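/- Let G be a finite connected simple graph. The connected subgraph arrangement 𝒜_G over ℚ is free (i.e. its module of 𝒜_G-derivations is a free module over the polynomial ring) if and only if G is isomorphic to a path graph P_m, a cycle graph C_m (m ≥ 3), an almost path graph A_{m,k} for some 1 < k < m, or a path-with-triangle graph Δ_{m,k} for some 1 ≤ k < m. -/

import Mathlib

open Finset

/-- The linear form `∑_{i ∈ I} x_i` on `ℚ^n`. -/
noncomputable def linForm {n : ℕ} (I : Finset (Fin n)) : (Fin n → ℚ) →ₗ[ℚ] ℚ :=
  ∑ i ∈ I, LinearMap.proj i

/-- `I` is a nonempty subset of vertices inducing a connected subgraph of `G`. -/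
def ConnSet {n : ℕ} (G : SimpleGraph (Fin n)) (I : Finset (Fin n)) : Prop :=
  I.Nonempty ∧ (G.induce (↑I : Set (Fin n))).Connected

/-- The connected subgraph arrangement of `G`, as a set of hyperplanes of `ℚ^n`. -/
def csa {n : ℕ} (G : SimpleGraph (Fin n)) : Set (Submodule ℚ (Fin n → ℚ)) :=
  {H | ∃ I : Finset (Fin n), ConnSet G I ∧ H = LinearMap.ker (linForm I)}

/-- The almost path graph `A_{n,k}` (paper notation, vertices `1,…,n+1` realized as
`Fin (n+1)` with `0,…,n`): a path `1–⋯–n` together with the edge `{k, n+1}`. -/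
def almostPath (n k : ℕ) : SimpleGraph (Fin (n + 1)) :=
  SimpleGraph.fromRel (fun a b =>
    (a.val + 1 = b.val ∧ b.val < n) ∨ (a.val = k - 1 ∧ b.val = n))

/-- The path-with-triangle graph `Δ_{n,k}` (paper notation): a path `1–⋯–n` together
with the edges `{k, n+1}` and `{k+1, n+1}`. -/
def pathTriangle (n k : ℕ) : SimpleGraph (Fin (n + 1)) :=
  SimpleGraph.fromRel (fun a b =>
    (a.val + 1 = b.val ∧ b.val < n) ∨ (a.val = k - 1 ∧ b.val = n) ∨ (a.val = k ∧ b.val = n))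

/-- The module of `𝒜_G`-derivations `D(𝒜_G) ⊆ Der_ℚ(ℚ[x_1,…,x_n])`. -/
noncomputable def derModule {n : ℕ} (G : SimpleGraph (Fin n)) :
    Submodule (MvPolynomial (Fin n) ℚ)
      (Derivation ℚ (MvPolynomial (Fin n) ℚ) (MvPolynomial (Fin n) ℚ)) where
  carrier := {θ | ∀ I : Finset (Fin n), ConnSet G I →
    (∑ i ∈ I, MvPolynomial.X i) ∣ θ (∑ i ∈ I, MvPolynomial.X i)}
  add_mem' := by
    intro a b ha hb I hI
    rw [Derivation.add_apply]
    exact dvd_add (ha I hI) (hb I hI)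
  zero_mem' := by
    intro I hI
    simp
  smul_mem' := by
    intro c θ hθ I hI
    rw [Derivation.smul_apply, smul_eq_mul]
    exact (hθ I hI).mul_left c

set_option linter.unusedSectionVars false


namespace CSA

section Lin
variable {σ : Type*} [Fintype σ] [DecidableEq σ]

/-- linear form with coefficients `a` -/
noncomputable def lin (a : σ → ℚ) : MvPolynomial σ ℚ := ∑ i, MvPolynomial.C (a i) * MvPolynomial.X i

/-- reduction modulo `lin a` -/
noncomputable def rho (a : σ → ℚ) (i0 : σ) : MvPolynomial σ ℚ →ₐ[ℚ] MvPolynomial σ ℚ :=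
  MvPolynomial.aeval (fun i => if i = i0 then MvPolynomial.X i0 - MvPolynomial.C (a i0)⁻¹ * lin a
    else MvPolynomial.X i)

lemma lin_add (a b : σ → ℚ) : lin (a + b) = lin a + lin b := by
  simp [lin, add_mul, Finset.sum_add_distrib]

lemma lin_sub (a b : σ → ℚ) : lin (a - b) = lin a - lin b := by
  simp [lin, sub_mul, Finset.sum_sub_distrib]

lemma lin_smul (c : ℚ) (a : σ → ℚ) : lin (c • a) = MvPolynomial.C c * lin a := by
  simp [lin, Finset.mul_sum, mul_assoc]

lemma lin_zero : lin (0 : σ → ℚ) = 0 := by simp [lin]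

lemma lin_eq_zero {a : σ → ℚ} (h : lin a = 0) : a = 0 := by
  funext j
  have := congrArg (MvPolynomial.eval (Pi.single j (1:ℚ))) h
  simpa [lin, Pi.single_apply] using this

lemma rho_X (a : σ → ℚ) (i0 i : σ) : rho a i0 (MvPolynomial.X i) =
    if i = i0 then MvPolynomial.X i0 - MvPolynomial.C (a i0)⁻¹ * lin a
    else MvPolynomial.X i := by simp [rho]

lemma rho_lin (a b : σ → ℚ) (i0 : σ) : rho a i0 (lin b) =
    lin (b - (b i0 * (a i0)⁻¹) • a) := by
  rw [lin_sub, lin_smul]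
  have : ∀ i, rho a i0 (MvPolynomial.C (b i) * MvPolynomial.X i) =
    MvPolynomial.C (b i) * MvPolynomial.X i - if i = i0 then
      MvPolynomial.C (b i0 * (a i0)⁻¹) * lin a else 0 := by
    intro i
    rw [map_mul, rho_X, ← MvPolynomial.algebraMap_eq, AlgHom.commutes]
    split_ifs with h
    · subst h
      simp [MvPolynomial.algebraMap_eq]; ring
    · simp
  conv_lhs => rw [lin]
  rw [map_sum, Finset.sum_congr rfl (fun i _ => this i), Finset.sum_sub_distrib]
  simp [lin]

lemma rho_self {a : σ → ℚ} {i0 : σ} (h : a i0 ≠ 0) : rho a i0 (lin a) = 0 := by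
  rw [rho_lin, mul_inv_cancel₀ h, one_smul, sub_self, lin_zero]

lemma lin_dvd_rho_sub (a : σ → ℚ) (i0 : σ) (f : MvPolynomial σ ℚ) :
    lin a ∣ rho a i0 f - f := by
  rw [← Ideal.mem_span_singleton, ← Ideal.Quotient.eq]
  have : (Ideal.Quotient.mkₐ ℚ (Ideal.span {lin a})).comp (rho a i0) =
      Ideal.Quotient.mkₐ ℚ (Ideal.span {lin a}) := by
    apply MvPolynomial.algHom_ext
    intro i
    simp only [AlgHom.comp_apply, Ideal.Quotient.mkₐ_eq_mk]
    rw [Ideal.Quotient.eq, Ideal.mem_span_singleton, rho_X]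
    split_ifs with h
    · subst h
      exact ⟨- MvPolynomial.C (a i)⁻¹, by ring⟩
    · simp
  exact DFunLike.congr_fun this f

lemma lin_dvd_iff {a : σ → ℚ} {i0 : σ} (h : a i0 ≠ 0) (f : MvPolynomial σ ℚ) :
    lin a ∣ f ↔ rho a i0 f = 0 := by
  constructor
  · rintro ⟨g, rfl⟩
    rw [map_mul, rho_self h, zero_mul]
  · intro h0
    have := lin_dvd_rho_sub a i0 f
    rw [h0, zero_sub] at this
    exact (dvd_neg).1 this

lemma prime_lin {a : σ → ℚ} (ha : a ≠ 0) : Prime (lin a) := by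
  obtain ⟨i0, h⟩ := Function.ne_iff.1 ha
  refine ⟨fun h0 => ha (lin_eq_zero h0), fun hu => ?_, fun f g hfg => ?_⟩
  · have := hu.map (rho a i0)
    rw [rho_self h] at this
    exact not_isUnit_zero this
  · rw [lin_dvd_iff h] at hfg ⊢
    rw [lin_dvd_iff h]
    rw [map_mul] at hfg
    exact mul_eq_zero.1 hfg

lemma lin_dvd_lin {a b : σ → ℚ} {i0 : σ} (h : a i0 ≠ 0) (hd : lin a ∣ lin b) :
    b = (b i0 * (a i0)⁻¹) • a := by
  rw [lin_dvd_iff h, rho_lin] at hd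
  exact sub_eq_zero.1 (lin_eq_zero hd)

lemma totalDegree_lin (a : σ → ℚ) : (lin a).totalDegree ≤ 1 := by
  refine (MvPolynomial.totalDegree_finsetSum _ _).trans (Finset.sup_le fun i _ => ?_)
  refine (MvPolynomial.totalDegree_mul _ _).trans ?_
  simp

lemma totalDegree_lin_eq {a : σ → ℚ} (ha : a ≠ 0) : (lin a).totalDegree = 1 := by
  refine le_antisymm (totalDegree_lin a) ?_
  by_contra hlt
  have h0 : (lin a).totalDegree = 0 := by omega
  rw [MvPolynomial.totalDegree_eq_zero_iff_eq_C] at h0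
  apply ha
  have hc : (lin a) = 0 := by
    rw [h0]
    simp [lin, MvPolynomial.coeff_sum, MvPolynomial.coeff_C_mul]
  exact lin_eq_zero hc

/-- indicator -/
def ind (I : Finset σ) : σ → ℚ := fun i => if i ∈ I then 1 else 0

/-- sum of variables in `I` -/
noncomputable def al (I : Finset σ) : MvPolynomial σ ℚ := ∑ i ∈ I, MvPolynomial.X i

lemma al_eq (I : Finset σ) : al I = lin (ind I) := by
  simp [al, lin, ind, Finset.sum_ite_mem]

lemma ind_ne_zero {I : Finset σ} (h : I.Nonempty) : ind I ≠ 0 := by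
  obtain ⟨i, hi⟩ := h
  intro h0
  have := congrFun h0 i
  simp [ind, hi] at this

lemma ind_inj {I J : Finset σ} (h : ind I = ind J) : I = J := by
  ext i
  have := congrFun h i
  simp only [ind] at this
  split_ifs at this <;> simp_all

lemma al_prime {I : Finset σ} (h : I.Nonempty) : Prime (al I) := by
  rw [al_eq]; exact prime_lin (ind_ne_zero h)

lemma al_dvd_al {I J : Finset σ} (hI : I.Nonempty) (hJ : J.Nonempty) (h : al I ∣ al J) : I = J := by
  obtain ⟨i, hi⟩ := hI
  rw [al_eq, al_eq] at h
  have h1 := lin_dvd_lin (i0 := i) (by simp [ind, hi]) h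
  by_cases hiJ : i ∈ J
  · apply ind_inj
    rw [h1]; simp [ind, hi, hiJ]
  · exfalso
    apply ind_ne_zero hJ
    rw [h1]; simp [ind, hiJ]

lemma al_relPrime {I J : Finset σ} (hI : I.Nonempty) (hJ : J.Nonempty) (h : I ≠ J) :
    IsRelPrime (al I) (al J) := by
  rw [(al_prime hI).irreducible.isRelPrime_iff_not_dvd]
  exact fun hd => h (al_dvd_al hI hJ hd)

end Lin

end CSA


namespace CSA

section Saito
variable {n : ℕ}

open Classical in
/-- finset of connected sets -/
noncomputable def conns (G : SimpleGraph (Fin n)) : Finset (Finset (Fin n)) :=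
  univ.filter (fun I => ConnSet G I)

lemma mem_conns {G : SimpleGraph (Fin n)} {I : Finset (Fin n)} : I ∈ conns G ↔ ConnSet G I := by
  simp [conns]

/-- defining polynomial -/
noncomputable def Q (G : SimpleGraph (Fin n)) : MvPolynomial (Fin n) ℚ := ∏ I ∈ conns G, al I

lemma Q_ne_zero (G : SimpleGraph (Fin n)) : Q G ≠ 0 :=
  Finset.prod_ne_zero_iff.2 fun _ hI => (al_prime (mem_conns.1 hI).1).ne_zero

lemma totalDegree_prod_al (s : Finset (Finset (Fin n))) (hs : ∀ I ∈ s, I.Nonempty) :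
    (∏ I ∈ s, al I : MvPolynomial (Fin n) ℚ).totalDegree = s.card := by
  induction s using Finset.induction_on with
  | empty => simp
  | insert I s hI ih =>
    rw [Finset.prod_insert hI, MvPolynomial.totalDegree_mul_of_isDomain, ih, card_insert_of_notMem hI,
      al_eq, totalDegree_lin_eq (ind_ne_zero (hs I (mem_insert_self _ _))), add_comm]
    · exact fun J hJ => hs J (mem_insert_of_mem hJ)
    · exact (al_prime (hs I (mem_insert_self _ _))).ne_zero
    · exact Finset.prod_ne_zero_iff.2 fun J hJ => (al_prime (hs J (mem_insert_of_mem hJ))).ne_zero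

lemma Q_dvd {G : SimpleGraph (Fin n)} {f : MvPolynomial (Fin n) ℚ}
    (h : ∀ I, ConnSet G I → al I ∣ f) : Q G ∣ f := by
  apply Finset.prod_dvd_of_isRelPrime
  · intro I hI J hJ hIJ
    exact al_relPrime (mem_conns.1 hI).1 (mem_conns.1 hJ).1 hIJ
  · exact fun I hI => h I (mem_conns.1 hI)

lemma al_dvd_det {M : Matrix (Fin n) (Fin n) (MvPolynomial (Fin n) ℚ)} {I : Finset (Fin n)}
    (hI : I.Nonempty) (h : ∀ k, al I ∣ ∑ i ∈ I, M k i) : al I ∣ M.det := by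
  obtain ⟨j, hj⟩ := hI
  choose g hg using h
  have h1 := Matrix.det_updateCol_sum M j (fun i => if i ∈ I then 1 else 0)
  have h2 : (fun k => ∑ i, (if i ∈ I then (1 : MvPolynomial (Fin n) ℚ) else 0) • M k i) = al I • g := by
    funext k
    simp [Finset.sum_ite_mem, hg]
  rw [h2, Matrix.det_updateCol_smul] at h1
  simp only [hj, if_true, one_smul] at h1
  exact ⟨_, h1.symm⟩

/-- Saito data -/
def SD (G : SimpleGraph (Fin n)) : Prop :=
  ∃ M : Matrix (Fin n) (Fin n) (MvPolynomial (Fin n) ℚ),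
    (∀ I, ConnSet G I → ∀ k, al I ∣ ∑ i ∈ I, M k i) ∧ M.det ≠ 0 ∧
    M.det.totalDegree ≤ (conns G).card

lemma mem_der {G : SimpleGraph (Fin n)}
    {θ : Derivation ℚ (MvPolynomial (Fin n) ℚ) (MvPolynomial (Fin n) ℚ)} :
    θ ∈ derModule G ↔ ∀ I, ConnSet G I → al I ∣ ∑ i ∈ I, θ (MvPolynomial.X i) := by
  show (∀ I : Finset (Fin n), ConnSet G I → _) ↔ _
  simp only [map_sum, al]

theorem SD.free {G : SimpleGraph (Fin n)} (h : SD G) :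
    Module.Free (MvPolynomial (Fin n) ℚ) (derModule G) := by
  obtain ⟨M, hM, hdet, hdeg⟩ := h
  have hQ : Q G ∣ M.det := Q_dvd fun I hI => al_dvd_det hI.1 (hM I hI)
  obtain ⟨c, hc⟩ := hQ
  have hc0 : c ≠ 0 := by rintro rfl; simp at hc; exact hdet hc
  have hcd : c.totalDegree = 0 := by
    rw [hc, MvPolynomial.totalDegree_mul_of_isDomain (Q_ne_zero G) hc0, Q, totalDegree_prod_al] at hdeg
    · omega
    · exact fun I hI => (mem_conns.1 hI).1
  rw [MvPolynomial.totalDegree_eq_zero_iff_eq_C] at hcd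
  set r := MvPolynomial.coeff 0 c with hr
  have hr0 : r ≠ 0 := by rintro h0; rw [h0] at hcd; simp at hcd; exact hc0 hcd
  let L : (Fin n → MvPolynomial (Fin n) ℚ) →ₗ[MvPolynomial (Fin n) ℚ]
      Derivation ℚ (MvPolynomial (Fin n) ℚ) (MvPolynomial (Fin n) ℚ) :=
    { toFun := fun f => MvPolynomial.mkDerivation ℚ (Matrix.vecMul f M)
      map_add' := fun f g => MvPolynomial.derivation_ext fun i => by
        simp [Matrix.add_vecMul]
      map_smul' := fun c f => MvPolynomial.derivation_ext fun i => by
        simp [Matrix.smul_vecMul] }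
  have hL : ∀ f i, L f (MvPolynomial.X i) = Matrix.vecMul f M i := by
    intro f i
    exact MvPolynomial.mkDerivation_X _ _ _
  have hinj : Function.Injective L := by
    intro f g hfg
    have : Matrix.vecMul (f - g) M = 0 := by
      rw [Matrix.sub_vecMul, sub_eq_zero]
      funext i
      rw [← hL, ← hL, hfg]
    exact sub_eq_zero.1 (Matrix.eq_zero_of_vecMul_eq_zero hdet this)
  have hrange : derModule G = LinearMap.range L := by
    apply le_antisymm
    · intro D hD
      set w : Fin n → MvPolynomial (Fin n) ℚ := fun i => D (MvPolynomial.X i) with hw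
      have hdiv : ∀ k, Q G ∣ (M.transpose.cramer w) k := by
        intro k
        rw [Matrix.cramer_transpose_apply]
        refine Q_dvd fun I hI => al_dvd_det hI.1 fun l => ?_
        by_cases hlk : l = k
        · subst hlk
          simpa using mem_der.1 hD I hI
        · simpa [Matrix.updateRow_ne hlk] using hM I hI l
      choose g hg using hdiv
      refine ⟨fun k => MvPolynomial.C r⁻¹ * g k, ?_⟩
      apply MvPolynomial.derivation_ext
      intro i
      have h1 := congrFun (Matrix.mulVec_cramer M.transpose w) i
      rw [Matrix.det_transpose] at h1
      simp only [Matrix.mulVec, dotProduct, Matrix.transpose_apply, hg, Pi.smul_apply, smul_eq_mul] at h1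
      have h2 : Q G * ∑ k, M k i * g k = Q G * (MvPolynomial.C r * w i) := by
        rw [Finset.mul_sum, ← mul_assoc, ← hcd, ← hc, ← h1]
        exact Finset.sum_congr rfl fun k _ => by ring
      have h3 := mul_left_cancel₀ (Q_ne_zero G) h2
      have : w i = MvPolynomial.C r⁻¹ * ∑ k, M k i * g k := by
        rw [h3, ← mul_assoc, ← MvPolynomial.C_mul, inv_mul_cancel₀ hr0, MvPolynomial.C_1, one_mul]
      rw [hL]
      show _ = w i
      rw [this, Finset.mul_sum, Matrix.vecMul, dotProduct]
      exact Finset.sum_congr rfl fun k _ => by ring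
    · rintro D ⟨f, rfl⟩
      rw [mem_der]
      intro I hI
      simp only [hL, Matrix.vecMul, dotProduct]
      rw [Finset.sum_comm]
      simp only [← Finset.mul_sum]
      exact Finset.dvd_sum fun k _ => (hM I hI k).mul_left _
  rw [hrange]
  exact Module.Free.of_equiv (LinearEquiv.ofInjective L hinj)

lemma connSet_map_iso {n' : ℕ} {G : SimpleGraph (Fin n)} {G' : SimpleGraph (Fin n')} (e : G ≃g G')
    {I : Finset (Fin n)} (h : ConnSet G I) : ConnSet G' (I.map e.toEquiv.toEmbedding) := by
  refine ⟨by simpa using h.1, ?_⟩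
  have hb : Set.BijOn e (I : Set (Fin n)) (I.map e.toEquiv.toEmbedding : Finset (Fin n')) := by
    rw [Finset.coe_map]
    exact e.injective.injOn.bijOn_image
  exact (SimpleGraph.Iso.connected_iff (e.induce hb)).1 h.2

lemma conns_card_le {n' : ℕ} {G : SimpleGraph (Fin n)} {G' : SimpleGraph (Fin n')} (e : G ≃g G') :
    (conns G).card ≤ (conns G').card := by
  apply Finset.card_le_card_of_injOn (fun I => I.map e.toEquiv.toEmbedding)
  · intro I hI
    exact mem_conns.2 (connSet_map_iso e (mem_conns.1 hI))
  · exact (Finset.map_injective _).injOn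

theorem SD.of_iso {n' : ℕ} {G : SimpleGraph (Fin n)} {G' : SimpleGraph (Fin n')} (e : G ≃g G')
    (h : SD G') : SD G := by
  have hn : n = n' := by simpa using Fintype.card_congr e.toEquiv
  subst hn
  obtain ⟨M, hM, hdet, hdeg⟩ := h
  let f : MvPolynomial (Fin n) ℚ →+* MvPolynomial (Fin n) ℚ :=
    (MvPolynomial.rename e.symm : MvPolynomial (Fin n) ℚ →ₐ[ℚ] _).toRingHom
  have hf : Function.Injective f := MvPolynomial.rename_injective _ e.symm.injective
  have hd : (f.mapMatrix (M.submatrix e.toEquiv e.toEquiv)).det = f M.det := by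
    rw [← RingHom.map_det, Matrix.det_submatrix_equiv_self]
  refine ⟨f.mapMatrix (M.submatrix e.toEquiv e.toEquiv), ?_, ?_, ?_⟩
  · intro I hI k
    have h1 := hM _ (connSet_map_iso e hI) (e k)
    have h2 := map_dvd f h1
    rw [map_sum, Finset.sum_map] at h2
    convert h2 using 1
    swap
    · rfl
    rw [al, al, map_sum, Finset.sum_map]
    refine Finset.sum_congr rfl fun x _ => ?_
    show _ = MvPolynomial.rename e.symm _
    rw [MvPolynomial.rename_X]
    congr 1
    exact (e.symm_apply_apply x).symm
  · rw [hd]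
    exact fun h0 => hdet (hf (by rw [h0, map_zero]))
  · rw [hd]
    exact (MvPolynomial.totalDegree_rename_le _ _).trans (hdeg.trans (conns_card_le e.symm))

end Saito
end CSA


namespace CSA

section Nec
variable {n : ℕ}

/-- vectors of values of logarithmic derivations -/
def LogVec (G : SimpleGraph (Fin n)) (w : Fin n → MvPolynomial (Fin n) ℚ) : Prop :=
  ∀ I, ConnSet G I → al I ∣ ∑ i ∈ I, w i

/-- evaluation on variables -/
noncomputable def evX (n : ℕ) : Derivation ℚ (MvPolynomial (Fin n) ℚ) (MvPolynomial (Fin n) ℚ)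
    →ₗ[MvPolynomial (Fin n) ℚ] (Fin n → MvPolynomial (Fin n) ℚ) where
  toFun θ i := θ (MvPolynomial.X i)
  map_add' θ η := by funext i; simp
  map_smul' c θ := by funext i; simp

lemma evX_injective : Function.Injective (evX n) := by
  intro θ η h
  exact MvPolynomial.derivation_ext fun i => congrFun h i

lemma mem_map_evX {G : SimpleGraph (Fin n)} {w : Fin n → MvPolynomial (Fin n) ℚ} :
    w ∈ (derModule G).map (evX n) ↔ LogVec G w := by
  constructor
  · rintro ⟨θ, hθ, rfl⟩
    exact mem_der.1 hθ
  · intro h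
    refine ⟨MvPolynomial.mkDerivation ℚ w, mem_der.2 ?_, ?_⟩
    · intro I hI; simpa using h I hI
    · funext i; exact MvPolynomial.mkDerivation_X _ _ _

lemma exists_basis_of_free {R : Type*} [CommRing R] [IsDomain R] [IsNoetherianRing R]
    (V : Submodule R (Fin n → R)) (q : R) (hq : q ≠ 0) (hV : ∀ w, q • w ∈ V)
    (hf : Module.Free R V) : ∃ M : Matrix (Fin n) (Fin n) R,
      (∀ w ∈ V, ∃ c, w = Matrix.vecMul c M) ∧ ∀ k, M k ∈ V := by
  have h1 : Module.finrank R V ≤ n := by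
    simpa using LinearMap.finrank_le_finrank_of_injective (f := V.subtype) V.injective_subtype
  have h2 : n ≤ Module.finrank R V := by
    let f : (Fin n → R) →ₗ[R] V := (q • LinearMap.id).codRestrict V (fun w => hV w)
    have hi : Function.Injective f := by
      intro a b hab
      have := congrArg Subtype.val hab
      exact smul_right_injective _ hq this
    simpa using LinearMap.finrank_le_finrank_of_injective hi
  let b := Module.finBasisOfFinrankEq R V (le_antisymm h1 h2)
  refine ⟨fun k => (b k : Fin n → R), fun w hw => ⟨b.repr ⟨w, hw⟩, ?_⟩, fun k => (b k).2⟩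
  have h3 := congrArg Subtype.val (b.sum_repr ⟨w, hw⟩)
  simp only [Submodule.coe_sum, Submodule.coe_smul] at h3
  funext i
  rw [← congrFun h3 i]
  simp [Matrix.vecMul, dotProduct]

/-- product of all other forms -/
noncomputable def Qo (G : SimpleGraph (Fin n)) (J : Finset (Fin n)) : MvPolynomial (Fin n) ℚ :=
  ∏ I ∈ (conns G).erase J, al I

lemma al_dvd_Qo {G : SimpleGraph (Fin n)} {I J : Finset (Fin n)} (hI : ConnSet G I) (h : I ≠ J) :
    al I ∣ Qo G J := Finset.dvd_prod_of_mem _ (mem_erase.2 ⟨h, mem_conns.2 hI⟩)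

lemma al_dvd_Q {G : SimpleGraph (Fin n)} {I : Finset (Fin n)} (hI : ConnSet G I) :
    al I ∣ Q G := Finset.dvd_prod_of_mem _ (mem_conns.2 hI)

theorem saito_nec {G : SimpleGraph (Fin n)}
    (hf : Module.Free (MvPolynomial (Fin n) ℚ) (derModule G)) :
    ∃ M : Matrix (Fin n) (Fin n) (MvPolynomial (Fin n) ℚ),
      (∀ k, LogVec G (M k)) ∧ M.det ∣ Q G := by
  have hf' : Module.Free (MvPolynomial (Fin n) ℚ) ((derModule G).map (evX n)) :=
    Module.Free.of_equiv (Submodule.equivMapOfInjective (evX n) evX_injective (derModule G))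
  obtain ⟨M, hM, hMk⟩ := exists_basis_of_free _ (Q G) (Q_ne_zero G) (fun w => by
    rw [mem_map_evX]; intro I hI
    simp only [Pi.smul_apply, smul_eq_mul, ← Finset.mul_sum]
    exact (al_dvd_Q hI).mul_right _) hf'
  have hM' : ∀ w, LogVec G w → ∃ c, w = Matrix.vecMul c M := fun w hw => hM w (mem_map_evX.2 hw)
  refine ⟨M, fun k => mem_map_evX.1 (hMk k), ?_⟩
  have hdet : ∀ N : Matrix (Fin n) (Fin n) (MvPolynomial (Fin n) ℚ), (∀ k, LogVec G (N k)) →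
      M.det ∣ N.det := by
    intro N hN
    choose c hc using fun k => hM' (N k) (hN k)
    have : N = Matrix.of c * M := by
      ext1 k i
      rw [hc k, Matrix.mul_apply]; rfl
    rw [this, Matrix.det_mul]
    exact dvd_mul_left _ _
  have hA : M.det ∣ Q G ^ n := by
    have := hdet (Matrix.diagonal fun _ => Q G) (fun k I hI => Finset.dvd_sum fun i _ => by
      rw [Matrix.diagonal_apply]
      split_ifs
      · exact al_dvd_Q hI
      · exact dvd_zero _)
    simpa using this
  have hB : ∀ J, ConnSet G J → ¬ (al J * al J ∣ M.det) := by
    intro J hJ hdvd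
    obtain ⟨j0, hj0⟩ := hJ.1
    let N : Matrix (Fin n) (Fin n) (MvPolynomial (Fin n) ℚ) := fun j i =>
      if j = j0 then (if i = j0 then Qo G J * al J else 0) else
        Qo G J * ((if i = j then 1 else 0) - (if j ∈ J ∧ i = j0 then 1 else 0))
    have hsum : ∀ j, ∑ i ∈ J, N j i = if j = j0 then Qo G J * al J else 0 := by
      intro j
      by_cases hj : j = j0
      · simp [N, hj, hj0]
      · simp only [N, hj, if_false, ← Finset.mul_sum, Finset.sum_sub_distrib]
        by_cases hjJ : j ∈ J <;> simp [hjJ, hj0]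
    have hlog : ∀ k, LogVec G (N k) := by
      intro k I hI
      by_cases hIJ : I = J
      · subst hIJ
        rw [hsum]
        split_ifs
        · exact dvd_mul_left _ _
        · exact dvd_zero _
      · refine Finset.dvd_sum fun i _ => ?_
        simp only [N]
        split_ifs
        all_goals first
          | exact dvd_zero _
          | exact (al_dvd_Qo hI hIJ).mul_right _
    have h1 := hdet N hlog
    have h2 := Matrix.det_updateCol_sum N j0 (fun i => if i ∈ J then 1 else 0)
    have h3 : N.updateCol j0 (fun k => ∑ i, (if i ∈ J then (1 : MvPolynomial (Fin n) ℚ) else 0) • N k i)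
        = Matrix.diagonal (fun j => if j = j0 then Qo G J * al J else Qo G J) := by
      ext1 k i
      rw [Matrix.updateCol_apply, Matrix.diagonal_apply]
      split_ifs with h4 h5 h6 h7 h8
      · simp [Finset.sum_ite_mem, hsum, h6]
      · exact absurd (h5.trans h4) h6
      · have : k ≠ j0 := fun h => h5 (h.trans h4.symm)
        simp [Finset.sum_ite_mem, hsum, this]
      · exact absurd (h7.symm.trans h8) h4
      · simp [N, h8, h7.symm]
      · simp only [N, h4]
        have h9 : ¬ i = k := fun h => h7 h.symm
        simp [h9]
    rw [h3, Matrix.det_diagonal] at h2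
    simp only [hj0, if_true, one_smul] at h2
    rw [← h2, ← Finset.mul_prod_erase _ _ (mem_univ j0), if_pos rfl] at h1
    have h5 := hdvd.trans h1
    have h6 : al J * al J ∣ al J * (Qo G J * ∏ x ∈ univ.erase j0, if x = j0 then Qo G J * al J else Qo G J) := by
      convert h5 using 1; ring
    have hp := al_prime hJ.1
    have h7 := (mul_dvd_mul_iff_left hp.ne_zero).1 h6
    have h8 : ¬ al J ∣ Qo G J := by
      intro h
      obtain ⟨I, hI, hd⟩ := (hp.dvd_finsetProd_iff _).1 h
      rw [mem_erase, mem_conns] at hI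
      exact hI.1 (al_dvd_al hJ.1 hI.2.1 hd).symm
    rcases hp.dvd_or_dvd h7 with h | h
    · exact h8 h
    · obtain ⟨x, hx, hd⟩ := (hp.dvd_finsetProd_iff _).1 h
      rw [if_neg (mem_erase.1 hx).1] at hd
      exact h8 hd
  have h0 : M.det ≠ 0 := by
    intro h; rw [h, zero_dvd_iff] at hA
    exact pow_ne_zero _ (Q_ne_zero G) hA
  have hsq : Squarefree M.det := by
    rw [squarefree_iff_irreducible_sq_not_dvd_of_ne_zero h0]
    intro x hx hdvd
    have hxp : Prime x := hx.prime
    have h1 : x ∣ Q G := hxp.dvd_of_dvd_pow ((dvd_of_mul_left_dvd hdvd).trans hA)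
    obtain ⟨I, hI, hd⟩ := (hxp.dvd_finsetProd_iff _).1 h1
    rw [mem_conns] at hI
    have hass : Associated x (al I) := hx.associated_of_dvd (al_prime hI.1).irreducible hd
    apply hB I hI
    exact ((hass.mul_mul hass).dvd_iff_dvd_left).1 hdvd
  by_cases hn : n = 0
  · subst hn
    simp at hA
    simp
  · exact (hsq.dvd_pow_iff_dvd hn).1 hA

/-- restriction to the line `v + s p` -/
noncomputable def lineEv (v p : Fin n → ℚ) : MvPolynomial (Fin n) ℚ →ₐ[ℚ] Polynomial ℚ :=
  MvPolynomial.aeval (fun i => Polynomial.C (v i) + Polynomial.X * Polynomial.C (p i))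

lemma lineEv_al (v p : Fin n → ℚ) (I : Finset (Fin n)) :
    lineEv v p (al I) = Polynomial.C (∑ i ∈ I, v i) + Polynomial.X * Polynomial.C (∑ i ∈ I, p i) := by
  simp [lineEv, al, map_sum, Finset.sum_add_distrib, Finset.mul_sum]

theorem nonfree_key {G : SimpleGraph (Fin n)}
    (hf : Module.Free (MvPolynomial (Fin n) ℚ) (derModule G)) (v p : Fin n → ℚ)
    (Z : Finset (Finset (Fin n))) (hZ : ∀ J, ConnSet G J → (∑ i ∈ J, v i = 0) → J ∈ Z)
    (hZ0 : ∀ J ∈ Z, ∑ i ∈ J, v i = 0)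
    (hp : ∀ J ∈ Z, ∑ i ∈ J, p i ≠ 0)
    {d : ℕ} (γ : Fin d → Fin n → ℚ) (hγ : LinearIndependent ℚ γ) (e : Fin d → ℕ)
    (he : ∀ w, LogVec G w → ∀ i, Polynomial.X ^ (e i) ∣
      ∑ j, Polynomial.C (γ i j) * lineEv v p (w j)) :
    ∑ i, e i ≤ Z.card := by
  obtain ⟨M, hM, hdet⟩ := saito_nec hf
  -- extend to a basis
  let b := Module.Basis.sumExtend hγ
  have hfin : Finite (Fin d ⊕ Module.Basis.sumExtendIndex hγ) := Module.Finite.finite_basis b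
  have hfin' : Finite (Module.Basis.sumExtendIndex hγ) := Finite.sum_right (Fin d)
  have : Fintype (Module.Basis.sumExtendIndex hγ) := Fintype.ofFinite _
  have hcard : Fintype.card (Fin d ⊕ Module.Basis.sumExtendIndex hγ) = n := by
    rw [← Module.finrank_eq_card_basis b]; simp
  let ε : (Fin d ⊕ Module.Basis.sumExtendIndex hγ) ≃ Fin n := Fintype.equivFinOfCardEq hcard
  let B : Matrix (Fin n) (Fin n) ℚ := Matrix.of fun k => b (ε.symm k)
  have hB : IsUnit B := by
    rw [← Matrix.linearIndependent_rows_iff_isUnit]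
    have h := (b.reindex ε).linearIndependent
    convert h using 1; funext k; simp [B]; rfl
  have hBdet : B.det ≠ 0 := ((Matrix.isUnit_iff_isUnit_det _).1 hB).ne_zero
  let e' : Fin n → ℕ := fun k => Sum.elim e (fun _ => 0) (ε.symm k)
  have hsum : ∑ k, e' k = ∑ i, e i := by
    rw [← Equiv.sum_comp ε e']
    simp [e', Fintype.sum_sum_type]
  let N : Matrix (Fin n) (Fin n) (Polynomial ℚ) :=
    (lineEv v p).toRingHom.mapMatrix M * (Polynomial.C.mapMatrix B).transpose
  have hN : ∀ k i, Polynomial.X ^ (e' i) ∣ N k i := by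
    intro k i
    rcases hi : ε.symm i with x | x
    · have h1 := he (M k) (hM k) x
      have h2 : e' i = e x := by simp [e', hi]
      rw [h2]
      convert h1 using 1
      simp only [N, Matrix.mul_apply]
      refine Finset.sum_congr rfl fun j _ => ?_
      rw [mul_comm]
      have h3 : B i j = γ x j := by
        have : Module.Basis.sumExtend hγ (Sum.inl x) = γ x := by
          simp [Module.Basis.sumExtend]
          rfl
        show b (ε.symm i) j = _
        rw [hi]
        exact congrFun this j
      rw [← h3]
      rfl
    · have h2 : e' i = 0 := by simp [e', hi]
      rw [h2, pow_zero]
      exact one_dvd _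
  choose N' hN' using hN
  have hNd : N = Matrix.of N' * Matrix.diagonal (fun i => Polynomial.X ^ (e' i)) := by
    ext1 k i
    rw [Matrix.mul_diagonal, hN', mul_comm]; rfl
  have h1 : (Polynomial.X : Polynomial ℚ) ^ (∑ i, e i) ∣ N.det := by
    rw [hNd, Matrix.det_mul, Matrix.det_diagonal, Finset.prod_pow_eq_pow_sum, hsum]
    exact dvd_mul_left _ _
  have h2 : N.det = lineEv v p M.det * Polynomial.C B.det := by
    simp only [N]
    rw [Matrix.det_mul, Matrix.det_transpose, ← RingHom.map_det, ← RingHom.map_det]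
    rfl
  have hu : IsUnit (Polynomial.C B.det) := (isUnit_iff_ne_zero.2 hBdet).map Polynomial.C
  rw [h2, hu.dvd_mul_right] at h1
  have h3 := h1.trans (map_dvd (lineEv v p) hdet)
  rw [Q, map_prod] at h3
  by_contra hlt
  push Not at hlt
  have h4 : (Polynomial.X : Polynomial ℚ) ^ (Z.card + 1) ∣ ∏ J ∈ conns G, lineEv v p (al J) :=
    (pow_dvd_pow _ hlt).trans h3
  classical
  rw [← Finset.prod_filter_mul_prod_filter_not (conns G) (fun J => J ∈ Z)] at h4
  have h5 : ∏ J ∈ conns G with J ∈ Z, lineEv v p (al J) ∣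
      Polynomial.X ^ Z.card * ∏ J ∈ Z, Polynomial.C (∑ i ∈ J, p i)  := by
    have h6 : Polynomial.X ^ Z.card * ∏ J ∈ Z, Polynomial.C (∑ i ∈ J, p i) =
        ∏ J ∈ Z, Polynomial.X * Polynomial.C (∑ i ∈ J, p i) := by
      rw [Finset.prod_mul_distrib, Finset.prod_const]
    rw [h6]
    have h8 : ∏ J ∈ conns G with J ∈ Z, lineEv v p (al J) =
        ∏ J ∈ conns G with J ∈ Z, Polynomial.X * Polynomial.C (∑ i ∈ J, p i) := by
      refine Finset.prod_congr rfl fun J hJ => ?_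
      rw [lineEv_al, hZ0 J (mem_filter.1 hJ).2, Polynomial.C_0, zero_add]
    rw [h8]
    exact Finset.prod_dvd_prod_of_subset _ _ _ fun J hJ => (mem_filter.1 hJ).2
  have h6 : (Polynomial.X : Polynomial ℚ) ∣ (∏ J ∈ Z, Polynomial.C (∑ i ∈ J, p i)) *
      ∏ J ∈ conns G with J ∉ Z, lineEv v p (al J) := by
    have h7 := h4.trans (mul_dvd_mul_right h5 _)
    rw [pow_succ, mul_assoc] at h7
    exact (mul_dvd_mul_iff_left (pow_ne_zero _ Polynomial.X_ne_zero)).1 h7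
  rcases Polynomial.prime_X.dvd_or_dvd h6 with h | h
  · obtain ⟨J, hJ, hd⟩ := (Polynomial.prime_X.dvd_finsetProd_iff _).1 h
    rw [Polynomial.X_dvd_iff] at hd
    simp only [Polynomial.coeff_C_zero] at hd
    exact hp J hJ hd
  · obtain ⟨J, hJ, hd⟩ := (Polynomial.prime_X.dvd_finsetProd_iff _).1 h
    rw [Polynomial.X_dvd_iff, lineEv_al] at hd
    rw [mem_filter, mem_conns] at hJ
    refine hJ.2 (hZ J hJ.1 ?_)
    simpa using hd

end Nec
end CSA


namespace CSA

section Trunc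
variable {r : ℕ}

/-- truncation below degree `e` -/
noncomputable def trunc (e : ℕ) : MvPolynomial (Fin r) ℚ →ₗ[ℚ] MvPolynomial (Fin r) ℚ :=
  ∑ i ∈ range e, MvPolynomial.homogeneousComponent i

lemma coeff_trunc (e : ℕ) (f : MvPolynomial (Fin r) ℚ) (d : Fin r →₀ ℕ) :
    (trunc e f).coeff d = if d.degree < e then f.coeff d else 0 := by
  simp [trunc, LinearMap.sum_apply, MvPolynomial.coeff_sum, MvPolynomial.coeff_homogeneousComponent]

lemma trunc_X_mul (e : ℕ) (j : Fin r) (f : MvPolynomial (Fin r) ℚ) :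
    trunc (e + 1) (MvPolynomial.X j * f) = MvPolynomial.X j * trunc e f := by
  ext d
  rw [coeff_trunc, MvPolynomial.coeff_X_mul', MvPolynomial.coeff_X_mul', coeff_trunc]
  split_ifs with h1 h2 h3 h3
  · rfl
  · exfalso
    apply h3
    have : d = (d - Finsupp.single j 1) + Finsupp.single j 1 := by
      rw [tsub_add_cancel_of_le]
      rw [Finsupp.single_le_iff]
      exact Nat.one_le_iff_ne_zero.2 (Finsupp.mem_support_iff.1 h2)
    have h4 : d.degree = (d - Finsupp.single j 1).degree + 1 := by
      conv_lhs => rw [this]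
      rw [map_add, Finsupp.degree_single]
    omega
  · rfl
  · exfalso
    apply h1
    have : d = (d - Finsupp.single j 1) + Finsupp.single j 1 := by
      rw [tsub_add_cancel_of_le]
      rw [Finsupp.single_le_iff]
      exact Nat.one_le_iff_ne_zero.2 (Finsupp.mem_support_iff.1 h3)
    have h4 : d.degree = (d - Finsupp.single j 1).degree + 1 := by
      conv_lhs => rw [this]
      rw [map_add, Finsupp.degree_single]
    omega
  · rfl
  · rfl

lemma trunc_al_mul (e : ℕ) (K : Finset (Fin r)) (f : MvPolynomial (Fin r) ℚ) :
    trunc (e + 1) (al K * f) = al K * trunc e f := by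
  simp only [al, Finset.sum_mul, map_sum, trunc_X_mul]

lemma totalDegree_trunc {e : ℕ} (he : 0 < e) (f : MvPolynomial (Fin r) ℚ) :
    (trunc e f).totalDegree < e := by
  have : (trunc e f).totalDegree ≤ e - 1 := by
    rw [trunc, LinearMap.sum_apply]
    refine MvPolynomial.totalDegree_finsetSum_le fun i hi => ?_
    have := (MvPolynomial.homogeneousComponent_isHomogeneous i f).totalDegree_le
    have := mem_range.1 hi
    omega
  omega

/-- evaluation on the line through the origin in direction `p` -/
noncomputable def rayEv (p : Fin r → ℚ) : MvPolynomial (Fin r) ℚ →ₐ[ℚ] Polynomial ℚ :=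
  MvPolynomial.aeval (fun j => Polynomial.X * Polynomial.C (p j))

lemma rayEv_dvd {e : ℕ} {f : MvPolynomial (Fin r) ℚ} (h : trunc e f = 0) (p : Fin r → ℚ) :
    Polynomial.X ^ e ∣ rayEv p f := by
  rw [rayEv, MvPolynomial.aeval_def, MvPolynomial.eval₂_eq']
  refine Finset.dvd_sum fun d hd => Dvd.dvd.mul_left ?_ _
  have h1 : e ≤ d.degree := by
    by_contra hlt
    have := coeff_trunc e f d
    rw [h, if_pos (not_le.1 hlt)] at this
    exact MvPolynomial.mem_support_iff.1 hd this.symm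
  simp only [mul_pow, Finset.prod_mul_distrib, Finset.prod_pow_eq_pow_sum]
  rw [← Finsupp.degree_eq_sum]
  exact (pow_dvd_pow _ h1).mul_right _

lemma rayEv_al (p : Fin r → ℚ) (K : Finset (Fin r)) :
    rayEv p (al K) = Polynomial.X * Polynomial.C (∑ j ∈ K, p j) := by
  simp [rayEv, al, map_sum, Finset.mul_sum]

end Trunc

section Generic
variable {n r : ℕ}

lemma exists_generic (W : Fin r → Finset (Fin n)) (hW : ∀ i j, i ≠ j → Disjoint (W i) (W j))
    (w : Fin r → Fin n) (hw : ∀ j, w j ∈ W j) (u : Fin r → ℚ) :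
    ∃ v : Fin n → ℚ, (∀ j, ∑ i ∈ W j, v i = u j) ∧
      ∀ J : Finset (Fin n), ∑ i ∈ J, v i = 0 → J = (univ.filter (fun j => w j ∈ J)).biUnion W := by
  classical
  have hmem : ∀ i j, w i ∈ W j ↔ i = j := by
    intro i j
    refine ⟨fun h => ?_, fun h => h ▸ hw i⟩
    by_contra hne
    exact Finset.disjoint_left.1 (hW i j hne) (hw i) h
  have winj : ∀ i j, w i = w j ↔ i = j := by
    intro i j
    refine ⟨fun h => ?_, fun h => h ▸ rfl⟩
    rw [← hmem, h]; exact hw j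
  let V : Fin n → Polynomial ℚ := fun l => (if ∃ j, l = w j then 0 else Polynomial.X ^ (l.val + 1)) +
    ∑ j, if l = w j then (Polynomial.C (u j) - ∑ i ∈ (W j).erase (w j), Polynomial.X ^ (i.val + 1)) else 0
  have hVw : ∀ j, V (w j) = Polynomial.C (u j) - ∑ i ∈ (W j).erase (w j), Polynomial.X ^ (i.val + 1) := by
    intro j
    simp only [V, winj]
    simp
  have hVn : ∀ l, (¬ ∃ j, l = w j) → V l = Polynomial.X ^ (l.val + 1) := by
    intro l hl
    simp only [V]
    rw [if_neg hl, Finset.sum_eq_zero, add_zero]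
    intro j _
    rw [if_neg fun h => hl ⟨j, h⟩]
  have hVsum : ∀ j, ∑ i ∈ W j, V i = Polynomial.C (u j) := by
    intro j
    rw [← Finset.add_sum_erase _ _ (hw j), hVw, Finset.sum_congr rfl (fun l hl => hVn l ?_)]
    · ring
    · rintro ⟨j', rfl⟩
      rw [mem_erase, hmem] at hl
      exact hl.1 (by rw [hl.2])
  have hcoeff : ∀ i l : Fin n, (¬ ∃ j, i = w j) → (V l).coeff (i.val + 1) =
      (if l = i then 1 else 0) - (if ∃ j, i ∈ W j ∧ l = w j then 1 else 0) := by
    intro i l hi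
    by_cases hl : ∃ j, l = w j
    · obtain ⟨j, rfl⟩ := hl
      have h1 : ¬ (w j = i) := fun h => hi ⟨j, h.symm⟩
      rw [hVw, if_neg h1, Polynomial.coeff_sub, Polynomial.finsetSum_coeff]
      simp only [Polynomial.coeff_X_pow, Polynomial.coeff_C_succ, winj]
      have : ∀ x : Fin n, (i.val + 1 = x.val + 1) ↔ i = x := fun x => by
        rw [add_left_inj, Fin.val_inj]
      simp only [this]
      congr 1
      simp only [Finset.sum_ite_eq, mem_erase]
      have h2 : (∃ j', i ∈ W j' ∧ j = j') ↔ i ∈ W j := by simp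
      simp only [h2]
      have h3 : i ≠ w j := fun h => h1 h.symm
      simp [h3]
    · rw [hVn l hl, Polynomial.coeff_X_pow]
      rw [if_neg (c := ∃ j, i ∈ W j ∧ l = w j) (fun ⟨j, _, h⟩ => hl ⟨j, h⟩)]
      simp only [add_left_inj, Fin.val_inj, sub_zero]
      simp [eq_comm]
  have hne : ∀ J : Finset (Fin n), J ≠ (univ.filter (fun j => w j ∈ J)).biUnion W → ∑ i ∈ J, V i ≠ 0 := by
    intro J hJ h0
    apply hJ
    have hc : ∀ i, (¬ ∃ j, i = w j) → ((if i ∈ J then (1:ℚ) else 0) = if ∃ j, i ∈ W j ∧ w j ∈ J then 1 else 0) := by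
      intro i hi
      have h1 := congrArg (fun f => Polynomial.coeff f (i.val + 1)) h0
      simp only [Polynomial.finsetSum_coeff, Polynomial.coeff_zero] at h1
      rw [Finset.sum_congr rfl (fun l _ => hcoeff i l hi), Finset.sum_sub_distrib, sub_eq_zero] at h1
      rw [Finset.sum_ite_eq'] at h1
      rw [h1]
      by_cases hi2 : ∃ j, i ∈ W j
      · obtain ⟨j, hj⟩ := hi2
        have h3 : ∀ j', i ∈ W j' ↔ j' = j := by
          intro j'
          refine ⟨fun h => ?_, fun h => h ▸ hj⟩
          by_contra hne
          exact Finset.disjoint_left.1 (hW _ _ hne) h hj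
        simp only [h3]
        simp
      · push Not at hi2
        simp [hi2]
    ext i
    rw [mem_biUnion]
    simp only [mem_filter, mem_univ, true_and]
    by_cases hi : ∃ j, i = w j
    · obtain ⟨j, rfl⟩ := hi
      simp [hmem]
    · have := hc i hi
      have h2 : (∃ a, w a ∈ J ∧ i ∈ W a) ↔ ∃ j, i ∈ W j ∧ w j ∈ J := by
        simp only [and_comm]
      rw [h2]
      split_ifs at this <;> simp_all
  have hprod : (∏ J ∈ univ.filter (fun J : Finset (Fin n) => J ≠ (univ.filter (fun j => w j ∈ J)).biUnion W),
      ∑ i ∈ J, V i) ≠ 0 := by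
    rw [Finset.prod_ne_zero_iff]
    intro J hJ
    exact hne J (mem_filter.1 hJ).2
  obtain ⟨N, hN⟩ : ∃ N : ℚ, Polynomial.eval N (∏ J ∈ univ.filter (fun J : Finset (Fin n) => J ≠ (univ.filter (fun j => w j ∈ J)).biUnion W),
      ∑ i ∈ J, V i) ≠ 0 := by
    by_contra hall
    push Not at hall
    exact hprod (Polynomial.funext fun x => by rw [hall x, Polynomial.eval_zero])
  refine ⟨fun i => (V i).eval N, ?_, ?_⟩
  · intro j
    rw [← Polynomial.eval_finsetSum, hVsum, Polynomial.eval_C]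
  · intro J hJ
    by_contra hJ2
    rw [Polynomial.eval_prod, Finset.prod_ne_zero_iff] at hN
    apply hN J (mem_filter.2 ⟨mem_univ _, hJ2⟩)
    rw [Polynomial.eval_finsetSum, hJ]

end Generic
end CSA


namespace CSA

section NF
variable {n r : ℕ}

theorem nonfree_block {G : SimpleGraph (Fin n)}
    (hf : Module.Free (MvPolynomial (Fin n) ℚ) (derModule G))
    (W : Fin r → Finset (Fin n)) (hW : ∀ i j, i ≠ j → Disjoint (W i) (W j))
    (hWne : ∀ j, (W j).Nonempty) (u p : Fin r → ℚ) (𝒦 : Finset (Finset (Fin r)))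
    (hK1 : ∀ K ∈ 𝒦, ConnSet G (K.biUnion W)) (hK2 : ∀ K ∈ 𝒦, ∑ j ∈ K, u j = 0)
    (hK3 : ∀ K, K.Nonempty → ∑ j ∈ K, u j = 0 → ConnSet G (K.biUnion W) → K ∈ 𝒦)
    (hp : ∀ K ∈ 𝒦, ∑ j ∈ K, p j ≠ 0)
    {d e : ℕ} (he : 0 < e) (K : Fin (d + 1) → Finset (Fin r)) (hK : ∀ i, K i ∈ 𝒦)
    (hli : LinearIndependent ℚ (fun i => ind (K i)))
    (hE : ∀ (q : Fin r → MvPolynomial (Fin r) ℚ) (h : Finset (Fin r) → MvPolynomial (Fin r) ℚ),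
      (∀ L ∈ 𝒦, ∑ j ∈ L, q j = al L * h L) → (∀ L ∈ 𝒦, (h L).totalDegree < e) →
      ∀ i, h (K i) = h (K 0)) :
    1 + d * (e + 1) ≤ 𝒦.card := by
  classical
  choose w hw using hWne
  obtain ⟨v, hv1, hv2⟩ := exists_generic W hW w hw u
  have hmem : ∀ i j, w i ∈ W j ↔ i = j := by
    intro i j
    refine ⟨fun h => ?_, fun h => h ▸ hw i⟩
    by_contra hne
    exact Finset.disjoint_left.1 (hW i j hne) (hw i) h
  have hwK : ∀ (L : Finset (Fin r)) j, w j ∈ L.biUnion W ↔ j ∈ L := by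
    intro L j
    simp [hmem]
  have hsumW : ∀ {M : Type} [AddCommMonoid M] (L : Finset (Fin r)) (f : Fin n → M),
      ∑ i ∈ L.biUnion W, f i = ∑ j ∈ L, ∑ i ∈ W j, f i := by
    intro M _ L f
    exact Finset.sum_biUnion fun i _ j _ hij => hW i j hij
  let P : Fin n → ℚ := fun i => ∑ j, if w j = i then p j else 0
  have hPW : ∀ L : Finset (Fin r), ∑ i ∈ L.biUnion W, P i = ∑ j ∈ L, p j := by
    intro L
    simp only [P]
    rw [Finset.sum_comm]
    simp only [Finset.sum_ite_eq, hwK]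
    rw [Finset.sum_ite_mem, univ_inter]
  have hvW : ∀ L : Finset (Fin r), ∑ i ∈ L.biUnion W, v i = ∑ j ∈ L, u j := by
    intro L
    rw [hsumW]
    exact Finset.sum_congr rfl fun j _ => hv1 j
  -- substitution
  let φ : MvPolynomial (Fin n) ℚ →ₐ[ℚ] MvPolynomial (Fin r) ℚ := MvPolynomial.aeval fun i =>
    MvPolynomial.C (v i) + ∑ j, if w j = i then MvPolynomial.X j else 0
  have hφal : ∀ L ∈ 𝒦, φ (al (L.biUnion W)) = al L := by
    intro L hL
    simp only [φ, al, map_sum, MvPolynomial.aeval_X]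
    rw [Finset.sum_add_distrib, ← map_sum, hvW, hK2 L hL, map_zero, zero_add, Finset.sum_comm]
    simp only [Finset.sum_ite_eq, hwK]
    rw [Finset.sum_ite_mem, univ_inter]
  have hφline : ∀ f, lineEv v P f = rayEv p (φ f) := by
    intro f
    have : lineEv v P = (rayEv p).comp φ := by
      apply MvPolynomial.algHom_ext
      intro i
      simp only [lineEv, φ, rayEv, AlgHom.comp_apply, MvPolynomial.aeval_X, map_add, map_sum,
        MvPolynomial.algHom_C, P]
      congr 1
      rw [Finset.mul_sum]
      refine Finset.sum_congr rfl fun j _ => ?_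
      split_ifs <;> simp
    rw [this]; rfl
  -- the forms
  let t : Fin (d + 1) → ℚ := fun i => if i = 0 then 0 else (∑ j ∈ K i, p j) / (∑ j ∈ K 0, p j)
  let c : Fin (d + 1) → Fin r → ℚ := fun i j => ind (K i) j - t i * ind (K 0) j
  let γ : Fin (d + 1) → Fin n → ℚ := fun i l => ∑ j, c i j * ind (W j) l
  have hγw : ∀ i j, γ i (w j) = c i j := by
    intro i j
    simp [γ, ind, hmem]
  have hcli : LinearIndependent ℚ c := by
    rw [Fintype.linearIndependent_iff] at hli ⊢
    intro g hg
    let g' : Fin (d + 1) → ℚ := fun i => g i - if i = 0 then ∑ i, g i * t i else 0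
    have h1 : ∑ i, g' i • ind (K i) = 0 := by
      rw [← hg]
      funext j
      simp only [Finset.sum_apply, Pi.smul_apply, smul_eq_mul, g', c, mul_sub, sub_mul,
        Finset.sum_sub_distrib, ite_mul, zero_mul, Finset.sum_ite_eq', mem_univ, if_true]
      rw [Finset.sum_mul]
      congr 1
      exact Finset.sum_congr rfl fun i _ => by ring
    have h2 := hli g' h1
    have h3 : ∀ i, i ≠ 0 → g i = 0 := by
      intro i hi
      have := h2 i
      simpa [g', hi] using this
    intro i
    by_cases hi : i = 0
    · subst hi
      have h4 := h2 0
      have h5 : ∑ i, g i * t i = 0 := by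
        refine Finset.sum_eq_zero fun i _ => ?_
        by_cases hi : i = 0
        · simp [hi, t]
        · rw [h3 i hi, zero_mul]
      simpa [g', h5] using h4
    · exact h3 i hi
  have hγli : LinearIndependent ℚ γ := by
    have : LinearIndependent ℚ ((LinearMap.funLeft ℚ ℚ w) ∘ γ) := by
      convert hcli using 1
      funext i j
      exact hγw i j
    exact this.of_comp _
  let ex : Fin (d + 1) → ℕ := fun i => if i = 0 then 1 else e + 1
  have hex : ∑ i, ex i = 1 + d * (e + 1) := by
    rw [Fin.sum_univ_succ]
    simp [ex]
  rw [← hex]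
  refine le_trans (nonfree_key hf v P (𝒦.image fun L => L.biUnion W) ?_ ?_ ?_ γ hγli ex ?_) card_image_le
  · intro J hJ hJ0
    have h1 := hv2 J hJ0
    rw [mem_image]
    refine ⟨_, hK3 _ ?_ ?_ ?_, h1.symm⟩
    · by_contra hne
      rw [not_nonempty_iff_eq_empty] at hne
      rw [hne, biUnion_empty] at h1
      exact hJ.1.ne_empty h1
    · rw [← hvW, ← h1, hJ0]
    · rwa [← h1]
  · intro J hJ
    obtain ⟨L, hL, rfl⟩ := mem_image.1 hJ
    rw [hvW, hK2 L hL]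
  · intro J hJ
    obtain ⟨L, hL, rfl⟩ := mem_image.1 hJ
    rw [hPW]; exact hp L hL
  · intro x hx
    have hdiv : ∀ L, ∃ H, L ∈ 𝒦 → ∑ j ∈ L, ∑ i ∈ W j, φ (x i) = al L * H := by
      intro L
      by_cases hL : L ∈ 𝒦
      · obtain ⟨g, hg⟩ := hx _ (hK1 L hL)
        refine ⟨φ g, fun _ => ?_⟩
        rw [← hφal L hL, ← map_mul, ← hg, map_sum, hsumW]
      · exact ⟨0, fun h => absurd h hL⟩
    choose H hH using hdiv
    have hE' := hE (fun j => trunc (e + 1) (∑ i ∈ W j, φ (x i))) (fun L => trunc e (H L))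
      (fun L hL => by rw [← map_sum, hH L hL, trunc_al_mul]) (fun L _ => totalDegree_trunc he _)
    -- value of γ i
    have hval : ∀ i, ∑ l, Polynomial.C (γ i l) * lineEv v P (x l) =
        Polynomial.X * (Polynomial.C (∑ j ∈ K i, p j) * rayEv p (H (K i)) -
          Polynomial.C (t i * ∑ j ∈ K 0, p j) * rayEv p (H (K 0))) := by
      intro i
      have hq : ∀ i, ∑ j, Polynomial.C (ind (K i) j) * rayEv p (∑ l ∈ W j, φ (x l)) =
          Polynomial.X * Polynomial.C (∑ j ∈ K i, p j) * rayEv p (H (K i)) := by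
        intro i
        rw [← rayEv_al, ← map_mul, ← hH _ (hK i), map_sum]
        simp only [ind, apply_ite Polynomial.C, Polynomial.C_1, Polynomial.C_0, ite_mul, one_mul,
          zero_mul, Finset.sum_ite_mem, univ_inter]
      have h1 : ∑ l, Polynomial.C (γ i l) * lineEv v P (x l) =
          ∑ j, Polynomial.C (c i j) * rayEv p (∑ l ∈ W j, φ (x l)) := by
        simp only [γ, map_sum, Finset.sum_mul, map_mul]
        rw [Finset.sum_comm]
        refine Finset.sum_congr rfl fun j _ => ?_
        rw [Finset.mul_sum]
        simp only [ind, apply_ite Polynomial.C, Polynomial.C_1, Polynomial.C_0, mul_ite, mul_one,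
          mul_zero, ite_mul, zero_mul, Finset.sum_ite_mem, univ_inter, hφline]
      rw [h1]
      simp only [c, Polynomial.C_sub, sub_mul, Finset.sum_sub_distrib, hq, Polynomial.C_mul, mul_assoc]
      rw [← Finset.mul_sum, hq]
      ring
    intro i
    rw [hval]
    by_cases hi : i = 0
    · simp [ex, hi]
    · have h0 : ∑ j ∈ K 0, p j ≠ 0 := hp _ (hK 0)
      simp only [ex, hi, if_false, t]
      rw [div_mul_cancel₀ _ h0, ← mul_sub, ← map_sub, pow_succ, mul_comm]
      apply mul_dvd_mul_left
      apply Dvd.dvd.mul_left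
      apply rayEv_dvd
      rw [map_sub, sub_eq_zero]
      exact hE' i

end NF
end CSA


namespace CSA

section Conn
variable {n r : ℕ}

lemma connSet_iff {G : SimpleGraph (Fin n)} {J : Finset (Fin n)} :
    ConnSet G J ↔ J.Nonempty ∧ ∀ P : Fin n → Prop, (∃ x ∈ J, P x) → (∃ x ∈ J, ¬ P x) →
      ∃ x ∈ J, ∃ y ∈ J, P x ∧ ¬ P y ∧ G.Adj x y := by
  constructor
  · rintro ⟨hne, hc⟩
    refine ⟨hne, ?_⟩
    rintro P ⟨x, hx, hPx⟩ ⟨y, hy, hPy⟩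
    by_contra hno
    push Not at hno
    obtain ⟨w⟩ := hc.preconnected ⟨x, hx⟩ ⟨y, hy⟩
    have key : ∀ (a b : (↑J : Set (Fin n))) (w : (G.induce (↑J : Set (Fin n))).Walk a b), P a → P b := by
      intro a b w
      induction w with
      | nil => exact id
      | cons h _ ih =>
        intro ha
        apply ih
        by_contra hb
        exact hno _ (Subtype.coe_prop _) _ (Subtype.coe_prop _) ha hb h
    exact hPy (key _ _ w hPx)
  · rintro ⟨hne, h⟩
    refine ⟨hne, ?_⟩
    obtain ⟨x, hx⟩ := hne
    rw [SimpleGraph.connected_iff_exists_forall_reachable]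
    refine ⟨⟨x, hx⟩, ?_⟩
    by_contra hno
    push Not at hno
    obtain ⟨⟨y, hy⟩, hy2⟩ := hno
    obtain ⟨a, ha, b, hb, ⟨ha', hpa⟩, hpb, hab⟩ := h (fun z => ∃ hz : z ∈ J,
      (G.induce (↑J : Set (Fin n))).Reachable ⟨x, hx⟩ ⟨z, hz⟩) ⟨x, hx, hx, SimpleGraph.Reachable.refl _⟩
      ⟨y, hy, fun ⟨_, h⟩ => hy2 h⟩
    apply hpb
    refine ⟨hb, hpa.trans ?_⟩
    apply SimpleGraph.Adj.reachable
    exact hab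

/-- adjacency of sets -/
def AdjS (G : SimpleGraph (Fin n)) (A B : Finset (Fin n)) : Prop := ∃ a ∈ A, ∃ b ∈ B, G.Adj a b

lemma AdjS.symm {G : SimpleGraph (Fin n)} {A B : Finset (Fin n)} (h : AdjS G A B) : AdjS G B A := by
  obtain ⟨a, ha, b, hb, hab⟩ := h
  exact ⟨b, hb, a, ha, hab.symm⟩

lemma AdjS.union_left {G : SimpleGraph (Fin n)} {A B : Finset (Fin n)} (C : Finset (Fin n))
    (h : AdjS G A B) : AdjS G (A ∪ C) B := by
  obtain ⟨a, ha, b, hb, hab⟩ := h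
  exact ⟨a, mem_union_left _ ha, b, hb, hab⟩

lemma AdjS.mono {G : SimpleGraph (Fin n)} {A B A' B' : Finset (Fin n)} (hA : A ⊆ A') (hB : B ⊆ B')
    (h : AdjS G A B) : AdjS G A' B' := by
  obtain ⟨a, ha, b, hb, hab⟩ := h
  exact ⟨a, hA ha, b, hB hb, hab⟩

lemma connSet_singleton (G : SimpleGraph (Fin n)) (x : Fin n) : ConnSet G {x} := by
  rw [connSet_iff]
  refine ⟨singleton_nonempty x, ?_⟩
  rintro P ⟨a, ha, hPa⟩ ⟨b, hb, hPb⟩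
  rw [mem_singleton] at ha hb
  subst ha; subst hb
  exact absurd hPa hPb

lemma connSet_union {G : SimpleGraph (Fin n)} {A B : Finset (Fin n)} (hA : ConnSet G A)
    (hB : ConnSet G B) (h : AdjS G A B) : ConnSet G (A ∪ B) := by
  rw [connSet_iff] at *
  refine ⟨hA.1.mono subset_union_left, ?_⟩
  intro P hP hP'
  by_cases hA1 : (∃ x ∈ A, P x) ∧ (∃ x ∈ A, ¬ P x)
  · obtain ⟨x, hx, y, hy, hh⟩ := hA.2 P hA1.1 hA1.2
    exact ⟨x, mem_union_left _ hx, y, mem_union_left _ hy, hh⟩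
  by_cases hB1 : (∃ x ∈ B, P x) ∧ (∃ x ∈ B, ¬ P x)
  · obtain ⟨x, hx, y, hy, hh⟩ := hB.2 P hB1.1 hB1.2
    exact ⟨x, mem_union_right _ hx, y, mem_union_right _ hy, hh⟩
  obtain ⟨a, ha, b, hb, hab⟩ := h
  obtain ⟨x, hx, hPx⟩ := hP
  obtain ⟨y, hy, hPy⟩ := hP'
  rw [mem_union] at hx hy
  by_cases hPa : P a <;> by_cases hPb : P b
  · rcases hy with hy | hy
    · exact absurd ⟨⟨a, ha, hPa⟩, ⟨y, hy, hPy⟩⟩ hA1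
    · exact absurd ⟨⟨b, hb, hPb⟩, ⟨y, hy, hPy⟩⟩ hB1
  · exact ⟨a, mem_union_left _ ha, b, mem_union_right _ hb, hPa, hPb, hab⟩
  · exact ⟨b, mem_union_right _ hb, a, mem_union_left _ ha, hPb, hPa, hab.symm⟩
  · rcases hx with hx | hx
    · exact absurd ⟨⟨x, hx, hPx⟩, ⟨a, ha, hPa⟩⟩ hA1
    · exact absurd ⟨⟨x, hx, hPx⟩, ⟨b, hb, hPb⟩⟩ hB1

/-- combinatorial connectivity of `K` with respect to a relation -/
def CutConn (lo : Fin r → Fin r → Bool) (K : Finset (Fin r)) : Prop :=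
  K.Nonempty ∧ ∀ A ∈ K.powerset, A.Nonempty → A ≠ K → ∃ a ∈ A, ∃ b ∈ K, b ∉ A ∧ lo a b = true

instance (lo : Fin r → Fin r → Bool) (K : Finset (Fin r)) : Decidable (CutConn lo K) := by
  unfold CutConn; infer_instance

lemma connSet_biUnion {G : SimpleGraph (Fin n)} {W : Fin r → Finset (Fin n)}
    (hWc : ∀ j, ConnSet G (W j)) {lo : Fin r → Fin r → Bool}
    (hlo : ∀ i j, lo i j = true → AdjS G (W i) (W j)) {K : Finset (Fin r)} (hK : CutConn lo K) :
    ConnSet G (K.biUnion W) := by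
  classical
  rw [connSet_iff]
  refine ⟨?_, ?_⟩
  · obtain ⟨j, hj⟩ := hK.1
    obtain ⟨x, hx⟩ := (hWc j).1
    exact ⟨x, mem_biUnion.2 ⟨j, hj, hx⟩⟩
  intro P hP hP'
  by_cases hcut : ∃ j ∈ K, (∃ x ∈ W j, P x) ∧ (∃ x ∈ W j, ¬ P x)
  · obtain ⟨j, hj, h1, h2⟩ := hcut
    obtain ⟨x, hx, y, hy, hh⟩ := (connSet_iff.1 (hWc j)).2 P h1 h2
    exact ⟨x, mem_biUnion.2 ⟨j, hj, hx⟩, y, mem_biUnion.2 ⟨j, hj, hy⟩, hh⟩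
  · push Not at hcut
    let A := K.filter (fun j => ∃ x ∈ W j, P x)
    obtain ⟨x, hx, hPx⟩ := hP
    obtain ⟨y, hy, hPy⟩ := hP'
    obtain ⟨jx, hjx, hx⟩ := mem_biUnion.1 hx
    obtain ⟨jy, hjy, hy⟩ := mem_biUnion.1 hy
    obtain ⟨a, ha, b, hb, hbA, hab⟩ := hK.2 A (mem_powerset.2 (filter_subset _ _))
      ⟨jx, mem_filter.2 ⟨hjx, x, hx, hPx⟩⟩ (fun h => by
        have : jy ∈ A := h ▸ hjy
        exact hPy (hcut jy hjy (mem_filter.1 this).2 y hy))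
    obtain ⟨z, hz, t, ht, hzt⟩ := hlo a b hab
    rw [mem_filter] at ha
    refine ⟨z, mem_biUnion.2 ⟨a, ha.1, hz⟩, t, mem_biUnion.2 ⟨b, hb, ht⟩, hcut a ha.1 ha.2 z hz, ?_, hzt⟩
    intro hPt
    exact hbA (mem_filter.2 ⟨hb, t, ht, hPt⟩)

lemma cutConn_of_connSet {G : SimpleGraph (Fin n)} {W : Fin r → Finset (Fin n)}
    (hW : ∀ i j, i ≠ j → Disjoint (W i) (W j)) (hWne : ∀ j, (W j).Nonempty) {hi : Fin r → Fin r → Bool}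
    (hhi : ∀ i j, i ≠ j → AdjS G (W i) (W j) → hi i j = true) {K : Finset (Fin r)}
    (hK : ConnSet G (K.biUnion W)) : CutConn hi K := by
  classical
  rw [connSet_iff] at hK
  obtain ⟨⟨x, hx⟩, hcut⟩ := hK
  obtain ⟨j, hj, -⟩ := mem_biUnion.1 hx
  refine ⟨⟨j, hj⟩, ?_⟩
  intro A hA hAne hAK
  rw [mem_powerset] at hA
  obtain ⟨i, hi'⟩ := hAne
  obtain ⟨k, hk, hkA⟩ : ∃ k ∈ K, k ∉ A := by
    by_contra h
    push Not at h
    exact hAK (subset_antisymm hA h)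
  obtain ⟨xi, hxi⟩ := hWne i
  obtain ⟨xk, hxk⟩ := hWne k
  have huniq : ∀ i j x, x ∈ W i → x ∈ W j → i = j := by
    intro i j x hi hj
    by_contra hne
    exact Finset.disjoint_left.1 (hW i j hne) hi hj
  obtain ⟨a, ha, b, hb, hPa, hPb, hab⟩ := hcut (fun x => ∃ j ∈ A, x ∈ W j)
    ⟨xi, mem_biUnion.2 ⟨i, hA hi', hxi⟩, i, hi', hxi⟩
    ⟨xk, mem_biUnion.2 ⟨k, hk, hxk⟩, fun ⟨j, hj, hxj⟩ => hkA (huniq _ _ _ hxk hxj ▸ hj)⟩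
  obtain ⟨ja, hja, haj⟩ := hPa
  obtain ⟨jb, hjb, hbj⟩ := mem_biUnion.1 hb
  have hjbA : jb ∉ A := fun h => hPb ⟨jb, h, hbj⟩
  exact ⟨ja, hja, jb, hjb, hjbA, hhi ja jb (fun h => hjbA (h ▸ hja)) ⟨a, haj, b, hbj, hab⟩⟩

/-- Nonfreeness from a contraction pattern. -/
theorem nonfree_minor {G : SimpleGraph (Fin n)}
    (W : Fin r → Finset (Fin n)) (hW : ∀ i j, i ≠ j → Disjoint (W i) (W j))
    (hWc : ∀ j, ConnSet G (W j)) (lo hi : Fin r → Fin r → Bool)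
    (hlo : ∀ i j, lo i j = true → AdjS G (W i) (W j))
    (hhi : ∀ i j, i ≠ j → AdjS G (W i) (W j) → hi i j = true)
    (u p : Fin r → ℤ) (𝒦 : Finset (Finset (Fin r)))
    (hK1 : ∀ K ∈ 𝒦, CutConn lo K ∧ ∑ j ∈ K, u j = 0 ∧ ∑ j ∈ K, p j ≠ 0)
    (hK3 : ∀ K : Finset (Fin r), ∑ j ∈ K, u j = 0 → K ∉ 𝒦 → ¬ CutConn hi K)
    {d e : ℕ} (he : 0 < e) (hbound : 𝒦.card < 1 + d * (e + 1))
    (K : Fin (d + 1) → Finset (Fin r)) (hK : ∀ i, K i ∈ 𝒦)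
    (hli : LinearIndependent ℚ (fun i => ind (K i)))
    (hE : ∀ (q : Fin r → MvPolynomial (Fin r) ℚ) (h : Finset (Fin r) → MvPolynomial (Fin r) ℚ),
      (∀ L ∈ 𝒦, ∑ j ∈ L, q j = al L * h L) → (∀ L ∈ 𝒦, (h L).totalDegree < e) →
      ∀ i, h (K i) = h (K 0)) :
    ¬ Module.Free (MvPolynomial (Fin n) ℚ) (derModule G) := by
  intro hf
  have := nonfree_block hf W hW (fun j => (hWc j).1) (fun j => (u j : ℚ)) (fun j => (p j : ℚ)) 𝒦
    (fun L hL => connSet_biUnion hWc hlo (hK1 L hL).1) (fun L hL => by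
      have := (hK1 L hL).2.1
      exact_mod_cast this)
    (fun L _ hL hc => by
      by_contra hne
      exact hK3 L (by exact_mod_cast hL) hne (cutConn_of_connSet hW (fun j => (hWc j).1) hhi hc))
    (fun L hL => by
      have := (hK1 L hL).2.2
      exact_mod_cast this) he K hK hli hE
  omega

end Conn
end CSA


namespace CSA

section Patterns
variable {n r : ℕ}

lemma li_of_dual {d : ℕ} (K : Fin (d + 1) → Finset (Fin r)) (D : Fin (d + 1) → Fin r → ℤ)
    (h : ∀ i i', ∑ j ∈ K i', D i j = if i = i' then 1 else 0) :
    LinearIndependent ℚ (fun i => ind (K i)) := by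
  rw [Fintype.linearIndependent_iff]
  intro g hg i
  have h1 : ∀ i', ∑ j, (D i j : ℚ) * ind (K i') j = if i = i' then 1 else 0 := by
    intro i'
    have := h i i'
    have h2 : ((∑ j ∈ K i', D i j : ℤ) : ℚ) = if i = i' then 1 else 0 := by
      rw [this]; split_ifs <;> simp
    rw [← h2]
    simp [ind, Finset.sum_ite_mem]
  have h3 : ∑ j, (D i j : ℚ) * (∑ i', g i' • ind (K i')) j = 0 := by
    rw [hg]; simp
  have h4 : ∑ j, (D i j : ℚ) * (∑ i', g i' • ind (K i')) j
      = ∑ i', g i' * ∑ j, (D i j : ℚ) * ind (K i') j := by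
    simp only [Finset.sum_apply, Pi.smul_apply, smul_eq_mul, Finset.mul_sum]
    rw [Finset.sum_comm]
    refine sum_congr rfl fun i' _ => sum_congr rfl fun j _ => by ring
  rw [h4] at h3
  simpa [h1] using h3

lemma hE_circuit {d : ℕ} (𝒦 : Finset (Finset (Fin r))) (K : Fin (d + 1) → Finset (Fin r))
    (hK : ∀ i, K i ∈ 𝒦)
    (hli : LinearIndependent ℚ (fun i => ind (K i))) (L0 : Finset (Fin r)) (hL0 : L0 ∈ 𝒦)
    (c : Fin (d + 1) → ℤ) (hc : ∀ i, c i ≠ 0)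
    (hrel : ∀ j, ∑ i, (if j ∈ K i then c i else 0) = if j ∈ L0 then 1 else 0)
    (q : Fin r → MvPolynomial (Fin r) ℚ) (h : Finset (Fin r) → MvPolynomial (Fin r) ℚ)
    (hq : ∀ L ∈ 𝒦, ∑ j ∈ L, q j = al L * h L) (hd : ∀ L ∈ 𝒦, (h L).totalDegree < 1) (i) :
    h (K i) = h (K 0) := by
  have hcon : ∀ L ∈ 𝒦, h L = MvPolynomial.C ((h L).coeff 0) := by
    intro L hL
    have := hd L hL
    exact MvPolynomial.totalDegree_eq_zero_iff_eq_C.1 (by omega)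
  have hrel' : ∀ j, ∑ i, (c i : ℚ) * ind (K i) j = ind L0 j := by
    intro j
    have h2 : ((∑ i, (if j ∈ K i then c i else 0) : ℤ) : ℚ) = if j ∈ L0 then 1 else 0 := by
      rw [hrel]; split_ifs <;> simp
    simp only [ind]
    rw [← h2]
    push_cast
    simp
  have hsum : ∑ i, (c i : MvPolynomial (Fin r) ℚ) * (∑ j ∈ K i, q j) = ∑ j ∈ L0, q j := by
    have e1 : ∀ L : Finset (Fin r), ∑ j ∈ L, q j = ∑ j, MvPolynomial.C (ind L j) * q j := by
      intro L; simp [ind, Finset.sum_ite_mem]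
    simp only [e1]
    simp only [Finset.mul_sum]
    rw [Finset.sum_comm]
    refine sum_congr rfl fun j _ => ?_
    rw [← hrel' j, map_sum, Finset.sum_mul]
    refine sum_congr rfl fun i _ => ?_
    rw [map_mul]
    simp [mul_assoc]
  have hv : ∑ i, ((c i : ℚ) * ((h (K i)).coeff 0 - (h L0).coeff 0)) • ind (K i) = 0 := by
    have hLL : ind L0 = ∑ i, (c i : ℚ) • ind (K i) := by
      funext j; rw [← hrel' j]; simp
    apply lin_eq_zero
    have hl : ∀ f : Fin (d+1) → (Fin r → ℚ), lin (∑ i, f i) = ∑ i, lin (f i) := by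
      intro f
      induction (univ : Finset (Fin (d+1))) using Finset.induction_on with
      | empty => simp [lin_zero]
      | insert a s ha ih => rw [sum_insert ha, sum_insert ha, lin_add, ih]
    have e2 : ∑ i, (c i : MvPolynomial (Fin r) ℚ) * (al (K i) * h (K i)) = al L0 * h L0 := by
      rw [← hq L0 hL0, ← hsum]
      exact sum_congr rfl fun i _ => by rw [hq _ (hK i)]
    have e3 : al L0 = ∑ i, (c i : MvPolynomial (Fin r) ℚ) * al (K i) := by
      rw [al_eq, hLL, hl]
      refine sum_congr rfl fun i _ => ?_
      rw [lin_smul, al_eq]; simp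
    rw [e3, Finset.sum_mul] at e2
    rw [hl, ← sub_eq_zero.2 e2, ← Finset.sum_sub_distrib]
    refine sum_congr rfl fun i _ => ?_
    rw [lin_smul, ← al_eq, hcon _ (hK i), hcon _ hL0]
    simp only [map_mul, map_sub, MvPolynomial.coeff_zero_C]
    simp
    ring
  have hz := Fintype.linearIndependent_iff.1 hli _ hv
  have hall : ∀ i, h (K i) = h L0 := by
    intro i
    have := hz i
    have hci : (c i : ℚ) ≠ 0 := by exact_mod_cast hc i
    rcases mul_eq_zero.1 this with h1 | h1
    · exact absurd h1 hci
    · rw [hcon _ (hK i), hcon _ hL0, sub_eq_zero.1 h1]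
  rw [hall i, hall 0]

/-- undirected adjacency table from a list of pairs -/
def tab (E : List (Fin r × Fin r)) (i j : Fin r) : Bool := E.contains (i, j) || E.contains (j, i)

lemma tab_lo {G : SimpleGraph (Fin n)} {W : Fin r → Finset (Fin n)} {E : List (Fin r × Fin r)}
    (h : ∀ e ∈ E, AdjS G (W e.1) (W e.2)) (i j : Fin r) (hij : tab E i j = true) :
    AdjS G (W i) (W j) := by
  simp only [tab, Bool.or_eq_true, List.contains_iff_mem] at hij
  rcases hij with hij | hij
  · exact h _ hij
  · exact (h _ hij).symm

lemma tab_hi {G : SimpleGraph (Fin n)} {W : Fin r → Finset (Fin n)} {N : List (Fin r × Fin r)}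
    (h : ∀ e ∈ N, ¬ AdjS G (W e.1) (W e.2)) (i j : Fin r) (hij : AdjS G (W i) (W j)) :
    (!(tab N i j)) = true := by
  by_contra hc
  have : tab N i j = true := by simpa using hc
  simp only [tab, Bool.or_eq_true, List.contains_iff_mem] at this
  rcases this with hh | hh
  · exact h _ hh hij
  · exact h _ hh hij.symm

/-- circuit version of `nonfree_minor`: `E` required edges, `N` forbidden edges. -/
theorem nonfree_circuit {G : SimpleGraph (Fin n)}
    (W : Fin r → Finset (Fin n)) (hW : ∀ i j, i < j → Disjoint (W i) (W j))
    (hWc : ∀ j, ConnSet G (W j)) (E N : List (Fin r × Fin r))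
    (hlo : ∀ e ∈ E, AdjS G (W e.1) (W e.2))
    (hhi : ∀ e ∈ N, ¬ AdjS G (W e.1) (W e.2))
    (u : Fin r → ℤ) (𝒦 : Finset (Finset (Fin r)))
    (hK1 : ∀ K ∈ 𝒦, CutConn (tab E) K ∧ ∑ j ∈ K, u j = 0)
    (hK3 : ∀ K : Finset (Fin r), ∑ j ∈ K, u j = 0 → K ∉ 𝒦 → ¬ CutConn (fun i j => !(tab N i j)) K)
    {d : ℕ} (hbound : 𝒦.card < 1 + d * 2)
    (K : Fin (d + 1) → Finset (Fin r)) (hK : ∀ i, K i ∈ 𝒦) (D : Fin (d + 1) → Fin r → ℤ)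
    (hD : ∀ i i', ∑ j ∈ K i', D i j = if i = i' then 1 else 0)
    (L0 : Finset (Fin r)) (hL0 : L0 ∈ 𝒦)
    (c : Fin (d + 1) → ℤ) (hc : ∀ i, c i ≠ 0)
    (hrel : ∀ j, ∑ i, (if j ∈ K i then c i else 0) = if j ∈ L0 then 1 else 0) :
    ¬ Module.Free (MvPolynomial (Fin n) ℚ) (derModule G) := by
  refine nonfree_minor W (fun i j hij => ?_) hWc (tab E) (fun i j => !(tab N i j)) (tab_lo hlo)
    (fun i j _ h => tab_hi hhi i j h) u (fun _ => 1) 𝒦 (fun K hK => ⟨(hK1 K hK).1, (hK1 K hK).2, ?_⟩)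
    hK3 (e := 1) one_pos (by omega) K hK (li_of_dual K D hD)
    (hE_circuit 𝒦 K hK (li_of_dual K D hD) L0 hL0 c hc hrel)
  · rcases lt_or_gt_of_ne hij with h | h
    · exact hW i j h
    · exact (hW j i h).symm
  · have := (hK1 K hK).1.1
    simp [this.ne_empty]

end Patterns
end CSA


namespace CSA

section Exact
variable {n : ℕ}

/-- nonfree -/
def NF (G : SimpleGraph (Fin n)) : Prop :=
  ¬ Module.Free (MvPolynomial (Fin n) ℚ) (derModule G)

theorem K14_exact {G : SimpleGraph (Fin n)} (W : Fin 5 → Finset (Fin n))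
    (hW : ∀ i j, i < j → Disjoint (W i) (W j)) (hWc : ∀ j, ConnSet G (W j))
    (hlo : ∀ e ∈ [((0 : Fin 5), (1 : Fin 5)), (0, 2), (0, 3), (0, 4)], AdjS G (W e.1) (W e.2))
    (hhi : ∀ e ∈ [((1 : Fin 5), (3 : Fin 5)), (1, 4), (2, 3), (2, 4)], ¬ AdjS G (W e.1) (W e.2)) :
    NF G := by
  refine nonfree_circuit W hW hWc _ _ hlo hhi ![0, 1, 10, -1, -10]
    {{0}, {0, 1, 3}, {0, 2, 4}, {0, 1, 2, 3, 4}} (by decide +kernel) (by decide +kernel) (d := 2)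
    (by decide +kernel) ![{0}, {0, 1, 3}, {0, 2, 4}] (by decide +kernel)
    ![![1, -1, -1, 0, 0], ![0, 1, 0, 0, 0], ![0, 0, 1, 0, 0]] (by decide +kernel) {0, 1, 2, 3, 4}
    (by decide +kernel) ![-1, 1, 1] (by decide +kernel) (by decide +kernel)

theorem C4p_exact {G : SimpleGraph (Fin n)} (W : Fin 5 → Finset (Fin n))
    (hW : ∀ i j, i < j → Disjoint (W i) (W j)) (hWc : ∀ j, ConnSet G (W j))
    (hlo : ∀ e ∈ [((0 : Fin 5), (1 : Fin 5)), (1, 2), (2, 3), (0, 3), (0, 4)],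
      AdjS G (W e.1) (W e.2))
    (hhi : ∀ e ∈ [((0 : Fin 5), (2 : Fin 5)), (1, 3), (1, 4), (2, 4), (3, 4)],
      ¬ AdjS G (W e.1) (W e.2)) :
    NF G := by
  refine nonfree_circuit W hW hWc _ _ hlo hhi ![1, -1, 10, -1, -10]
    {{0, 1}, {0, 3}, {0, 1, 2, 4}, {0, 2, 3, 4}} (by decide +kernel) (by decide +kernel) (d := 2)
    (by decide +kernel) ![{0, 1}, {0, 3}, {0, 1, 2, 4}] (by decide +kernel)
    ![![0, 1, -1, 0, 0], ![0, 0, 0, 1, 0], ![0, 0, 1, 0, 0]] (by decide +kernel) {0, 2, 3, 4}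
    (by decide +kernel) ![-1, 1, 1] (by decide +kernel) (by decide +kernel)

theorem net_exact {G : SimpleGraph (Fin n)} (W : Fin 6 → Finset (Fin n))
    (hW : ∀ i j, i < j → Disjoint (W i) (W j)) (hWc : ∀ j, ConnSet G (W j))
    (hlo : ∀ e ∈ [((0 : Fin 6), (1 : Fin 6)), (1, 2), (0, 2), (0, 3), (1, 4), (2, 5)],
      AdjS G (W e.1) (W e.2))
    (hhi : ∀ e ∈ [((0 : Fin 6), (4 : Fin 6)), (0, 5), (1, 3), (1, 5), (2, 3), (2, 4), (3, 4),
      (3, 5), (4, 5)], ¬ AdjS G (W e.1) (W e.2)) :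
    NF G := by
  refine nonfree_circuit W hW hWc _ _ hlo hhi ![10, 1, -1, 1, -11, -10]
    {{1, 2}, {0, 1, 4}, {0, 1, 2, 3, 4}, {0, 1, 2, 5}, {0, 2, 3, 5}}
    (by decide +kernel) (by decide +kernel) (d := 3)
    (by decide +kernel) ![{1, 2}, {0, 1, 4}, {0, 1, 2, 3, 4}, {0, 1, 2, 5}] (by decide +kernel)
    ![![0, 0, 1, -1, 0, -1], ![0, 0, 0, -1, 1, 0], ![0, 0, 0, 1, 0, 0], ![0, 0, 0, 0, 0, 1]]
    (by decide +kernel) {0, 2, 3, 5}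
    (by decide +kernel) ![-1, -1, 1, 1] (by decide +kernel) (by decide +kernel)

theorem S222_exact {G : SimpleGraph (Fin n)} (W : Fin 7 → Finset (Fin n))
    (hW : ∀ i j, i < j → Disjoint (W i) (W j)) (hWc : ∀ j, ConnSet G (W j))
    (hlo : ∀ e ∈ [((0 : Fin 7), (1 : Fin 7)), (1, 2), (0, 3), (3, 4), (0, 5), (5, 6)],
      AdjS G (W e.1) (W e.2))
    (hhi : ∀ e ∈ [((0 : Fin 7), (2 : Fin 7)), (0, 4), (0, 6), (1, 3), (1, 4), (1, 5), (1, 6),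
      (2, 3), (2, 4), (2, 5), (2, 6), (3, 5), (3, 6), (4, 5), (4, 6)], ¬ AdjS G (W e.1) (W e.2)) :
    NF G := by
  refine nonfree_circuit W hW hWc _ _ hlo hhi ![-12, -11, -12, 23, -11, 23, -11]
    {{0, 1, 3}, {0, 3, 4}, {0, 1, 5}, {0, 5, 6}, {0, 1, 2, 3, 4, 5}, {0, 1, 2, 3, 5, 6}}
    (by decide +kernel) (by decide +kernel) (d := 4)
    (by decide +kernel) ![{0, 1, 3}, {0, 3, 4}, {0, 1, 5}, {0, 5, 6}, {0, 1, 2, 3, 4, 5}]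
    (by decide +kernel)
    ![![0, 0, 0, 1, -1, 0, 0], ![0, 0, -1, 0, 1, 0, 0], ![0, 0, -1, 0, 0, 1, -1],
      ![0, 0, 0, 0, 0, 0, 1], ![0, 0, 1, 0, 0, 0, 0]]
    (by decide +kernel) {0, 1, 2, 3, 5, 6}
    (by decide +kernel) ![1, -1, -1, 1, 1] (by decide +kernel) (by decide +kernel)

end Exact
end CSA


namespace CSA

section Deg
variable {σ : Type*} [Fintype σ] [DecidableEq σ]

lemma totalDegree_rho_le (a : σ → ℚ) (i0 : σ) (f : MvPolynomial σ ℚ) :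
    (rho a i0 f).totalDegree ≤ f.totalDegree := by
  rw [rho, MvPolynomial.aeval_def, MvPolynomial.eval₂_eq']
  refine MvPolynomial.totalDegree_finsetSum_le fun s hs => ?_
  refine (MvPolynomial.totalDegree_mul _ _).trans ?_
  rw [MvPolynomial.algebraMap_eq, MvPolynomial.totalDegree_C, zero_add]
  refine (MvPolynomial.totalDegree_finsetProd _ _).trans ?_
  have : ∑ i, s i ≤ f.totalDegree := by
    have := MvPolynomial.le_totalDegree hs
    rwa [Finsupp.sum_fintype _ _ (fun _ => rfl)] at this
  refine le_trans (sum_le_sum fun i _ => ?_) this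
  refine (MvPolynomial.totalDegree_pow _ _).trans ?_
  refine (Nat.mul_le_mul_left _ (?_ : _ ≤ 1)).trans (by simp)
  split_ifs
  · refine (MvPolynomial.totalDegree_sub _ _).trans (max_le (by simp) ?_)
    refine (MvPolynomial.totalDegree_mul _ _).trans ?_
    have := totalDegree_lin a
    simpa using this
  · simp

/-- linear forms dividing, independent modulo nothing -/
lemma not_lin_dvd {a b : σ → ℚ} (ha : a ≠ 0) (h : ∀ t : ℚ, b ≠ t • a) : ¬ lin a ∣ lin b := by
  obtain ⟨i0, hi⟩ := Function.ne_iff.1 ha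
  intro hd
  exact h _ (lin_dvd_lin hi hd)

lemma eq_zero_of_dvd_deg {f g : MvPolynomial σ ℚ} (h : f ∣ g) (hd : g.totalDegree < f.totalDegree) :
    g = 0 := by
  obtain ⟨k, rfl⟩ := h
  by_contra hne
  have h1 := left_ne_zero_of_mul hne
  have h2 := right_ne_zero_of_mul hne
  rw [MvPolynomial.totalDegree_mul_of_isDomain h1 h2] at hd
  omega

lemma deg_of_mul_lin {a : σ → ℚ} (ha : a ≠ 0) {g f : MvPolynomial σ ℚ} {D : ℕ}
    (h : f = lin a * g) (hd : f.totalDegree < D + 1) : g.totalDegree < D ∨ g = 0 := by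
  by_cases hg : g = 0
  · exact Or.inr hg
  · left
    have h0 : lin a ≠ 0 := fun h => ha (lin_eq_zero h)
    rw [h, MvPolynomial.totalDegree_mul_of_isDomain h0 hg, totalDegree_lin_eq ha] at hd
    omega

lemma three_mod (w v1 v2 v3 z : σ → ℚ) (hw : w ≠ 0)
    (h1 : ∀ s t : ℚ, v1 ≠ s • w + t • v2) (h2 : ∀ s t : ℚ, v2 ≠ s • w + t • v3)
    (h3 : ∀ s t : ℚ, v3 ≠ s • w + t • v1)
    (z1 : ∀ s t : ℚ, z ≠ s • w + t • v1) (z2 : ∀ s t : ℚ, z ≠ s • w + t • v2)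
    (z3 : ∀ s t : ℚ, z ≠ s • w + t • v3)
    (g : MvPolynomial σ ℚ) (hg : g.totalDegree < 3)
    (d1 : ∃ A B, lin z * g = lin v1 * A + lin w * B)
    (d2 : ∃ A B, lin z * g = lin v2 * A + lin w * B)
    (d3 : ∃ A B, lin z * g = lin v3 * A + lin w * B) : lin w ∣ g := by
  obtain ⟨i0, hi⟩ := Function.ne_iff.1 hw
  have hi : w i0 ≠ 0 := hi
  set red : (σ → ℚ) → (σ → ℚ) := fun b => b - (b i0 * (w i0)⁻¹) • w with hred
  have hrl : ∀ b, rho w i0 (lin b) = lin (red b) := fun b => rho_lin w b i0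
  have key : ∀ a b : σ → ℚ, (∀ s t : ℚ, b ≠ s • w + t • a) → ∀ t : ℚ, red b ≠ t • red a := by
    intro a b h t he
    apply h (b i0 * (w i0)⁻¹ - t * (a i0 * (w i0)⁻¹)) t
    have : b = red b + (b i0 * (w i0)⁻¹) • w := by simp [hred]
    calc b = red b + (b i0 * (w i0)⁻¹) • w := this
      _ = t • red a + (b i0 * (w i0)⁻¹) • w := by rw [he]
      _ = _ := by simp only [hred]; module
  have nz : ∀ a b : σ → ℚ, (∀ s t : ℚ, b ≠ s • w + t • a) → red b ≠ 0 := by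
    intro a b h h0
    apply key a b h 0
    rw [h0, zero_smul]
  have hz : ∀ v, red v ≠ 0 → (∀ s t : ℚ, z ≠ s • w + t • v) →
      (∃ A B, lin z * g = lin v * A + lin w * B) → lin (red v) ∣ rho w i0 g := by
    rintro v hv hzv ⟨A, B, hAB⟩
    have := congrArg (rho w i0) hAB
    rw [map_mul, map_add, map_mul, map_mul, rho_self hi, zero_mul, add_zero, hrl, hrl] at this
    have hd : lin (red v) ∣ lin (red z) * rho w i0 g := ⟨_, this⟩
    exact ((prime_lin hv).dvd_or_dvd hd).resolve_left (not_lin_dvd hv (key v z hzv))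
  have n1 := nz _ _ h1
  have n2 := nz _ _ h2
  have n3 := nz _ _ h3
  rw [lin_dvd_iff hi]
  have r13 : ¬ lin (red v1) ∣ lin (red v3) := not_lin_dvd n1 (key _ _ h3)
  have r21 : ¬ lin (red v2) ∣ lin (red v1) := not_lin_dvd n2 (key _ _ h1)
  have r32 : ¬ lin (red v3) ∣ lin (red v2) := not_lin_dvd n3 (key _ _ h2)
  obtain ⟨k, hk⟩ := hz v1 n1 z1 d1
  have h2' := hz v2 n2 z2 d2
  have h3' := hz v3 n3 z3 d3
  have hv2 : lin (red v2) ∣ k := by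
    rw [hk] at h2'
    exact ((prime_lin n2).dvd_or_dvd h2').resolve_left r21
  obtain ⟨k', rfl⟩ := hv2
  have r31 : ¬ lin (red v3) ∣ lin (red v1) := fun h =>
    r13 (((prime_lin n3).irreducible.associated_of_dvd (prime_lin n1).irreducible h).symm.dvd)
  have hv3 : lin (red v3) ∣ k' := by
    rw [hk] at h3'
    rcases (prime_lin n3).dvd_or_dvd h3' with h | h
    · exact absurd h r31
    · exact ((prime_lin n3).dvd_or_dvd h).resolve_left r32
  obtain ⟨k'', rfl⟩ := hv3
  apply eq_zero_of_dvd_deg (f := lin (red v1) * (lin (red v2) * lin (red v3)))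
  · exact ⟨k'', by rw [hk]; ring⟩
  · have := totalDegree_rho_le w i0 g
    have p1 := (prime_lin n1).ne_zero
    have p2 := (prime_lin n2).ne_zero
    have p3 := (prime_lin n3).ne_zero
    rw [MvPolynomial.totalDegree_mul_of_isDomain p1 (mul_ne_zero p2 p3),
      MvPolynomial.totalDegree_mul_of_isDomain p2 p3, totalDegree_lin_eq n1, totalDegree_lin_eq n2,
      totalDegree_lin_eq n3]
    omega

/-- the five-form argument -/
theorem five_forms (ε : Fin 5 → σ → ℚ) (h0 : ∑ i, ε i = 0)
    (hψ : ∀ i l : Fin 5, ∃ φ : (σ → ℚ) →ₗ[ℚ] ℚ, ∀ k, φ (ε k) =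
      (if k = i then 1 else 0) - (if k = l then 1 else 0))
    (hcube : ∑ i, lin (ε i) ^ 3 ≠ 0)
    (H : Fin 5 → MvPolynomial σ ℚ) (hd : ∀ i, (H i).totalDegree < 4)
    (hs : ∑ i, lin (ε i) * H i = 0)
    (hp : ∀ i j, i ≠ j → lin (ε i + ε j) ∣ lin (ε i) * H i + lin (ε j) * H j) (i : Fin 5) :
    H i = H 0 := by
  classical
  -- nondegeneracy
  have hex : ∀ i j : Fin 5, ∃ l, l ≠ i ∧ l ≠ j := by decide
  have hex4 : ∀ i j k l : Fin 5, ∃ m : Fin 5, (m ≠ i ∧ m ≠ j) ∧ m ≠ k ∧ m ≠ l := by decide +kernel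
  have hex3 : ∀ i j k : Fin 5, ∃ l, l ≠ i ∧ l ≠ j ∧ l ≠ k := by decide
  have nzs : ∀ i j, i ≠ j → ε i + ε j ≠ 0 := by
    intro i j hij h
    obtain ⟨l, hl1, hl2⟩ := hex i j
    obtain ⟨φ, hφ⟩ := hψ i l
    have := congrArg φ h
    simp [hφ, hl1.symm, hl2.symm, hij.symm] at this
  have nzd : ∀ i j, i ≠ j → ε i - ε j ≠ 0 := by
    intro i j hij h
    obtain ⟨l, hl1, hl2⟩ := hex i j
    obtain ⟨φ, hφ⟩ := hψ i l
    have := congrArg φ h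
    simp [hφ, hl1.symm, hl2.symm, hij.symm] at this
  have stepA : ∀ i j, i ≠ j → ∃ g, H i - H j = lin (ε i + ε j) * g ∧ g.totalDegree < 3 := by
    intro i j hij
    obtain ⟨k, hk⟩ := hp i j hij
    have hdv : lin (ε i + ε j) ∣ lin (ε j) * (H i - H j) := by
      refine ⟨H i - k, ?_⟩
      rw [lin_add] at hk ⊢
      linear_combination -hk
    have hnd : ¬ lin (ε i + ε j) ∣ lin (ε j) := by
      refine not_lin_dvd (nzs i j hij) fun t ht => ?_
      obtain ⟨l, hl1, hl2⟩ := hex i j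
      obtain ⟨φ, hφ⟩ := hψ i l
      obtain ⟨φ', hφ'⟩ := hψ j l
      have e1 := congrArg φ ht
      have e2 := congrArg φ' ht
      simp [hφ, hl1.symm, hl2.symm, hij.symm] at e1
      simp [hφ', hl1.symm, hl2.symm, hij] at e2
      rw [← e1] at e2; norm_num at e2
    obtain ⟨g, hg⟩ := ((prime_lin (nzs i j hij)).dvd_or_dvd hdv).resolve_left hnd
    refine ⟨g, hg, ?_⟩
    have : (H i - H j).totalDegree < 3 + 1 :=
      lt_of_le_of_lt (MvPolynomial.totalDegree_sub _ _) (max_lt (hd i) (hd j))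
    rcases deg_of_mul_lin (nzs i j hij) hg this with h | h
    · exact h
    · rw [h]; simp
  have stepB : ∀ i j, i ≠ j → ∃ g, H i - H j = (lin (ε i) ^ 2 - lin (ε j) ^ 2) * g ∧
      g.totalDegree < 2 := by
    intro i j hij
    obtain ⟨g, hg, hgd⟩ := stepA i j hij
    have hT : ∀ i j : Fin 5, i ≠ j → ∃ k l m : Fin 5, k ≠ i ∧ k ≠ j ∧ l ≠ i ∧ l ≠ j ∧ m ≠ i ∧ m ≠ j ∧
      k ≠ l ∧ k ≠ m ∧ l ≠ m := by decide
    obtain ⟨k, l, m, hki, hkj, hli, hlj, hmi, hmj, hkl, hkm, hlm⟩ := hT i j hij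
    have D : ∀ k, k ≠ i → k ≠ j → ∃ A B, lin (ε j) * g = lin (ε j + ε k) * A + lin (ε i - ε j) * B := by
      intro k hki hkj
      obtain ⟨g1, hg1, -⟩ := stepA j k hkj.symm
      obtain ⟨g2, hg2, -⟩ := stepA k i hki
      have hc : lin (ε i + ε j) * g + lin (ε j + ε k) * g1 + lin (ε k + ε i) * g2 = 0 := by
        rw [← hg, ← hg1, ← hg2]; ring
      refine ⟨MvPolynomial.C (-1/2) * (g1 + g2), MvPolynomial.C (-1/2) * (g + g2), ?_⟩
      rw [lin_add, lin_add, lin_add] at hc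
      rw [lin_add, lin_sub]
      have hC : (MvPolynomial.C (-1/2) : MvPolynomial σ ℚ) * 2 = -1 := by
        rw [show (2 : MvPolynomial σ ℚ) = MvPolynomial.C 2 from (map_ofNat MvPolynomial.C 2).symm, ← map_mul]
        norm_num
      linear_combination -(MvPolynomial.C (-1/2) * (1:MvPolynomial σ ℚ)) * hc + lin (ε j) * g * hC
    have I1 : ∀ k l, k ≠ i → k ≠ j → l ≠ i → l ≠ j → k ≠ l → ∀ s t : ℚ,
        ε j + ε k ≠ s • (ε i - ε j) + t • (ε j + ε l) := by
      intro k l hki hkj hli hlj hkl s t he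
      obtain ⟨m, hm1, hm2, hm3⟩ := hex4 i j k l
      obtain ⟨φ, hφ⟩ := hψ k m
      have e1 := congrArg φ he
      simp [hφ, hki.symm, hkj.symm, hm1.1.symm, hm1.2.symm, hm2.symm, hm3.symm, hkl.symm] at e1
    have I2 : ∀ k, k ≠ i → k ≠ j → ∀ s t : ℚ, ε j ≠ s • (ε i - ε j) + t • (ε j + ε k) := by
      intro k hki hkj s t he
      obtain ⟨m, hm1, hm2, hm3⟩ := hex3 i j k
      obtain ⟨φ, hφ⟩ := hψ k m
      obtain ⟨φ', hφ'⟩ := hψ i m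
      obtain ⟨φ'', hφ''⟩ := hψ j m
      have e1 := congrArg φ he
      have e2 := congrArg φ' he
      have e3 := congrArg φ'' he
      simp [hφ, hki.symm, hkj.symm, hm1.symm, hm2.symm, hm3.symm] at e1
      simp [hφ', hki, hij.symm, hm1.symm, hm2.symm, hm3.symm] at e2
      simp [hφ'', hkj, hij, hm1.symm, hm2.symm, hm3.symm] at e3
      subst e1; subst e2; norm_num at e3
    have hdw := three_mod (ε i - ε j) (ε j + ε k) (ε j + ε l) (ε j + ε m) (ε j) (nzd i j hij)
      (I1 k l hki hkj hli hlj hkl) (I1 l m hli hlj hmi hmj hlm) (I1 m k hmi hmj hki hkj hkm.symm)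
      (I2 k hki hkj) (I2 l hli hlj) (I2 m hmi hmj) g hgd (D k hki hkj) (D l hli hlj) (D m hmi hmj)
    obtain ⟨g', hg'⟩ := hdw
    refine ⟨g', ?_, ?_⟩
    · rw [hg, hg', lin_add, lin_sub]; ring
    · rcases deg_of_mul_lin (nzd i j hij) hg' hgd with h | h
      · exact h
      · rw [h]; simp
  -- cocycle
  choose ℓ hℓ hℓd using fun i j => fun h : i ≠ j => stepB i j h
  have stepC : ∀ j k (hj : (0:Fin 5) ≠ j) (hk : (0:Fin 5) ≠ k), ℓ 0 j hj = ℓ 0 k hk := by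
    intro j k hj hk
    by_cases hjk : j = k
    · subst hjk; rfl
    have e1 := hℓ 0 j hj
    have e2 := hℓ 0 k hk
    have e3 := hℓ j k hjk
    have hc : (lin (ε 0) ^ 2 - lin (ε j) ^ 2) * (ℓ 0 j hj - ℓ 0 k hk) =
        - ((lin (ε j) - lin (ε k)) * (lin (ε j) + lin (ε k))) * (ℓ j k hjk - ℓ 0 k hk) := by
      linear_combination e2 - e1 - e3
    have hcop : ∀ p : MvPolynomial σ ℚ, Prime p → ¬ p ∣ lin (ε 0 + ε j) → ¬ p ∣ lin (ε 0 - ε j) →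
        p ∣ (lin (ε j) - lin (ε k)) * (lin (ε j) + lin (ε k)) → p ∣ (ℓ 0 j hj - ℓ 0 k hk) := by
      intro p pp n1 n2 hdv
      have : p ∣ (lin (ε 0) ^ 2 - lin (ε j) ^ 2) * (ℓ 0 j hj - ℓ 0 k hk) := by
        rw [hc, neg_mul, dvd_neg]; exact Dvd.dvd.mul_right hdv _
      rcases pp.dvd_or_dvd this with h | h
      · rw [sq_sub_sq, ← lin_add, ← lin_sub] at h
        rcases pp.dvd_or_dvd h with h | h
        · exact absurd h n1
        · exact absurd h n2
      · exact h
    have P1 := prime_lin (nzs j k hjk)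
    have P2 := prime_lin (nzd j k hjk)
    obtain ⟨m, hm1, hm2, hm3⟩ := hex3 0 j k
    obtain ⟨φ, hφ⟩ := hψ 0 m
    obtain ⟨φ', hφ'⟩ := hψ j m
    obtain ⟨φ'', hφ''⟩ := hψ k m
    have hj' := hj.symm
    have hk' := hk.symm
    have hm1' := hm1.symm
    have hm2' := hm2.symm
    have hm3' := hm3.symm
    have hkj : k ≠ j := fun h => hjk h.symm
    have D1 : lin (ε j + ε k) ∣ (ℓ 0 j hj - ℓ 0 k hk) := by
      refine hcop _ P1 (not_lin_dvd (nzs j k hjk) fun t ht => ?_)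
        (not_lin_dvd (nzs j k hjk) fun t ht => ?_) (by rw [lin_add]; exact Dvd.intro_left _ rfl)
      · have e1 := congrArg φ ht
        simp [hφ, hj', hk', hm1', hm2', hm3'] at e1
      · have e1 := congrArg φ ht
        simp [hφ, hj', hk', hm1', hm2', hm3'] at e1
    have D2 : lin (ε j - ε k) ∣ (ℓ 0 j hj - ℓ 0 k hk) := by
      refine hcop _ P2 (not_lin_dvd (nzd j k hjk) fun t ht => ?_)
        (not_lin_dvd (nzd j k hjk) fun t ht => ?_) (by rw [lin_sub]; exact Dvd.intro _ rfl)
      · have e1 := congrArg φ ht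
        simp [hφ, hj', hk', hm1', hm2', hm3'] at e1
      · have e1 := congrArg φ ht
        simp [hφ, hj', hk', hm1', hm2', hm3'] at e1
    obtain ⟨g, hg⟩ := D1
    have D3 : lin (ε j - ε k) ∣ g := by
      rw [hg] at D2
      refine (P2.dvd_or_dvd D2).resolve_left (not_lin_dvd (nzd j k hjk) fun t ht => ?_)
      have e1 := congrArg φ' ht
      have e2 := congrArg φ'' ht
      simp [hφ', hjk, hkj, hm2', hm3'] at e1
      simp [hφ'', hjk, hkj, hm2', hm3'] at e2
      rw [← e1] at e2; norm_num at e2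
    have : ℓ 0 j hj - ℓ 0 k hk = 0 := by
      apply eq_zero_of_dvd_deg (f := lin (ε j + ε k) * lin (ε j - ε k))
      · rw [hg]; exact mul_dvd_mul_left _ D3
      · rw [MvPolynomial.totalDegree_mul_of_isDomain P1.ne_zero P2.ne_zero,
          totalDegree_lin_eq (nzs j k hjk), totalDegree_lin_eq (nzd j k hjk)]
        exact lt_of_le_of_lt (MvPolynomial.totalDegree_sub _ _) (max_lt (hℓd _ _ _) (hℓd _ _ _))
    exact sub_eq_zero.1 this
  have h01 : (0 : Fin 5) ≠ 1 := by decide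
  have hform : ∀ j, H j = H 0 - (lin (ε 0) ^ 2 - lin (ε j) ^ 2) * ℓ 0 1 h01 := by
    intro j
    by_cases hj : 0 = j
    · subst hj; ring
    · rw [stepC 1 j h01 hj]
      linear_combination - hℓ 0 j hj
  have hlin0 : ∑ i, lin (ε i) = 0 := by
    have : ∀ s : Finset (Fin 5), lin (∑ i ∈ s, ε i) = ∑ i ∈ s, lin (ε i) := by
      intro s
      induction s using Finset.induction_on with
      | empty => simp [lin_zero]
      | insert a s ha ih => rw [sum_insert ha, sum_insert ha, lin_add, ih]
    rw [← this, h0, lin_zero]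
  have hfin : (∑ i, lin (ε i) ^ 3) * ℓ 0 1 h01 = 0 := by
    rw [Finset.sum_mul, ← hs]
    have h1 : ∑ i, lin (ε i) * H i = ∑ i, (lin (ε i) ^ 3 * ℓ 0 1 h01 +
        lin (ε i) * (H 0 - lin (ε 0) ^ 2 * ℓ 0 1 h01)) := by
      refine sum_congr rfl fun i _ => ?_
      rw [hform i]; ring
    rw [h1, Finset.sum_add_distrib, ← Finset.sum_mul univ (fun i => lin (ε i)) , hlin0, zero_mul, add_zero]
  have hl0 := (mul_eq_zero.1 hfin).resolve_left hcube
  rw [hform i, hl0]; ring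

end Deg
end CSA


namespace CSA

section K4
variable {n : ℕ}

/-- the five forms on four variables -/
def eps : Fin 5 → Fin 4 → ℚ :=
  ![![1, 0, 0, 0], ![0, 1, 0, 0], ![0, 0, 1, 0], ![0, 0, 0, 1], ![-1, -1, -1, -1]]

lemma eps_dual (i l : Fin 5) : ∃ φ : (Fin 4 → ℚ) →ₗ[ℚ] ℚ, ∀ k, φ (eps k) =
      (if k = i then 1 else 0) - (if k = l then 1 else 0) := by
  have : ∀ i : Fin 5, ∃ φ : (Fin 4 → ℚ) →ₗ[ℚ] ℚ, ∀ k, φ (eps k) =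
      (if k = i then 1 else 0) - (if k = 4 then 1 else 0) := by
    intro i
    by_cases hi : i = 4
    · refine ⟨0, fun k => ?_⟩
      subst hi; simp
    · have hi4 : i.val < 4 := by
        have := i.2
        have h2 : i.val ≠ 4 := fun h => hi (Fin.ext h)
        omega
      refine ⟨LinearMap.proj ⟨i.val, hi4⟩, fun k => ?_⟩
      simp only [LinearMap.proj_apply]
      fin_cases i <;> fin_cases k <;> simp [eps] at hi ⊢
  obtain ⟨φ, hφ⟩ := this i
  obtain ⟨φ', hφ'⟩ := this l
  refine ⟨φ - φ', fun k => ?_⟩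
  rw [LinearMap.sub_apply, hφ, hφ']
  ring

lemma lin_eps (i : Fin 5) : lin (eps i) = (![MvPolynomial.X 0, MvPolynomial.X 1, MvPolynomial.X 2,
    MvPolynomial.X 3, -(MvPolynomial.X 0 + MvPolynomial.X 1 + MvPolynomial.X 2 +
      MvPolynomial.X 3)] : Fin 5 → MvPolynomial (Fin 4) ℚ) i := by
  fin_cases i <;> simp [eps, lin, Fin.sum_univ_four]
  ring

theorem K4_exact {G : SimpleGraph (Fin n)} (W : Fin 4 → Finset (Fin n))
    (hW : ∀ i j, i < j → Disjoint (W i) (W j)) (hWc : ∀ j, ConnSet G (W j))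
    (hlo : ∀ e ∈ [((0 : Fin 4), (1 : Fin 4)), (0, 2), (0, 3), (1, 2), (1, 3), (2, 3)],
      AdjS G (W e.1) (W e.2)) :
    NF G := by
  refine nonfree_minor W (fun i j hij => ?_) hWc _ (fun i j => true) (tab_lo hlo)
    (fun i j _ h => rfl) (fun _ => 0) (fun _ => 1) (univ.erase ∅) (by decide +kernel)
    (by decide +kernel) (d := 3) (e := 4) (by norm_num) (by decide +kernel)
    ![{0}, {1}, {2}, {3}] (by decide +kernel) (li_of_dual _
      ![![1, 0, 0, 0], ![0, 1, 0, 0], ![0, 0, 1, 0], ![0, 0, 0, 1]] (by decide +kernel)) ?_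
  · rcases lt_or_gt_of_ne hij with h | h
    · exact hW i j h
    · exact (hW j i h).symm
  intro q h hq hd
  have hm : ∀ L : Finset (Fin 4), L ≠ ∅ → L ∈ (univ.erase ∅ : Finset (Finset (Fin 4))) := by
    intro L hL; simp [hL]
  have hq' : ∀ L : Finset (Fin 4), L ≠ ∅ → ∑ j ∈ L, q j = al L * h L := fun L hL => hq L (hm L hL)
  have key := five_forms eps (by decide +kernel) eps_dual ?_
    ![h {0}, h {1}, h {2}, h {3}, h {0, 1, 2, 3}] ?_ ?_ ?_
  · intro i
    have a := key 1
    have b := key 2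
    have c := key 3
    simp at a b c
    fin_cases i <;> simp [a, b, c]
  · intro h0
    have := congrArg (MvPolynomial.eval (![1, 1, 0, 0] : Fin 4 → ℚ)) h0
    simp only [lin_eps] at this
    simp [Fin.sum_univ_five] at this
    norm_num at this
  · intro i
    have := fun L hL => hd L (hm L hL)
    fin_cases i <;> exact this _ (by decide)
  · simp only [lin_eps]
    have h0 := hq' {0} (by decide)
    have h1 := hq' {1} (by decide)
    have h2 := hq' {2} (by decide)
    have h3 := hq' {3} (by decide)
    have h4 := hq' {0, 1, 2, 3} (by decide)
    simp [al] at h0 h1 h2 h3 h4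
    simp [Fin.sum_univ_five]
    linear_combination h4 - h0 - h1 - h2 - h3
  · have h0 := hq' {0} (by decide)
    have h1 := hq' {1} (by decide)
    have h2 := hq' {2} (by decide)
    have h3 := hq' {3} (by decide)
    have h4 := hq' {0, 1, 2, 3} (by decide)
    have h01 := hq' {0, 1} (by decide)
    have h02 := hq' {0, 2} (by decide)
    have h03 := hq' {0, 3} (by decide)
    have h12 := hq' {1, 2} (by decide)
    have h13 := hq' {1, 3} (by decide)
    have h23 := hq' {2, 3} (by decide)
    have h012 := hq' {0, 1, 2} (by decide)
    have h013 := hq' {0, 1, 3} (by decide)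
    have h023 := hq' {0, 2, 3} (by decide)
    have h123 := hq' {1, 2, 3} (by decide)
    simp [al] at h0 h1 h2 h3 h4 h01 h02 h03 h12 h13 h23 h012 h013 h023 h123
    have main : ∀ i j : Fin 5, i < j → lin (eps i + eps j) ∣
        lin (eps i) * ![h {0}, h {1}, h {2}, h {3}, h {0, 1, 2, 3}] i +
        lin (eps j) * ![h {0}, h {1}, h {2}, h {3}, h {0, 1, 2, 3}] j := by
      intro i j hij
      simp only [lin_add, lin_eps]
      fin_cases i <;> fin_cases j <;> simp at hij ⊢
      · exact ⟨h {0, 1}, by linear_combination h01 - h0 - h1⟩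
      · exact ⟨h {0, 2}, by linear_combination h02 - h0 - h2⟩
      · exact ⟨h {0, 3}, by linear_combination h03 - h0 - h3⟩
      · exact ⟨h {1, 2, 3}, by linear_combination h4 - h123 - h0⟩
      · exact ⟨h {1, 2}, by linear_combination h12 - h1 - h2⟩
      · exact ⟨h {1, 3}, by linear_combination h13 - h1 - h3⟩
      · exact ⟨h {0, 2, 3}, by linear_combination h4 - h023 - h1⟩
      · exact ⟨h {2, 3}, by linear_combination h23 - h2 - h3⟩
      · exact ⟨h {0, 1, 3}, by linear_combination h4 - h013 - h2⟩
      · exact ⟨h {0, 1, 2}, by linear_combination h4 - h012 - h3⟩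
    intro i j hij
    rcases lt_or_gt_of_ne hij with h | h
    · exact main i j h
    · rw [add_comm (eps i), add_comm (lin (eps i) * _)]
      exact main j i h

lemma tri {σ : Type*} [Fintype σ] [DecidableEq σ] {a b : σ → ℚ} (hb : b ≠ 0)
    (hab : ¬ lin b ∣ lin a) {h1 h2 h3 : MvPolynomial σ ℚ}
    (hd : h1.totalDegree < 2) (hd3 : h3.totalDegree < 2)
    (h : lin a * h1 + lin b * h2 = (lin a + lin b) * h3) :
    ∃ c : ℚ, h1 - h3 = MvPolynomial.C c * lin b ∧ h2 - h3 = - MvPolynomial.C c * lin a := by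
  have hdv : lin b ∣ lin a * (h1 - h3) := ⟨h3 - h2, by linear_combination h⟩
  obtain ⟨g, hg⟩ := ((prime_lin hb).dvd_or_dvd hdv).resolve_left hab
  have hgd : g.totalDegree = 0 := by
    have : (h1 - h3).totalDegree < 1 + 1 :=
      lt_of_le_of_lt (MvPolynomial.totalDegree_sub _ _) (max_lt hd hd3)
    rcases deg_of_mul_lin hb hg this with h | h
    · omega
    · rw [h]; simp
  have hgC := MvPolynomial.totalDegree_eq_zero_iff_eq_C.1 hgd
  refine ⟨g.coeff 0, ?_, ?_⟩
  · rw [hg, ← hgC]; ring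
  · rw [← hgC]
    have : lin b * (h2 - h3) = lin b * (-g * lin a) := by linear_combination h - lin a * hg
    exact mul_left_cancel₀ (prime_lin hb).ne_zero this

theorem diamond_exact {G : SimpleGraph (Fin n)} (W : Fin 4 → Finset (Fin n))
    (hW : ∀ i j, i < j → Disjoint (W i) (W j)) (hWc : ∀ j, ConnSet G (W j))
    (hlo : ∀ e ∈ [((0 : Fin 4), (1 : Fin 4)), (0, 2), (0, 3), (1, 2), (1, 3)],
      AdjS G (W e.1) (W e.2)) (hhi : ∀ e ∈ [((2 : Fin 4), (3 : Fin 4))], ¬ AdjS G (W e.1) (W e.2)) :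
    NF G := by
  refine nonfree_minor W (fun i j hij => ?_) hWc _ _ (tab_lo hlo)
    (fun i j _ h => tab_hi hhi i j h) ![0, 0, 1, -1] (fun _ => 1)
    {{0}, {1}, {0, 1}, {0, 2, 3}, {1, 2, 3}, {0, 1, 2, 3}} (by decide +kernel)
    (by decide +kernel) (d := 2) (e := 2) (by norm_num) (by decide +kernel)
    ![{0}, {1}, {0, 2, 3}] (by decide +kernel) (li_of_dual _
      ![![1, 0, -1, 0], ![0, 1, 0, 0], ![0, 0, 1, 0]] (by decide +kernel)) ?_
  · rcases lt_or_gt_of_ne hij with h | h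
    · exact hW i j h
    · exact (hW j i h).symm
  intro q h hq hd
  have h0 := hq {0} (by decide)
  have h1 := hq {1} (by decide)
  have h01 := hq {0, 1} (by decide)
  have h4 := hq {0, 2, 3} (by decide)
  have h5 := hq {1, 2, 3} (by decide)
  have h6 := hq {0, 1, 2, 3} (by decide)
  have nd : ∀ I J : Finset (Fin 4), I ≠ ∅ → J ≠ ∅ → I ≠ J → ¬ lin (ind I) ∣ lin (ind J) := by
    intro I J hI hJ hIJ hdv
    rw [← al_eq, ← al_eq] at hdv
    exact hIJ (al_dvd_al (nonempty_iff_ne_empty.2 hI) (nonempty_iff_ne_empty.2 hJ) hdv)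
  have nz : ∀ I : Finset (Fin 4), I ≠ ∅ → ind I ≠ 0 :=
    fun I hI => ind_ne_zero (nonempty_iff_ne_empty.2 hI)
  obtain ⟨g, e1, e2⟩ := tri (a := ind {0}) (b := ind {1}) (h1 := h {0}) (h2 := h {1})
    (h3 := h {0, 1}) (nz _ (by decide)) (nd _ _ (by decide) (by decide) (by decide))
    (hd _ (by decide)) (hd _ (by decide)) (by
      rw [← al_eq, ← al_eq]
      simp [al] at h0 h1 h01 ⊢
      linear_combination h01 - h0 - h1)
  obtain ⟨g', e1', e2'⟩ := tri (a := ind {0}) (b := ind {1, 2, 3}) (h1 := h {0})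
    (h2 := h {1, 2, 3}) (h3 := h {0, 1, 2, 3}) (nz _ (by decide))
    (nd _ _ (by decide) (by decide) (by decide)) (hd _ (by decide)) (hd _ (by decide)) (by
      rw [← al_eq, ← al_eq]
      simp [al] at h0 h5 h6 ⊢
      linear_combination h6 - h0 - h5)
  obtain ⟨g'', e1'', e2''⟩ := tri (a := ind {1}) (b := ind {0, 2, 3}) (h1 := h {1})
    (h2 := h {0, 2, 3}) (h3 := h {0, 1, 2, 3}) (nz _ (by decide))
    (nd _ _ (by decide) (by decide) (by decide)) (hd _ (by decide)) (hd _ (by decide)) (by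
      rw [← al_eq, ← al_eq]
      simp [al] at h1 h4 h6 ⊢
      linear_combination h6 - h1 - h4)
  rw [← al_eq] at e1 e2 e1' e2' e1'' e2''
  have hrel : MvPolynomial.C g * al ({1} : Finset (Fin 4)) + MvPolynomial.C g * al {0} -
      MvPolynomial.C g' * al {1, 2, 3} + MvPolynomial.C g'' * al {0, 2, 3} = 0 := by
    linear_combination - e1 + e2 + e1' - e1''
  have ev := fun v : Fin 4 → ℚ => congrArg (MvPolynomial.eval v) hrel
  have ev0 := ev ![1, 0, 0, 0]
  have ev1 := ev ![0, 1, 0, 0]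
  have ev2 := ev ![0, 0, 1, 0]
  simp [al] at ev0 ev1 ev2
  have hg'' : g'' = 0 := by linarith
  have hg' : g' = 0 := by linarith
  rw [hg'] at e1'
  rw [hg''] at e1'' e2''
  simp [sub_eq_zero] at e1' e1'' e2''
  intro i
  fin_cases i <;> simp [e1', e1'', e2'']

end K4
end CSA


namespace CSA

section Mdl
variable {n r s : ℕ}

/-- a (not necessarily induced) minor model -/
def MdlW (G : SimpleGraph (Fin n)) (W : Fin r → Finset (Fin n)) (E : List (Fin r × Fin r)) : Prop :=
  (∀ i j, i < j → Disjoint (W i) (W j)) ∧ (∀ j, ConnSet G (W j)) ∧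
    ∀ e ∈ E, AdjS G (W e.1) (W e.2)

lemma MdlW.cons {G : SimpleGraph (Fin n)} {W : Fin r → Finset (Fin n)} {E : List (Fin r × Fin r)}
    (h : MdlW G W E) (e : Fin r × Fin r) (he : AdjS G (W e.1) (W e.2)) : MdlW G W (e :: E) := by
  refine ⟨h.1, h.2.1, fun f hf => ?_⟩
  rcases List.mem_cons.1 hf with rfl | hf
  · exact he
  · exact h.2.2 f hf

lemma MdlW.map {G : SimpleGraph (Fin n)} {W : Fin r → Finset (Fin n)} {E : List (Fin r × Fin r)}
    (h : MdlW G W E) (K : Fin s → Finset (Fin r)) (F : List (Fin s × Fin s))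
    (hK : (∀ i j, i < j → Disjoint (K i) (K j)) ∧ (∀ i, CutConn (tab E) (K i)) ∧
      ∀ e ∈ F, ∃ a ∈ K e.1, ∃ b ∈ K e.2, tab E a b = true) :
    MdlW G (fun i => (K i).biUnion W) F := by
  have hW : ∀ i j, i ≠ j → Disjoint (W i) (W j) := by
    intro i j hij
    rcases lt_or_gt_of_ne hij with h' | h'
    · exact h.1 i j h'
    · exact (h.1 j i h').symm
  refine ⟨fun i j hij => ?_, fun i => connSet_biUnion h.2.1 (tab_lo h.2.2) (hK.2.1 i), fun e he => ?_⟩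
  · rw [disjoint_biUnion_left]
    intro a ha
    rw [disjoint_biUnion_right]
    intro b hb
    exact hW a b (fun hab => (disjoint_left.1 (hK.1 i j hij)) ha (hab ▸ hb))
  · obtain ⟨a, ha, b, hb, hab⟩ := hK.2.2 e he
    exact (tab_lo h.2.2 a b hab).mono (subset_biUnion_of_mem W ha) (subset_biUnion_of_mem W hb)

theorem NF_D {G : SimpleGraph (Fin n)} {W : Fin 4 → Finset (Fin n)}
    (h : MdlW G W [(0, 1), (0, 2), (0, 3), (1, 2), (1, 3)]) : NF G := by
  by_cases h23 : AdjS G (W 2) (W 3)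
  · refine K4_exact W h.1 h.2.1 (fun e he => ?_)
    have := (h.cons (2, 3) h23).2.2
    apply this
    revert e; decide
  · refine diamond_exact W h.1 h.2.1 h.2.2 (fun e he => ?_)
    rw [List.mem_singleton] at he
    subst he
    exact h23

theorem NF_K14 {G : SimpleGraph (Fin n)} {W : Fin 5 → Finset (Fin n)}
    (h : MdlW G W [(0, 1), (0, 2), (0, 3), (0, 4)]) : NF G := by
  by_cases hsh : ∃ i j k : Fin 5, (i ≠ 0 ∧ j ≠ 0 ∧ k ≠ 0 ∧ i ≠ j ∧ i ≠ k ∧ j ≠ k) ∧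
      AdjS G (W i) (W j) ∧ AdjS G (W i) (W k)
  · obtain ⟨i, j, k, hijk, h1, h2⟩ := hsh
    have h' := (h.cons (i, j) h1).cons (i, k) h2
    refine NF_D (h'.map (s := 4) ![{0}, {i}, {j}, {k}] _ ⟨?_, ?_, ?_⟩)
    · clear h' h1 h2
      revert i j k
      decide +kernel
    · clear h' h1 h2
      revert i j k
      decide +kernel
    · clear h' h1 h2
      revert i j k
      decide +kernel
  · have hsh' : ∀ i j k : Fin 5, (i ≠ 0 ∧ j ≠ 0 ∧ k ≠ 0 ∧ i ≠ j ∧ i ≠ k ∧ j ≠ k) →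
        AdjS G (W i) (W j) → ¬ AdjS G (W i) (W k) := by
      intro i j k hijk h1 h2
      exact hsh ⟨i, j, k, hijk, h1, h2⟩
    have main : ∀ π : Fin 5 → Fin 5, Function.Injective π → π 0 = 0 →
        (AdjS G (W (π 1)) (W (π 2)) ∨ AdjS G (W (π 3)) (W (π 4)) ∨
          ∀ i j : Fin 5, i ≠ 0 → j ≠ 0 → i ≠ j → ¬ AdjS G (W i) (W j)) → NF G := by
      intro π hπ h0 hc
      have hne : ∀ i : Fin 5, i ≠ 0 → π i ≠ 0 := fun i hi h => hi (hπ (h.trans h0.symm))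
      have hne2 : ∀ i j : Fin 5, i ≠ j → π i ≠ π j := fun i j hij h => hij (hπ h)
      refine K14_exact (fun i => W (π i)) (fun i j hij => ?_) (fun j => h.2.1 _) (fun e he => ?_)
        (fun e he hadj => ?_)
      · rcases lt_or_gt_of_ne (hne2 i j hij.ne) with h' | h'
        · exact h.1 _ _ h'
        · exact (h.1 _ _ h').symm
      · have h1 : e.1 = 0 ∧ e.2 ≠ 0 := by revert e; decide
        have h2 : ∀ i : Fin 5, i ≠ 0 → AdjS G (W 0) (W i) := by
          intro i hi
          refine h.2.2 (0, i) ?_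
          revert i; decide
        rw [h1.1, h0]
        exact h2 _ (hne _ h1.2)
      · have h12 : (e.1 = 1 ∨ e.1 = 2) ∧ (e.2 = 3 ∨ e.2 = 4) := by clear hadj; revert e; decide
        have hd : e.1 ≠ 0 ∧ e.2 ≠ 0 ∧ e.1 ≠ e.2 := by clear hadj h12; revert e; decide
        rcases hc with hc | hc | hc
        · rcases h12.1 with h1 | h1
          · rw [h1] at hadj
            refine hsh' (π 1) (π 2) (π e.2) ⟨hne _ (by decide), hne _ (by decide), hne _ hd.2.1,
              hne2 _ _ (by decide), hne2 _ _ (h1 ▸ hd.2.2), hne2 _ _ ?_⟩ hc hadj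
            rcases h12.2 with h2 | h2 <;> rw [h2] <;> decide
          · rw [h1] at hadj
            refine hsh' (π 2) (π 1) (π e.2) ⟨hne _ (by decide), hne _ (by decide), hne _ hd.2.1,
              hne2 _ _ (by decide), hne2 _ _ (h1 ▸ hd.2.2), hne2 _ _ ?_⟩ hc.symm hadj
            rcases h12.2 with h2 | h2 <;> rw [h2] <;> decide
        · rcases h12.2 with h1 | h1
          · rw [h1] at hadj
            refine hsh' (π 3) (π 4) (π e.1) ⟨hne _ (by decide), hne _ (by decide), hne _ hd.1,
              hne2 _ _ (by decide), hne2 _ _ (h1 ▸ hd.2.2.symm), hne2 _ _ ?_⟩ hc hadj.symm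
            rcases h12.1 with h2 | h2 <;> rw [h2] <;> decide
          · rw [h1] at hadj
            refine hsh' (π 4) (π 3) (π e.1) ⟨hne _ (by decide), hne _ (by decide), hne _ hd.1,
              hne2 _ _ (by decide), hne2 _ _ (h1 ▸ hd.2.2.symm), hne2 _ _ ?_⟩ hc.symm hadj.symm
            rcases h12.1 with h2 | h2 <;> rw [h2] <;> decide
        · exact hc _ _ (hne _ hd.1) (hne _ hd.2.1) (hne2 _ _ hd.2.2) hadj
    by_cases hany : ∃ i j : Fin 5, (i ≠ 0 ∧ j ≠ 0 ∧ i ≠ j) ∧ AdjS G (W i) (W j)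
    · obtain ⟨i, j, hij, ha⟩ := hany
      have hπ : ∀ i j : Fin 5, (i ≠ 0 ∧ j ≠ 0 ∧ i ≠ j) → ∃ k l : Fin 5,
        Function.Injective ![0, i, j, k, l] := by decide +kernel
      obtain ⟨k, l, hkl⟩ := hπ i j hij
      exact main _ hkl rfl (Or.inl ha)
    · refine main id Function.injective_id rfl (Or.inr (Or.inr ?_))
      intro i j hi hj hij ha
      exact hany ⟨i, j, ⟨hi, hj, hij⟩, ha⟩

theorem NF_C4p {G : SimpleGraph (Fin n)} {W : Fin 5 → Finset (Fin n)}
    (h : MdlW G W [(0, 1), (1, 2), (2, 3), (0, 3), (0, 4)]) : NF G := by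
  by_cases c02 : AdjS G (W 0) (W 2)
  · exact NF_D ((h.cons (0, 2) c02).map ![{0}, {2}, {1}, {3}] _ (by decide +kernel))
  by_cases c13 : AdjS G (W 1) (W 3)
  · exact NF_D ((h.cons (1, 3) c13).map ![{1}, {3}, {0}, {2}] _ (by decide +kernel))
  by_cases c14 : AdjS G (W 1) (W 4)
  · exact NF_D ((h.cons (1, 4) c14).map ![{0}, {1}, {4}, {2, 3}] _ (by decide +kernel))
  by_cases c24 : AdjS G (W 2) (W 4)
  · exact NF_D ((h.cons (2, 4) c24).map ![{0}, {1, 2}, {3}, {4}] _ (by decide +kernel))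
  by_cases c34 : AdjS G (W 3) (W 4)
  · exact NF_D ((h.cons (3, 4) c34).map ![{0}, {3}, {4}, {1, 2}] _ (by decide +kernel))
  refine C4p_exact W h.1 h.2.1 h.2.2 (fun e he => ?_)
  simp only [List.mem_cons, List.not_mem_nil, or_false] at he
  rcases he with rfl | rfl | rfl | rfl | rfl <;> assumption

theorem NF_net {G : SimpleGraph (Fin n)} {W : Fin 6 → Finset (Fin n)}
    (h : MdlW G W [(0, 1), (1, 2), (0, 2), (0, 3), (1, 4), (2, 5)]) : NF G := by
  by_cases c04 : AdjS G (W 0) (W 4)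
  · exact NF_D ((h.cons (0, 4) c04).map ![{0}, {1}, {2}, {4}] _ (by decide +kernel))
  by_cases c05 : AdjS G (W 0) (W 5)
  · exact NF_D ((h.cons (0, 5) c05).map ![{0}, {2}, {1}, {5}] _ (by decide +kernel))
  by_cases c13 : AdjS G (W 1) (W 3)
  · exact NF_D ((h.cons (1, 3) c13).map ![{0}, {1}, {2}, {3}] _ (by decide +kernel))
  by_cases c15 : AdjS G (W 1) (W 5)
  · exact NF_D ((h.cons (1, 5) c15).map ![{1}, {2}, {0}, {5}] _ (by decide +kernel))
  by_cases c23 : AdjS G (W 2) (W 3)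
  · exact NF_D ((h.cons (2, 3) c23).map ![{0}, {2}, {1}, {3}] _ (by decide +kernel))
  by_cases c24 : AdjS G (W 2) (W 4)
  · exact NF_D ((h.cons (2, 4) c24).map ![{1}, {2}, {0}, {4}] _ (by decide +kernel))
  by_cases c34 : AdjS G (W 3) (W 4)
  · exact NF_D ((h.cons (3, 4) c34).map ![{0}, {1}, {2}, {3, 4}] _ (by decide +kernel))
  by_cases c35 : AdjS G (W 3) (W 5)
  · exact NF_D ((h.cons (3, 5) c35).map ![{0}, {2}, {1}, {3, 5}] _ (by decide +kernel))
  by_cases c45 : AdjS G (W 4) (W 5)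
  · exact NF_D ((h.cons (4, 5) c45).map ![{1}, {2}, {0}, {4, 5}] _ (by decide +kernel))
  refine net_exact W h.1 h.2.1 h.2.2 (fun e he => ?_)
  simp only [List.mem_cons, List.not_mem_nil, or_false] at he
  rcases he with rfl | rfl | rfl | rfl | rfl | rfl | rfl | rfl | rfl <;> assumption

theorem NF_S222 {G : SimpleGraph (Fin n)} {W : Fin 7 → Finset (Fin n)}
    (h : MdlW G W [(0, 1), (1, 2), (0, 3), (3, 4), (0, 5), (5, 6)]) : NF G := by
  by_cases c02 : AdjS G (W 0) (W 2)
  · exact NF_K14 ((h.cons (0, 2) c02).map ![{0}, {1}, {2}, {3}, {5}] _ (by decide +kernel))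
  by_cases c04 : AdjS G (W 0) (W 4)
  · exact NF_K14 ((h.cons (0, 4) c04).map ![{0}, {1}, {3}, {4}, {5}] _ (by decide +kernel))
  by_cases c06 : AdjS G (W 0) (W 6)
  · exact NF_K14 ((h.cons (0, 6) c06).map ![{0}, {1}, {3}, {5}, {6}] _ (by decide +kernel))
  by_cases c13 : AdjS G (W 1) (W 3)
  · exact NF_net ((h.cons (1, 3) c13).map ![{0}, {1}, {3}, {5}, {2}, {4}] _ (by decide +kernel))
  by_cases c14 : AdjS G (W 1) (W 4)
  · exact NF_K14 ((h.cons (1, 4) c14).map ![{0, 1}, {2}, {3}, {4}, {5}] _ (by decide +kernel))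
  by_cases c15 : AdjS G (W 1) (W 5)
  · exact NF_net ((h.cons (1, 5) c15).map ![{0}, {1}, {5}, {3}, {2}, {6}] _ (by decide +kernel))
  by_cases c16 : AdjS G (W 1) (W 6)
  · exact NF_K14 ((h.cons (1, 6) c16).map ![{0, 1}, {2}, {3}, {5}, {6}] _ (by decide +kernel))
  by_cases c23 : AdjS G (W 2) (W 3)
  · exact NF_K14 ((h.cons (2, 3) c23).map ![{0, 3}, {1}, {2}, {4}, {5}] _ (by decide +kernel))
  by_cases c24 : AdjS G (W 2) (W 4)
  · exact NF_C4p ((h.cons (2, 4) c24).map ![{0}, {1}, {2}, {3, 4}, {5}] _ (by decide +kernel))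
  by_cases c25 : AdjS G (W 2) (W 5)
  · exact NF_K14 ((h.cons (2, 5) c25).map ![{0, 5}, {1}, {2}, {3}, {6}] _ (by decide +kernel))
  by_cases c26 : AdjS G (W 2) (W 6)
  · exact NF_C4p ((h.cons (2, 6) c26).map ![{0}, {1}, {2}, {5, 6}, {3}] _ (by decide +kernel))
  by_cases c35 : AdjS G (W 3) (W 5)
  · exact NF_net ((h.cons (3, 5) c35).map ![{0}, {3}, {5}, {1}, {4}, {6}] _ (by decide +kernel))
  by_cases c36 : AdjS G (W 3) (W 6)
  · exact NF_K14 ((h.cons (3, 6) c36).map ![{0, 3}, {1}, {4}, {5}, {6}] _ (by decide +kernel))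
  by_cases c45 : AdjS G (W 4) (W 5)
  · exact NF_K14 ((h.cons (4, 5) c45).map ![{0, 5}, {1}, {3}, {4}, {6}] _ (by decide +kernel))
  by_cases c46 : AdjS G (W 4) (W 6)
  · exact NF_C4p ((h.cons (4, 6) c46).map ![{0}, {3}, {4}, {5, 6}, {1}] _ (by decide +kernel))
  refine S222_exact W h.1 h.2.1 h.2.2 (fun e he => ?_)
  simp only [List.mem_cons, List.not_mem_nil, or_false] at he
  rcases he with rfl | rfl | rfl | rfl | rfl | rfl | rfl | rfl | rfl | rfl | rfl | rfl | rfl | rfl | rfl <;> assumption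

end Mdl
end CSA


namespace CSA

section Weight
variable {σ : Type*}

/-- weight bound for polynomials over the polynomial ring -/
def Wt (d : ℕ) (F : Polynomial (MvPolynomial σ ℚ)) : Prop :=
  ∀ s, F.coeff s ≠ 0 → (F.coeff s).totalDegree + s ≤ d

lemma Wt.mono {d e : ℕ} {F : Polynomial (MvPolynomial σ ℚ)} (h : Wt d F) (hde : d ≤ e) : Wt e F :=
  fun s hs => (h s hs).trans hde

lemma Wt.natDegree_le {d : ℕ} {F : Polynomial (MvPolynomial σ ℚ)} (h : Wt d F) :
    F.natDegree ≤ d := by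
  by_cases hF : F = 0
  · simp [hF]
  · have := h F.natDegree (by simpa using hF)
    omega

lemma Wt.add {d : ℕ} {F H : Polynomial (MvPolynomial σ ℚ)} (h : Wt d F) (h' : Wt d H) :
    Wt d (F + H) := by
  intro s hs
  rw [Polynomial.coeff_add] at hs ⊢
  by_cases h1 : F.coeff s = 0
  · rw [h1, zero_add] at hs ⊢; exact h' s hs
  by_cases h2 : H.coeff s = 0
  · rw [h2, add_zero] at hs ⊢; exact h s hs
  have a := h s h1
  have b := h' s h2
  have := MvPolynomial.totalDegree_add (F.coeff s) (H.coeff s)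
  have : max (F.coeff s).totalDegree (H.coeff s).totalDegree + s ≤ d := by omega
  omega

lemma Wt.zero (d : ℕ) : Wt d (0 : Polynomial (MvPolynomial σ ℚ)) := by
  intro s hs; simp at hs

lemma Wt.sum {ι : Type*} {d : ℕ} (T : Finset ι) (F : ι → Polynomial (MvPolynomial σ ℚ))
    (h : ∀ i ∈ T, Wt d (F i)) : Wt d (∑ i ∈ T, F i) := by
  classical
  induction T using Finset.induction_on with
  | empty => simpa using Wt.zero d
  | insert a T ha ih =>
    rw [sum_insert ha]
    exact (h a (mem_insert_self _ _)).add (ih fun i hi => h i (mem_insert_of_mem hi))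

lemma Wt.monomial (s d : ℕ) (c : MvPolynomial σ ℚ) (h : c.totalDegree + s ≤ d) :
    Wt d (Polynomial.monomial s c) := by
  intro s' hs'
  rw [Polynomial.coeff_monomial] at hs' ⊢
  split_ifs at hs' ⊢ with h1
  · subst h1; exact h
  · exact absurd rfl hs'

lemma Wt.mul {d e : ℕ} {F H : Polynomial (MvPolynomial σ ℚ)} (h : Wt d F) (h' : Wt e H) :
    Wt (d + e) (F * H) := by
  intro s hs
  rw [Polynomial.coeff_mul] at hs ⊢
  have : (∑ x ∈ antidiagonal s, F.coeff x.1 * H.coeff x.2).totalDegree ≤ d + e - s := by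
    refine MvPolynomial.totalDegree_finsetSum_le fun x hx => ?_
    rw [Finset.HasAntidiagonal.mem_antidiagonal] at hx
    by_cases h1 : F.coeff x.1 = 0
    · simp [h1]
    by_cases h2 : H.coeff x.2 = 0
    · simp [h2]
    have a := h _ h1
    have b := h' _ h2
    have := MvPolynomial.totalDegree_mul (F.coeff x.1) (H.coeff x.2)
    omega
  obtain ⟨x, hx, hne⟩ := exists_ne_zero_of_sum_ne_zero hs
  rw [Finset.HasAntidiagonal.mem_antidiagonal] at hx
  have a := h _ (left_ne_zero_of_mul hne)
  have b := h' _ (right_ne_zero_of_mul hne)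
  omega

lemma Wt.one : Wt 0 (1 : Polynomial (MvPolynomial σ ℚ)) := by
  have := Wt.monomial (σ := σ) 0 0 1 (by simp)
  simpa using this

lemma Wt.X_pow (s : ℕ) : Wt s (Polynomial.X ^ s : Polynomial (MvPolynomial σ ℚ)) := by
  have := Wt.monomial (σ := σ) s s 1 (by simp)
  rwa [Polynomial.monomial_one_right_eq_X_pow] at this

lemma Wt.linear (c : MvPolynomial σ ℚ) (hc : c.totalDegree ≤ 1) :
    Wt 1 (Polynomial.X - Polynomial.C c) := by
  rw [sub_eq_add_neg, ← map_neg]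
  have h1 := Wt.X_pow (σ := σ) 1
  rw [pow_one] at h1
  refine h1.add ?_
  rw [← Polynomial.monomial_zero_left]
  exact Wt.monomial 0 1 _ (by rw [MvPolynomial.totalDegree_neg]; omega)

lemma Wt.prod {ι : Type*} (T : Finset ι) (F : ι → Polynomial (MvPolynomial σ ℚ))
    (h : ∀ i ∈ T, Wt 1 (F i)) : Wt T.card (∏ i ∈ T, F i) := by
  classical
  induction T using Finset.induction_on with
  | empty => simpa using Wt.one
  | insert a T ha ih =>
    rw [prod_insert ha, card_insert_of_notMem ha, add_comm]
    exact (h a (mem_insert_self _ _)).mul (ih fun i hi => h i (mem_insert_of_mem hi))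

lemma Wt.eval_le {d : ℕ} {F : Polynomial (MvPolynomial σ ℚ)} (h : Wt d F) (y : MvPolynomial σ ℚ)
    (hy : y.totalDegree ≤ 1) : (F.eval y).totalDegree ≤ d := by
  rw [Polynomial.eval_eq_sum, Polynomial.sum]
  refine MvPolynomial.totalDegree_finsetSum_le fun s hs => ?_
  have a := h s (Polynomial.mem_support_iff.1 hs)
  have b := MvPolynomial.totalDegree_mul (F.coeff s) (y ^ s)
  have c := MvPolynomial.totalDegree_pow y s
  have : s * y.totalDegree ≤ s * 1 := Nat.mul_le_mul_left _ hy
  omega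

/-- discrete antiderivative -/
lemma exists_antideriv (t : MvPolynomial σ ℚ) (ht : t.totalDegree ≤ 1) (d : ℕ) (s : ℕ) :
    ∀ g : Polynomial (MvPolynomial σ ℚ), Wt d g → g.degree < s →
      ∃ F : Polynomial (MvPolynomial σ ℚ), Wt (d + 1) F ∧
        F.comp (Polynomial.X + Polynomial.C t) - F = Polynomial.C t * g := by
  induction s with
  | zero =>
    intro g _ hg
    have : g = 0 := by
      apply Polynomial.degree_eq_bot.1
      exact (Nat.WithBot.lt_zero_iff).1 (by simpa using hg)
    exact ⟨0, Wt.zero _, by simp [this]⟩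
  | succ s ih =>
    intro g hg hgs
    set c := g.coeff s with hc
    set q : MvPolynomial σ ℚ := MvPolynomial.C ((s + 1 : ℚ)⁻¹) with hq
    have hq1 : q * ((s : MvPolynomial σ ℚ) + 1) = 1 := by
      have : ((s : MvPolynomial σ ℚ) + 1) = MvPolynomial.C (s + 1 : ℚ) := by simp
      rw [this, hq, ← map_mul, inv_mul_cancel₀ (by positivity), map_one]
    set L : Polynomial (MvPolynomial σ ℚ) := ∑ i ∈ range s,
      Polynomial.monomial i (c * q * (t ^ (s - i) * ((s + 1).choose i : MvPolynomial σ ℚ))) with hL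
    by_cases hc0 : c = 0
    · apply ih g hg
      refine Polynomial.degree_lt_iff_coeff_zero _ _ |>.2 fun k hk => ?_
      rcases hk.eq_or_lt with rfl | hk
      · exact hc0
      · exact (Polynomial.degree_lt_iff_coeff_zero _ _ |>.1 hgs) k hk
    have hcd : c.totalDegree + s ≤ d := hg s hc0
    have hLW : Wt d L := by
      refine Wt.sum _ _ fun i hi => Wt.monomial _ _ _ ?_
      have hi := mem_range.1 hi
      have h1 := MvPolynomial.totalDegree_mul (c * q) (t ^ (s - i) * ((s + 1).choose i : MvPolynomial σ ℚ))
      have h2 := MvPolynomial.totalDegree_mul c q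
      have h3 := MvPolynomial.totalDegree_mul (t ^ (s - i)) ((s + 1).choose i : MvPolynomial σ ℚ)
      have h4 := MvPolynomial.totalDegree_pow t (s - i)
      have h5 : (s - i) * t.totalDegree ≤ (s - i) * 1 := Nat.mul_le_mul_left _ ht
      have h6 : q.totalDegree = 0 := by rw [hq]; exact MvPolynomial.totalDegree_C _
      have h7 : (((s + 1).choose i : ℕ) : MvPolynomial σ ℚ).totalDegree = 0 := by
        rw [← map_natCast (MvPolynomial.C : ℚ →+* MvPolynomial σ ℚ)]
        exact MvPolynomial.totalDegree_C _
      omega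
    have hLdeg : L.degree < s := by
      refine (Polynomial.degree_sum_le _ _).trans_lt ?_
      rw [Finset.sup_lt_iff (by exact WithBot.bot_lt_coe s)]
      intro i hi
      refine (Polynomial.degree_monomial_le _ _).trans_lt ?_
      exact_mod_cast mem_range.1 hi
    have hcW : Wt d (Polynomial.monomial s c) := Wt.monomial _ _ _ hcd
    obtain ⟨F, hF, hFe⟩ := ih (g - (Polynomial.monomial s c + L)) (by
      have : g - (Polynomial.monomial s c + L) = g + Polynomial.monomial 0 (-1) * (Polynomial.monomial s c + L) := by
        rw [Polynomial.monomial_zero_left]; simp; ring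
      rw [this]
      refine hg.add ?_
      have := (Wt.monomial (σ := σ) 0 0 (-1) (by simp)).mul (hcW.add hLW)
      simpa using this) (by
      refine Polynomial.degree_lt_iff_coeff_zero _ _ |>.2 fun k hk => ?_
      have hLk : L.coeff k = 0 := (Polynomial.degree_lt_iff_coeff_zero _ _ |>.1 hLdeg) k hk
      rw [Polynomial.coeff_sub, Polynomial.coeff_add, hLk, add_zero, Polynomial.coeff_monomial]
      rcases hk.eq_or_lt with rfl | hk
      · simp [hc]
      · rw [if_neg (by omega), sub_zero]
        exact (Polynomial.degree_lt_iff_coeff_zero _ _ |>.1 hgs) k hk)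
    refine ⟨F + Polynomial.monomial (s + 1) (c * q), hF.add (Wt.monomial _ _ _ ?_), ?_⟩
    · have h2 := MvPolynomial.totalDegree_mul c q
      have h6 : q.totalDegree = 0 := by rw [hq]; exact MvPolynomial.totalDegree_C _
      omega
    · have key : (Polynomial.monomial (s + 1) (c * q)).comp (Polynomial.X + Polynomial.C t) -
          Polynomial.monomial (s + 1) (c * q) = Polynomial.C t * (Polynomial.monomial s c + L) := by
        rw [Polynomial.monomial_comp, add_pow, sum_range_succ, sum_range_succ, hL]
        simp only [Nat.choose_self, Nat.sub_self, pow_zero, Nat.choose_succ_self_right]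
        rw [← Polynomial.C_mul_X_pow_eq_monomial, ← Polynomial.C_mul_X_pow_eq_monomial]
        have e1 : ∑ x ∈ range s, (Polynomial.X : Polynomial (MvPolynomial σ ℚ)) ^ x *
            Polynomial.C t ^ (s + 1 - x) * ((s + 1).choose x : Polynomial (MvPolynomial σ ℚ)) * Polynomial.C (c * q)
            = Polynomial.C t * ∑ i ∈ range s,
      Polynomial.monomial i (c * q * (t ^ (s - i) * ((s + 1).choose i : MvPolynomial σ ℚ))) := by
          rw [Finset.mul_sum]
          refine sum_congr rfl fun i hi => ?_
          have hi := mem_range.1 hi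
          rw [← Polynomial.C_mul_X_pow_eq_monomial, show s + 1 - i = (s - i) + 1 by omega, pow_succ]
          simp only [map_mul, map_pow, map_natCast]
          ring
        have e2 : (Polynomial.C q : Polynomial (MvPolynomial σ ℚ)) * ((s : Polynomial (MvPolynomial σ ℚ)) + 1) = 1 := by
          have := congrArg (Polynomial.C : MvPolynomial σ ℚ → Polynomial (MvPolynomial σ ℚ)) hq1
          simpa using this
        rw [mul_add (Polynomial.C t), ← e1]
        simp only [← Finset.sum_mul, map_mul]
        rw [show s + 1 - s = 1 by omega]
        push_cast
        linear_combination (Polynomial.X ^ s * Polynomial.C t * Polynomial.C c) * e2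
      rw [Polynomial.add_comp]
      linear_combination hFe + key

end Weight
end CSA


namespace CSA

section Core
variable {m : ℕ}

/-- index interval -/
def iv (m i j : ℕ) : Finset (Fin (m + 1)) := univ.filter fun l => i ≤ l.val ∧ l.val < j

lemma mem_iv {i j : ℕ} {l : Fin (m + 1)} : l ∈ iv m i j ↔ i ≤ l.val ∧ l.val < j := by
  simp [iv]

/-- partial sums -/
noncomputable def yy (m i : ℕ) : MvPolynomial (Fin (m + 1)) ℚ := al (iv m i m)

/-- values on the variables of a derivation given by values on partial sums -/
noncomputable def vals (cyc : ℚ) (p : ℕ → MvPolynomial (Fin (m + 1)) ℚ)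
    (τ : MvPolynomial (Fin (m + 1)) ℚ) (l : Fin (m + 1)) : MvPolynomial (Fin (m + 1)) ℚ :=
  if l.val < m then p l.val - p (l.val + 1) else τ - MvPolynomial.C cyc * (p 0 - p m)

/-- the extra variable -/
noncomputable def tt (m : ℕ) (cyc : ℚ) : MvPolynomial (Fin (m + 1)) ℚ :=
  MvPolynomial.X (Fin.last m) + MvPolynomial.C cyc * (yy m 0 - yy m m)

lemma al_iv_split {i j k : ℕ} (hij : i ≤ j) (hjk : j ≤ k) :
    al (iv m i k) = al (iv m i j) + al (iv m j k) := by
  have : iv m i k = iv m i j ∪ iv m j k := by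
    ext l; simp only [mem_union, mem_iv]; omega
  rw [al, this, sum_union, al, al]
  rw [disjoint_left]
  intro l; simp only [mem_iv]; omega

lemma yy_sub {i j : ℕ} (hij : i ≤ j) (hj : j ≤ m) : yy m i - yy m j = al (iv m i j) := by
  rw [yy, yy, al_iv_split hij hj]; ring

lemma yy_ne {i j : ℕ} (hij : i < j) (hj : j ≤ m) : yy m i ≠ yy m j := by
  intro h
  have h1 := yy_sub hij.le hj
  rw [h, sub_self] at h1
  refine (al_prime (I := iv m i j) ⟨⟨i, by omega⟩, mem_iv.2 ⟨le_rfl, hij⟩⟩).ne_zero h1.symm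

lemma yy_inj {i j : ℕ} (hi : i ≤ m) (hj : j ≤ m) (h : yy m i = yy m j) : i = j := by
  rcases lt_trichotomy i j with h1 | h1 | h1
  · exact absurd h (yy_ne h1 hj)
  · exact h1
  · exact absurd h.symm (yy_ne h1 hi)

lemma deg_al (I : Finset (Fin (m + 1))) :
    (al I : MvPolynomial (Fin (m + 1)) ℚ).totalDegree ≤ 1 := by
  rw [al_eq]; exact totalDegree_lin _

lemma deg_yy (i : ℕ) : (yy m i).totalDegree ≤ 1 := deg_al _

lemma deg_sub_le {a b : MvPolynomial (Fin (m + 1)) ℚ} {d : ℕ} (ha : a.totalDegree ≤ d)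
    (hb : b.totalDegree ≤ d) : (a - b).totalDegree ≤ d :=
  (MvPolynomial.totalDegree_sub _ _).trans (max_le ha hb)

lemma deg_C_mul_le {a : MvPolynomial (Fin (m + 1)) ℚ} {d : ℕ} (c : ℚ) (ha : a.totalDegree ≤ d) :
    (MvPolynomial.C c * a).totalDegree ≤ d := by
  have := MvPolynomial.totalDegree_mul (MvPolynomial.C c) a
  rw [MvPolynomial.totalDegree_C] at this
  omega

lemma deg_tt (cyc : ℚ) : (tt m cyc).totalDegree ≤ 1 := by
  refine (MvPolynomial.totalDegree_add _ _).trans (max_le ?_ ?_)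
  · rw [MvPolynomial.totalDegree_X]
  · exact deg_C_mul_le _ (deg_sub_le (deg_yy _) (deg_yy _))

lemma vals_yy (cyc : ℚ) (l : Fin (m + 1)) : vals cyc (yy m) (tt m cyc) l = MvPolynomial.X l := by
  unfold vals
  split_ifs with h
  · rw [yy_sub (by omega) (by omega)]
    have : iv m l.val (l.val + 1) = {l} := by
      ext x; simp only [mem_iv, mem_singleton, Fin.ext_iff]; omega
    rw [this, al, sum_singleton]
  · have : l = Fin.last m := by ext; simp; omega
    rw [this, tt]; ring

lemma det_deg {N : ℕ} (M : Matrix (Fin N) (Fin N) (MvPolynomial (Fin N) ℚ)) (d : Fin N → ℕ)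
    (h : ∀ i j, (M i j).totalDegree ≤ d i) : M.det.totalDegree ≤ ∑ i, d i := by
  rw [Matrix.det_apply]
  refine MvPolynomial.totalDegree_finsetSum_le fun σ _ => ?_
  refine (MvPolynomial.totalDegree_smul_le _ _).trans ?_
  refine (MvPolynomial.totalDegree_finsetProd _ _).trans ?_
  rw [← Equiv.sum_comp σ d]
  exact sum_le_sum fun i _ => h _ _

open Polynomial in
/-- product of all linear factors -/
noncomputable def PiP (m : ℕ) : Polynomial (MvPolynomial (Fin (m + 1)) ℚ) :=
  ∏ i ∈ range (m + 1), (X - C (yy m i))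

theorem core (G : SimpleGraph (Fin (m + 1))) (cyc : ℚ) (ht : tt m cyc ≠ 0)
    (E : ℕ → ℕ → Prop)
    (hconn : ∀ I, ConnSet G I → ∃ i j, i ≤ m ∧ j ≤ m ∧
      ((∀ p τ, ∑ l ∈ I, vals (m := m) cyc p τ l = p i - p j) ∨
        ((E i j ∨ i = j) ∧ ∀ p τ, ∑ l ∈ I, vals (m := m) cyc p τ l = τ + p i - p j)))
    {ι : Type} [Fintype ι] (hι : Fintype.card ι = m)
    (g : ι → Polynomial (MvPolynomial (Fin (m + 1)) ℚ)) (w : ι → ℕ)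
    (hw : ∀ k, Wt (w k) (g k)) (hwm : ∀ k, w k ≤ m)
    (hE : ∀ k i j, i ≤ m → j ≤ m → E i j → (tt m cyc + yy m i - yy m j) ∣ (g k).eval (yy m i))
    (hind : ∀ (c : ι → MvPolynomial (Fin (m + 1)) ℚ) (c' : MvPolynomial (Fin (m + 1)) ℚ),
      Polynomial.C (tt m cyc) * ∑ k, Polynomial.C (c k) * g k =
        Polynomial.C c' * ((PiP m).comp (Polynomial.X + Polynomial.C (tt m cyc)) - PiP m) →
      ∀ k, c k = 0)
    (hcount : 1 + ∑ k, (w k + 1) ≤ (conns G).card) : SD G := by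
  classical
  have hF : ∀ k, ∃ F : Polynomial (MvPolynomial (Fin (m + 1)) ℚ), Wt (w k + 1) F ∧
      F.comp (Polynomial.X + Polynomial.C (tt m cyc)) - F = Polynomial.C (tt m cyc) * g k := by
    intro k
    refine exists_antideriv (tt m cyc) (deg_tt _) (w k) ((g k).natDegree + 1) (g k) (hw k) ?_
    refine Polynomial.degree_le_natDegree.trans_lt ?_
    exact_mod_cast Nat.lt_succ_self _
  choose F hFW hFe using hF
  have hFt : ∀ k z, (F k).eval (z + tt m cyc) - (F k).eval z = tt m cyc * (g k).eval z := by
    intro k z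
    have := congrArg (Polynomial.eval z) (hFe k)
    simpa [Polynomial.eval_comp] using this
  let e : Fin (m + 1) ≃ Option ι := Fintype.equivOfCardEq (by simp [hι])
  let M' : Option ι → Fin (m + 1) → MvPolynomial (Fin (m + 1)) ℚ := fun o l =>
    o.elim (MvPolynomial.X l) (fun k => vals cyc (fun i => (F k).eval (yy m i)) 0 l)
  let d : Option ι → ℕ := fun o => o.elim 1 (fun k => w k + 1)
  have hevdeg : ∀ k i, ((F k).eval (yy m i)).totalDegree ≤ w k + 1 :=
    fun k i => (hFW k).eval_le _ (deg_yy i)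
  have hM'deg : ∀ o l, (M' o l).totalDegree ≤ d o := by
    rintro (_ | k) l
    · show (MvPolynomial.X l).totalDegree ≤ 1
      rw [MvPolynomial.totalDegree_X]
    · show (vals cyc (fun i => (F k).eval (yy m i)) 0 l).totalDegree ≤ w k + 1
      unfold vals
      split_ifs
      · exact deg_sub_le (hevdeg _ _) (hevdeg _ _)
      · exact deg_sub_le (by simp) (deg_C_mul_le _ (deg_sub_le (hevdeg _ _) (hevdeg _ _)))
  refine ⟨Matrix.of fun k l => M' (e k) l, ?_, ?_, ?_⟩
  · intro I hI k
    simp only [Matrix.of_apply]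
    obtain ⟨i, j, hi, hj, h⟩ := hconn I hI
    have hal : al I = ∑ l ∈ I, vals cyc (yy m) (tt m cyc) l := by
      rw [al]; exact sum_congr rfl fun l _ => (vals_yy cyc l).symm
    rcases e k with _ | k
    · exact dvd_rfl
    · show al I ∣ ∑ l ∈ I, vals cyc (fun i => (F k).eval (yy m i)) 0 l
      rcases h with h | ⟨hEij, h⟩
      · rw [hal, h, h]
        exact Polynomial.sub_dvd_eval_sub _ _ _
      · rw [hal, h, h]
        have h1 : (0 : MvPolynomial (Fin (m + 1)) ℚ) + (F k).eval (yy m i) - (F k).eval (yy m j) =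
            ((F k).eval (yy m i + tt m cyc) - (F k).eval (yy m j)) - tt m cyc * (g k).eval (yy m i) := by
          rw [← hFt]; ring
        show _ ∣ (0 : MvPolynomial (Fin (m + 1)) ℚ) + (F k).eval (yy m i) - (F k).eval (yy m j)
        rw [h1]
        apply dvd_sub
        · rw [show tt m cyc + yy m i - yy m j = (yy m i + tt m cyc) - yy m j by ring]
          exact Polynomial.sub_dvd_eval_sub _ _ _
        · rcases hEij with hEij | rfl
          · exact (hE k i j hi hj hEij).mul_left _
          · rw [add_sub_cancel_right]; exact dvd_mul_right _ _
  · intro hdet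
    obtain ⟨c, hc0, hc⟩ := Matrix.exists_vecMul_eq_zero_iff.2 hdet
    apply hc0
    set c1 : Option ι → MvPolynomial (Fin (m + 1)) ℚ := fun o => c (e.symm o) with hc1
    have hl : ∀ l, c1 none * MvPolynomial.X l +
        ∑ k, c1 (some k) * vals cyc (fun i => (F k).eval (yy m i)) 0 l = 0 := by
      intro l
      have h1 := congrFun hc l
      simp only [Matrix.vecMul, dotProduct, Matrix.of_apply, Pi.zero_apply] at h1
      rw [← Equiv.sum_comp e.symm] at h1
      simp only [Equiv.apply_symm_apply, Fintype.sum_option] at h1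
      exact h1
    set p : ℕ → MvPolynomial (Fin (m + 1)) ℚ := fun i =>
      c1 none * yy m i + ∑ k, c1 (some k) * (F k).eval (yy m i) with hp
    have hv : ∀ l, vals cyc p (c1 none * tt m cyc) l = 0 := by
      intro l
      rw [← hl l, ← vals_yy cyc l]
      unfold vals
      split_ifs
      · simp only [hp, mul_sub, sum_sub_distrib]; ring
      · simp only [hp, mul_sub, sum_sub_distrib, mul_add, mul_zero, sum_const_zero, mul_sum]
        simp only [mul_left_comm (MvPolynomial.C cyc)]
        ring
    have hp0 : ∀ i ≤ m, p i = p 0 := by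
      intro i
      induction i with
      | zero => intro _; rfl
      | succ i ih =>
        intro hi
        have h1 := hv ⟨i, by omega⟩
        unfold vals at h1
        rw [if_pos (by show i < m; omega)] at h1
        rw [← ih (by omega)]
        exact (sub_eq_zero.1 h1).symm
    have hcn : c1 none = 0 := by
      have h1 := hv (Fin.last m)
      unfold vals at h1
      rw [if_neg (by simp), hp0 m le_rfl] at h1
      simpa [ht] using h1
    set P : Polynomial (MvPolynomial (Fin (m + 1)) ℚ) := ∑ k, Polynomial.C (c1 (some k)) * F k with hP
    have hPe : ∀ i ≤ m, P.eval (yy m i) = p 0 := by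
      intro i hi
      rw [← hp0 i hi, hP, hp, Polynomial.eval_finsetSum]
      simp [hcn]
    have hPiM : (PiP m).Monic := Polynomial.monic_prod_of_monic _ _ fun i _ => Polynomial.monic_X_sub_C _
    have hPid : (PiP m).natDegree = m + 1 := by
      rw [PiP, Polynomial.natDegree_prod_of_monic _ _ fun i _ => Polynomial.monic_X_sub_C _]
      simp
    have hPd : P.natDegree ≤ m + 1 := by
      refine Polynomial.natDegree_sum_le_of_forall_le _ _ fun k _ => ?_
      refine (Polynomial.natDegree_C_mul_le _ _).trans ((hFW k).natDegree_le.trans ?_)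
      have := hwm k; omega
    set κ := P.coeff (m + 1) with hκ
    have hzero : P - Polynomial.C (p 0) - Polynomial.C κ * PiP m = 0 := by
      refine Polynomial.eq_zero_of_natDegree_lt_card_of_eval_eq_zero _
        (f := fun i : Fin (m + 1) => yy m i.val) ?_ ?_ ?_
      · intro i j hij
        ext
        exact yy_inj (by omega) (by omega) hij
      · intro i
        have : (PiP m).eval (yy m i.val) = 0 := by
          rw [PiP, Polynomial.eval_prod]
          exact prod_eq_zero (mem_range.2 i.2) (by simp)
        simp [this, hPe i.val (by omega)]
      · rw [Fintype.card_fin, Nat.lt_succ_iff]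
        rw [Polynomial.natDegree_le_iff_coeff_eq_zero]
        intro N hN
        have hN0 : N ≠ 0 := by omega
        rw [Polynomial.coeff_sub, Polynomial.coeff_sub, Polynomial.coeff_C, if_neg hN0,
          Polynomial.coeff_C_mul]
        rcases Nat.eq_or_lt_of_le (Nat.succ_le_of_lt hN) with rfl | hN'
        · have : (PiP m).coeff (m + 1) = 1 := by
            have h2 : (PiP m).leadingCoeff = 1 := hPiM
            rwa [Polynomial.leadingCoeff, hPid] at h2
          rw [Nat.succ_eq_add_one, this]; simp [hκ]
        · rw [Polynomial.coeff_eq_zero_of_natDegree_lt (by omega),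
            Polynomial.coeff_eq_zero_of_natDegree_lt (p := PiP m) (by omega)]
          simp
    have hPeq : P = Polynomial.C (p 0) + Polynomial.C κ * PiP m := by linear_combination hzero
    have hfin := hind (fun k => c1 (some k)) κ (by
      have h1 : Polynomial.C (tt m cyc) * ∑ k, Polynomial.C (c1 (some k)) * g k =
          P.comp (Polynomial.X + Polynomial.C (tt m cyc)) - P := by
        rw [hP, Polynomial.sum_comp, mul_sum, ← sum_sub_distrib]
        refine sum_congr rfl fun k _ => ?_
        rw [Polynomial.mul_comp, Polynomial.C_comp]
        linear_combination (- Polynomial.C (c1 (some k))) * hFe k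
      rw [h1, hPeq]
      simp only [Polynomial.add_comp, Polynomial.mul_comp, Polynomial.C_comp]
      ring)
    funext x
    have : c x = c1 (e x) := by simp [hc1]
    rw [this]
    rcases e x with _ | k
    · exact hcn
    · exact hfin k
  · refine le_trans ?_ hcount
    have h1 := det_deg (Matrix.of fun k l => M' (e k) l) (fun k => d (e k)) (fun i j => hM'deg _ _)
    rw [Equiv.sum_comp e d, Fintype.sum_option] at h1
    exact h1

end Core
end CSA


namespace CSA

section Models
variable {m : ℕ}

lemma last_notMem_iv {i j : ℕ} (hj : j ≤ m) : Fin.last m ∉ iv m i j := by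
  simp only [mem_iv, Fin.val_last]; omega

lemma sum_vals_iv (cyc : ℚ) (p : ℕ → MvPolynomial (Fin (m + 1)) ℚ)
    (τ : MvPolynomial (Fin (m + 1)) ℚ) {i j : ℕ} (hij : i ≤ j) (hj : j ≤ m) :
    ∑ l ∈ iv m i j, vals cyc p τ l = p i - p j := by
  induction j with
  | zero =>
    have : i = 0 := by omega
    subst this
    have : iv m 0 0 = ∅ := by ext; simp [mem_iv]
    simp [this]
  | succ j ih =>
    rcases Nat.eq_or_lt_of_le hij with rfl | hij'
    · have : iv m (j + 1) (j + 1) = ∅ := by ext; simp only [mem_iv]; simp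
      simp [this]
    · have : iv m i (j + 1) = insert (⟨j, by omega⟩ : Fin (m + 1)) (iv m i j) := by
        ext x; simp only [mem_iv, mem_insert, Fin.ext_iff]; omega
      rw [this, sum_insert (by simp [mem_iv]), ih (by omega) (by omega), vals,
        if_pos (by show j < m; omega)]
      ring

lemma sum_vals_insert (cyc : ℚ) (p : ℕ → MvPolynomial (Fin (m + 1)) ℚ)
    (τ : MvPolynomial (Fin (m + 1)) ℚ) {i j : ℕ} (hij : i ≤ j) (hj : j ≤ m) :
    ∑ l ∈ insert (Fin.last m) (iv m i j), vals cyc p τ l =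
      τ - MvPolynomial.C cyc * (p 0 - p m) + (p i - p j) := by
  rw [sum_insert (last_notMem_iv hj), sum_vals_iv cyc p τ hij hj, vals, if_neg (by simp)]

lemma sum_vals_compl (p : ℕ → MvPolynomial (Fin (m + 1)) ℚ)
    (τ : MvPolynomial (Fin (m + 1)) ℚ) {i j : ℕ} (hij : i ≤ j) (hj : j ≤ m) :
    ∑ l ∈ (iv m i j)ᶜ, vals 1 p τ l = τ + p j - p i := by
  have h1 := sum_add_sum_compl (iv m i j) (vals 1 p τ)
  have h2 : (univ : Finset (Fin (m + 1))) = insert (Fin.last m) (iv m 0 m) := by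
    ext x
    have := x.2
    simp only [mem_univ, mem_insert, mem_iv, Fin.ext_iff, Fin.val_last, true_iff]; omega
  rw [h2, sum_vals_insert _ _ _ (Nat.zero_le m) le_rfl, sum_vals_iv _ _ _ hij hj, map_one] at h1
  linear_combination h1

lemma al_eq_vals (cyc : ℚ) (I : Finset (Fin (m + 1))) :
    al I = ∑ l ∈ I, vals cyc (yy m) (tt m cyc) l := by
  rw [al]; exact sum_congr rfl fun l _ => (vals_yy cyc l).symm

lemma ne_zero_tt0 {i j : ℕ} (hij : i ≤ j) (hj : j ≤ m) : tt m 0 + yy m i - yy m j ≠ 0 := by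
  have h := al_eq_vals 0 (insert (Fin.last m) (iv m i j))
  rw [sum_vals_insert _ _ _ hij hj] at h
  have h2 : tt m 0 + yy m i - yy m j = al (insert (Fin.last m) (iv m i j)) := by
    rw [h]; simp; ring
  rw [h2]
  exact (al_prime (insert_nonempty _ _)).ne_zero

lemma ne_zero_tt1 {i j : ℕ} (hij : i ≤ j) (hj : j ≤ m) : tt m 1 + yy m j - yy m i ≠ 0 := by
  have h := al_eq_vals 1 ((iv m i j)ᶜ)
  rw [sum_vals_compl _ _ hij hj] at h
  rw [← h]
  exact (al_prime ⟨Fin.last m, mem_compl.2 (last_notMem_iv hj)⟩).ne_zero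

lemma exists_iv (J : Finset (Fin (m + 1))) (hl : Fin.last m ∉ J)
    (h : ∀ a b c : Fin (m + 1), a < b → b < c → a ∈ J → c ∈ J → b ∈ J) :
    ∃ i j, i ≤ j ∧ j ≤ m ∧ J = iv m i j := by
  rcases J.eq_empty_or_nonempty with rfl | hne
  · exact ⟨0, 0, le_rfl, by omega, by ext; simp [mem_iv]⟩
  · have h1 := J.min'_mem hne
    have h2 := J.max'_mem hne
    have h3 : J.max' hne ≠ Fin.last m := fun h => hl (h ▸ h2)
    have h4 : (J.max' hne).val < m := by
      have := (J.max' hne).2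
      rw [Ne, Fin.ext_iff, Fin.val_last] at h3
      omega
    have h5 : (J.min' hne) ≤ J.max' hne := J.min'_le _ h2
    refine ⟨(J.min' hne).val, (J.max' hne).val + 1, ?_, by omega, ?_⟩
    · have : (J.min' hne).val ≤ (J.max' hne).val := h5
      omega
    · ext x
      rw [mem_iv]
      constructor
      · intro hx
        have a : (J.min' hne).val ≤ x.val := J.min'_le _ hx
        have b : x.val ≤ (J.max' hne).val := J.le_max' _ hx
        omega
      · rintro ⟨a, b⟩
        by_cases e1 : x = J.min' hne
        · rw [e1]; exact h1
        by_cases e2 : x = J.max' hne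
        · rw [e2]; exact h2
        rw [Fin.ext_iff] at e1 e2
        exact h _ x _ (Fin.lt_def.2 (by omega)) (Fin.lt_def.2 (by omega)) h1 h2

lemma conn_iv {G : SimpleGraph (Fin (m + 1))} (B : ℕ) (hB : B ≤ m + 1)
    (h : ∀ x y : Fin (m + 1), x.val + 1 = y.val → y.val < B → G.Adj x y) {i j : ℕ} (hij : i < j)
    (hj : j ≤ B) : ConnSet G (iv m i j) := by
  induction j with
  | zero => omega
  | succ j ih =>
    have hs : iv m i (j + 1) = iv m i j ∪ {(⟨j, by omega⟩ : Fin (m + 1))} := by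
      ext x; simp only [mem_iv, mem_union, mem_singleton, Fin.ext_iff]; omega
    rcases Nat.eq_or_lt_of_le (Nat.le_of_lt_succ hij) with rfl | hij'
    · have : iv m i (i + 1) = {(⟨i, by omega⟩ : Fin (m + 1))} := by
        ext x; simp only [mem_iv, mem_singleton, Fin.ext_iff]; omega
      rw [this]; exact connSet_singleton G _
    · rw [hs]
      refine connSet_union (ih hij' (by omega)) (connSet_singleton G _)
        ⟨⟨j - 1, by omega⟩, ?_, _, mem_singleton_self _, h _ _ ?_ ?_⟩
      · rw [mem_iv]; show i ≤ j - 1 ∧ j - 1 < j; omega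
      · show j - 1 + 1 = j; omega
      · show j < B; omega

lemma iv_inj {i j i' j' : ℕ} (hij : i < j) (hj : j ≤ m) (hij' : i' < j') (hj' : j' ≤ m)
    (h : iv m i j = iv m i' j') : i = i' ∧ j = j' := by
  have h1 : ∀ x, x ≤ m → (i ≤ x ∧ x < j ↔ i' ≤ x ∧ x < j') := by
    intro x hx
    have := Finset.ext_iff.1 h ⟨x, by omega⟩
    simpa only [mem_iv] using this
  have a := h1 i (by omega)
  have b := h1 i' (by omega)
  have c := h1 (j - 1) (by omega)
  have d := h1 (j' - 1) (by omega)
  omega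

lemma count_lem {G : SimpleGraph (Fin (m + 1))} {β : Type*} (T : Finset β)
    (f : β → Finset (Fin (m + 1))) (z : Finset (Fin (m + 1)))
    (h1 : ∀ i j, i < j → j ≤ m → ConnSet G (iv m i j))
    (h2 : ∀ x ∈ T, ConnSet G (f x) ∧ Fin.last m ∈ f x)
    (h3 : Set.InjOn f T) (h4 : ConnSet G z) (h5 : Fin.last m ∈ z) (h6 : ∀ x ∈ T, f x ≠ z) :
    1 + (∑ j ∈ range (m + 1), j + T.card) ≤ (conns G).card := by
  classical
  let T1 : Finset (Σ _ : ℕ, ℕ) := (range (m + 1)).sigma fun j => range j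
  have hT1 : T1.card = ∑ j ∈ range (m + 1), j := by
    rw [card_sigma]; simp
  let A := T1.image fun x => iv m x.2 x.1
  let B := T.image f
  have hT1m : ∀ x ∈ T1, x.2 < x.1 ∧ x.1 ≤ m := by
    intro x hx
    have := mem_sigma.1 hx
    simp only [mem_range] at this
    omega
  have hA : A.card = T1.card := by
    apply card_image_of_injOn
    rintro ⟨j, i⟩ hx ⟨j', i'⟩ hx' h
    have a := hT1m _ hx
    have b := hT1m _ hx'
    obtain ⟨rfl, rfl⟩ := iv_inj a.1 a.2 b.1 b.2 h
    rfl
  have hB : B.card = T.card := card_image_of_injOn h3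
  have hAB : Disjoint A B := by
    rw [disjoint_left]
    intro I hI hI'
    obtain ⟨x, hx, rfl⟩ := mem_image.1 hI
    obtain ⟨x', hx', e⟩ := mem_image.1 hI'
    have := (h2 x' hx').2
    rw [e] at this
    exact last_notMem_iv (hT1m x hx).2 this
  have hz : z ∉ A ∪ B := by
    rw [mem_union]
    rintro (h | h)
    · obtain ⟨x, hx, rfl⟩ := mem_image.1 h
      exact last_notMem_iv (hT1m x hx).2 h5
    · obtain ⟨x', hx', e⟩ := mem_image.1 h
      exact h6 x' hx' e
  have hsub : insert z (A ∪ B) ⊆ conns G := by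
    intro I hI
    rw [mem_conns]
    rcases mem_insert.1 hI with rfl | hI
    · exact h4
    rcases mem_union.1 hI with h | h
    · obtain ⟨x, hx, rfl⟩ := mem_image.1 h
      exact h1 _ _ (hT1m x hx).1 (hT1m x hx).2
    · obtain ⟨x, hx, rfl⟩ := mem_image.1 h
      exact (h2 x hx).1
  have := card_le_card hsub
  rw [card_insert_of_notMem hz, card_union_of_disjoint hAB, hA, hB, hT1] at this
  omega

open Polynomial in
/-- product of linear factors, shifted -/
noncomputable def lp (m : ℕ) (S : Finset ℕ) (t : MvPolynomial (Fin (m + 1)) ℚ) :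
    Polynomial (MvPolynomial (Fin (m + 1)) ℚ) := ∏ i ∈ S, (X - C (yy m i - t))

lemma lp_comp (S : Finset ℕ) (t : MvPolynomial (Fin (m + 1)) ℚ) :
    (lp m S 0).comp (Polynomial.X + Polynomial.C t) = lp m S t := by
  rw [lp, lp, Polynomial.prod_comp]
  refine prod_congr rfl fun i _ => ?_
  simp; ring

lemma lp_wt (S : Finset ℕ) {t : MvPolynomial (Fin (m + 1)) ℚ} (ht : t.totalDegree ≤ 1) :
    Wt S.card (lp m S t) :=
  Wt.prod _ _ fun i _ => Wt.linear _ (deg_sub_le (deg_yy i) ht)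

lemma lp_monic (S : Finset ℕ) (t : MvPolynomial (Fin (m + 1)) ℚ) : (lp m S t).Monic :=
  Polynomial.monic_prod_of_monic _ _ fun i _ => Polynomial.monic_X_sub_C _

lemma lp_natDegree (S : Finset ℕ) (t : MvPolynomial (Fin (m + 1)) ℚ) :
    (lp m S t).natDegree = S.card := by
  rw [lp, Polynomial.natDegree_prod_of_monic _ _ fun i _ => Polynomial.monic_X_sub_C _]
  simp only [Polynomial.natDegree_X_sub_C, sum_const, smul_eq_mul, mul_one]

lemma lp_eval (S : Finset ℕ) (t z : MvPolynomial (Fin (m + 1)) ℚ) :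
    (lp m S t).eval z = ∏ i ∈ S, (t + z - yy m i) := by
  rw [lp, Polynomial.eval_prod]
  refine prod_congr rfl fun i _ => ?_
  simp; ring

lemma lp_eval_zero (S : Finset ℕ) {i : ℕ} (hi : i ∈ S) : (lp m S 0).eval (yy m i) = 0 := by
  rw [lp_eval]
  exact prod_eq_zero hi (by ring)

lemma PiP_eq {S S' : Finset ℕ} (hd : Disjoint S S') (hu : S ∪ S' = range (m + 1)) :
    PiP m = lp m S 0 * lp m S' 0 := by
  rw [PiP, ← hu, prod_union hd, lp, lp]; simp

lemma eq_zero_of_lp {S : Finset ℕ} (hS : ∀ i ∈ S, i ≤ m)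
    {A R K : Polynomial (MvPolynomial (Fin (m + 1)) ℚ)} (h : lp m S 0 * A = R * K)
    (hR : ∀ i ∈ S, R.eval (yy m i) ≠ 0) (hK : K.degree < S.card) : K = 0 := by
  refine Polynomial.eq_zero_of_degree_lt_of_eval_index_eq_zero S (v := yy m) ?_ hK ?_
  · intro i hi j hj hij
    exact yy_inj (hS i hi) (hS j hj) hij
  · intro i hi
    have h1 := congrArg (Polynomial.eval (yy m i)) h
    rw [Polynomial.eval_mul, Polynomial.eval_mul, lp_eval_zero S hi, zero_mul] at h1
    exact (mul_eq_zero.1 h1.symm).resolve_left (hR i hi)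

/-- combination of powers -/
noncomputable def pw {a : ℕ} (c : Fin a → MvPolynomial (Fin (m + 1)) ℚ) :
    Polynomial (MvPolynomial (Fin (m + 1)) ℚ) :=
  ∑ s, Polynomial.C (c s) * Polynomial.X ^ s.val

lemma pw_coeff {a : ℕ} (c : Fin a → MvPolynomial (Fin (m + 1)) ℚ) (s : Fin a) :
    (pw c).coeff s.val = c s := by
  rw [pw, Polynomial.finsetSum_coeff]
  simp only [Polynomial.coeff_C_mul_X_pow]
  rw [Finset.sum_eq_single s]
  · simp
  · intro b _ hb
    rw [if_neg]
    exact fun h => hb (Fin.ext h.symm)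
  · simp

lemma pw_coeff_ge {a : ℕ} (c : Fin a → MvPolynomial (Fin (m + 1)) ℚ) {s : ℕ} (hs : a ≤ s) :
    (pw c).coeff s = 0 := by
  rw [pw, Polynomial.finsetSum_coeff]
  simp only [Polynomial.coeff_C_mul_X_pow]
  refine sum_eq_zero fun x _ => ?_
  rw [if_neg]; omega

lemma pw_eq_zero {a : ℕ} {c : Fin a → MvPolynomial (Fin (m + 1)) ℚ} (h : pw c = 0) (s : Fin a) :
    c s = 0 := by
  rw [← pw_coeff c s, h, Polynomial.coeff_zero]

lemma sum_lin (w a : ℕ) : ∑ s : Fin a, (w + s.val + 1) = a * w + ∑ j ∈ range (a + 1), j := by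
  rw [Fin.sum_univ_eq_sum_range (fun s => w + s + 1) a]
  induction a with
  | zero => simp
  | succ a ih => rw [sum_range_succ, ih, sum_range_succ (fun j => j) (a + 1)]; ring

lemma sum_split (a b : ℕ) : ∑ j ∈ range (a + b + 1), j =
    a * b + ∑ j ∈ range (a + 1), j + ∑ j ∈ range (b + 1), j := by
  induction b with
  | zero => simp
  | succ b ih =>
    rw [show a + (b + 1) + 1 = (a + b + 1) + 1 by ring, sum_range_succ, ih,
      sum_range_succ (fun j => j) (b + 1)]
    ring

end Models
end CSA


namespace CSA

section Models2

lemma ap_adj {m k : ℕ} {x y : Fin (m + 1)} : (almostPath m k).Adj x y ↔ x ≠ y ∧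
    (((x.val + 1 = y.val ∧ y.val < m) ∨ (x.val = k - 1 ∧ y.val = m)) ∨
      ((y.val + 1 = x.val ∧ x.val < m) ∨ (y.val = k - 1 ∧ x.val = m))) := by
  rw [almostPath, SimpleGraph.fromRel_adj]

lemma pt_adj {m k : ℕ} {x y : Fin (m + 1)} : (pathTriangle m k).Adj x y ↔ x ≠ y ∧
    (((x.val + 1 = y.val ∧ y.val < m) ∨ (x.val = k - 1 ∧ y.val = m) ∨ (x.val = k ∧ y.val = m)) ∨
      ((y.val + 1 = x.val ∧ x.val < m) ∨ (y.val = k - 1 ∧ x.val = m) ∨ (y.val = k ∧ x.val = m))) := by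
  rw [pathTriangle, SimpleGraph.fromRel_adj]

lemma insert_iv_inj {m i j i' j' : ℕ} (hij : i < j) (hj : j ≤ m) (hij' : i' < j') (hj' : j' ≤ m)
    (h : insert (Fin.last m) (iv m i j) = insert (Fin.last m) (iv m i' j')) : i = i' ∧ j = j' := by
  apply iv_inj hij hj hij' hj'
  rw [← erase_insert (last_notMem_iv (i := i) hj), h, erase_insert (last_notMem_iv hj')]

lemma sum_elim_pw {m b a : ℕ} (c : Fin b ⊕ Fin a → MvPolynomial (Fin (m + 1)) ℚ)
    (A B : Polynomial (MvPolynomial (Fin (m + 1)) ℚ)) :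
    ∑ k, Polynomial.C (c k) * (Sum.elim (fun s : Fin b => A * Polynomial.X ^ s.val)
      (fun s : Fin a => B * Polynomial.X ^ s.val)) k =
    A * pw (fun s => c (Sum.inl s)) + B * pw (fun s => c (Sum.inr s)) := by
  rw [Fintype.sum_sum_type]
  simp only [Sum.elim_inl, Sum.elim_inr]
  rw [pw, pw, mul_sum, mul_sum]
  refine congrArg₂ _ (sum_congr rfl fun s _ => ?_) (sum_congr rfl fun s _ => ?_)
  · exact mul_left_comm _ _ _
  · exact mul_left_comm _ _ _

set_option maxHeartbeats 1000000 in
theorem SD_almostPath {m k : ℕ} (hk1 : 1 ≤ k) (hkm : k ≤ m) : SD (almostPath m k) := by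
  obtain ⟨b, rfl⟩ := Nat.exists_eq_add_of_le hkm
  set m := k + b with hm
  set t := tt m 0 with htdef
  have ht : t ≠ 0 := by
    have := ne_zero_tt0 (m := m) (le_refl 0) (Nat.zero_le m)
    rwa [add_sub_cancel_right] at this
  have hpath : ∀ x y : Fin (m + 1), x.val + 1 = y.val → y.val < m → (almostPath m k).Adj x y := by
    intro x y h1 h2
    rw [ap_adj, Ne, Fin.ext_iff]; omega
  have hcI : ∀ i j, i < j → j ≤ m → ConnSet (almostPath m k) (iv m i j) :=
    fun i j hij hj => conn_iv m (by omega) hpath hij hj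
  refine core (almostPath m k) 0 ht (fun i j => i < k ∧ k ≤ j) ?_ (ι := Fin b ⊕ Fin k) ?_
    (Sum.elim (fun s => lp m (range k) 0 * Polynomial.X ^ s.val)
      (fun s => lp m (Ico k (m + 1)) t * Polynomial.X ^ s.val))
    (Sum.elim (fun s => k + s.val) (fun s => (b + 1) + s.val)) ?_ ?_ ?_ ?_ ?_
  · intro I hI
    have hcut := (connSet_iff.1 hI).2
    obtain ⟨i, j, hij, hj, hJ⟩ := exists_iv (I.erase (Fin.last m)) (notMem_erase _ _) (by
      intro a b' c hab hbc ha hc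
      rw [mem_erase] at ha hc ⊢
      have hcm : c.val < m := by
        have := c.2
        have h2 := hc.1
        rw [Ne, Fin.ext_iff, Fin.val_last] at h2
        omega
      have hbm : b' ≠ Fin.last m := by
        rw [Ne, Fin.ext_iff, Fin.val_last]
        have : b'.val < c.val := hbc
        omega
      refine ⟨hbm, ?_⟩
      by_contra hb
      rw [Fin.lt_def] at hab hbc
      obtain ⟨x, hx, y, hy, hPx, hPy, hadj⟩ := hcut
        (fun x => (x.val < m ∧ x.val < b'.val) ∨ (x.val = m ∧ k - 1 < b'.val))
        ⟨a, ha.2, by left; omega⟩ ⟨c, hc.2, by omega⟩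
      rw [ap_adj, Ne, Fin.ext_iff] at hadj
      have hyb : y.val ≠ b'.val := fun h => hb (Fin.ext h ▸ hy)
      have := x.2
      have := y.2
      omega)
    refine ⟨i, j, by omega, hj, ?_⟩
    by_cases hl : Fin.last m ∈ I
    · right
      have hI' : I = insert (Fin.last m) (iv m i j) := by rw [← hJ, insert_erase hl]
      constructor
      · rcases Nat.eq_or_lt_of_le hij with h | h
        · right; exact h
        left
        obtain ⟨x, hx, y, hy, hPx, hPy, hadj⟩ := hcut (fun x => x = Fin.last m) ⟨_, hl, rfl⟩
          ⟨⟨i, by omega⟩, by rw [hI', mem_insert, mem_iv]; right; simpa using h, by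
            rw [Fin.ext_iff, Fin.val_last]; show ¬ i = m; omega⟩
        rw [ap_adj, Ne, Fin.ext_iff, hPx, Fin.val_last] at hadj
        rw [hI', mem_insert, mem_iv] at hy
        have hy := hy.resolve_left hPy
        omega
      · intro p τ
        rw [hI', sum_vals_insert _ _ _ hij hj]
        simp; ring
    · left
      rw [erase_eq_of_notMem hl] at hJ
      intro p τ
      rw [hJ, sum_vals_iv _ _ _ hij hj]
  · simp [hm]; ring
  · rintro (s | s)
    · show Wt (k + s.val) (lp m (range k) 0 * Polynomial.X ^ s.val)
      have := (lp_wt (m := m) (range k) (t := 0) (by simp)).mul (Wt.X_pow s.val)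
      rwa [card_range] at this
    · show Wt ((b + 1) + s.val) (lp m (Ico k (m + 1)) t * Polynomial.X ^ s.val)
      have := (lp_wt (m := m) (Ico k (m + 1)) (t := t) (deg_tt _)).mul (Wt.X_pow s.val)
      rwa [Nat.card_Ico, show m + 1 - k = b + 1 by omega] at this
  · rintro (s | s)
    · show k + s.val ≤ m
      omega
    · show b + 1 + s.val ≤ m
      omega
  · rintro (s | s) i j hi hj ⟨hik, hkj⟩
    · show _ ∣ Polynomial.eval _ (lp m (range k) 0 * Polynomial.X ^ s.val)
      rw [Polynomial.eval_mul, lp_eval_zero _ (mem_range.2 hik), zero_mul]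
      exact dvd_zero _
    · show _ ∣ Polynomial.eval _ (lp m (Ico k (m + 1)) t * Polynomial.X ^ s.val)
      rw [Polynomial.eval_mul, lp_eval]
      refine Dvd.dvd.mul_right ?_ _
      exact dvd_prod_of_mem (fun j => t + yy m i - yy m j) (mem_Ico.2 ⟨hkj, by omega⟩)
  · intro c c' h
    rw [PiP_eq (m := m) (S := range k) (S' := Ico k (m + 1)) (by
        rw [disjoint_left]; intro x; simp only [mem_range, mem_Ico]; omega) (by
        ext x; simp only [mem_union, mem_range, mem_Ico]; omega),
      Polynomial.mul_comp, ← htdef, lp_comp, lp_comp] at h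
    set l0 := lp m (range k) 0
    set l1 := lp m (range k) t
    set r0 := lp m (Ico k (m + 1)) 0
    set r1 := lp m (Ico k (m + 1)) t
    set P := pw fun s => c (Sum.inl s) with hP
    set Q := pw fun s => c (Sum.inr s) with hQ
    have hsum := sum_elim_pw c l0 r1
    rw [hsum] at h
    have hd : l0 * (Polynomial.C t * P + Polynomial.C c' * r0 - Polynomial.C c' * r1) =
        r1 * (Polynomial.C c' * l1 - Polynomial.C t * Q - Polynomial.C c' * l0) := by
      linear_combination h
    have hK := eq_zero_of_lp (S := range k) (fun i hi => by have := mem_range.1 hi; omega) hd (by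
      intro i hi
      rw [lp_eval]
      refine prod_ne_zero_iff.2 fun j hj => ?_
      have := mem_range.1 hi
      have := mem_Ico.1 hj
      exact ne_zero_tt0 (by omega) (by omega)) (by
      rw [Polynomial.degree_lt_iff_coeff_zero]
      intro s hs
      rw [card_range] at hs
      simp only [Polynomial.coeff_sub, Polynomial.coeff_C_mul]
      rw [hQ, pw_coeff_ge _ hs]
      rcases Nat.eq_or_lt_of_le hs with rfl | hs
      · have e1 : l0.coeff k = 1 := by
          have := (lp_monic (m := m) (range k) 0); rw [Polynomial.Monic, Polynomial.leadingCoeff, lp_natDegree, card_range] at this; exact this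
        have e2 : l1.coeff k = 1 := by
          have := (lp_monic (m := m) (range k) t); rw [Polynomial.Monic, Polynomial.leadingCoeff, lp_natDegree, card_range] at this; exact this
        rw [e1, e2]; ring
      · rw [Polynomial.coeff_eq_zero_of_natDegree_lt (p := l0) (by rw [lp_natDegree, card_range]; exact hs),
          Polynomial.coeff_eq_zero_of_natDegree_lt (p := l1) (by rw [lp_natDegree, card_range]; exact hs)]
        ring)
    rw [hK, mul_zero] at hd
    have hl0 : l0 ≠ 0 := (lp_monic _ _).ne_zero
    have hd := (mul_eq_zero.1 hd).resolve_left hl0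
    have hc' : c' = 0 := by
      have h1 := congrArg (fun p => Polynomial.coeff p b) hd
      simp only [Polynomial.coeff_sub, Polynomial.coeff_add, Polynomial.coeff_C_mul, Polynomial.coeff_zero] at h1
      rw [hP, pw_coeff_ge _ le_rfl] at h1
      have hcard : #(Ico k (m + 1)) = b + 1 := by rw [Nat.card_Ico]; omega
      have e1 : ∀ z, (lp m (Ico k (m + 1)) z).coeff b = - ∑ i ∈ Ico k (m + 1), (yy m i - z) := by
        intro z
        have := Polynomial.prod_X_sub_C_coeff_card_pred (Ico k (m + 1)) (fun i => yy m i - z) (by omega)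
        rw [hcard] at this
        exact this
      rw [e1, e1, sum_sub_distrib, sum_sub_distrib, sum_const, sum_const, hcard] at h1
      have h2 : c' * (((b + 1 : ℕ) : MvPolynomial (Fin (m + 1)) ℚ) * t) = 0 := by
        simp only [nsmul_eq_mul] at h1
        linear_combination (-1) * h1
      rcases mul_eq_zero.1 h2 with h2 | h2
      · exact h2
      · rcases mul_eq_zero.1 h2 with h2 | h2
        · exact absurd h2 (Nat.cast_ne_zero.2 (by omega))
        · exact absurd h2 ht
    subst hc'
    simp only [map_zero, zero_mul, add_zero, sub_zero, zero_sub, neg_eq_zero] at hd hK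
    have hCt : Polynomial.C t ≠ 0 := by simpa using ht
    have hP0 := (mul_eq_zero.1 hd).resolve_left hCt
    have hQ0 := (mul_eq_zero.1 hK).resolve_left hCt
    rintro (s | s)
    · exact pw_eq_zero hP0 s
    · exact pw_eq_zero hQ0 s
  · have h := count_lem (G := almostPath m k) (range k ×ˢ Ico k (m + 1))
      (fun x => insert (Fin.last m) (iv m x.1 x.2)) {Fin.last m} hcI ?_ ?_ (connSet_singleton _ _)
      (mem_singleton_self _) ?_
    · refine le_trans (le_of_eq ?_) h
      rw [card_product, card_range, Nat.card_Ico, Fintype.sum_sum_type]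
      simp only [Sum.elim_inl, Sum.elim_inr]
      rw [sum_lin, sum_lin, hm, sum_split, show k + b + 1 - k = b + 1 by omega]
      ring
    · intro x hx
      have hx := mem_product.1 hx
      rw [mem_range, mem_Ico] at hx
      refine ⟨?_, mem_insert_self _ _⟩
      rw [insert_eq]
      refine connSet_union (connSet_singleton _ _) (hcI _ _ (by omega) (by omega))
        ⟨_, mem_singleton_self _, ⟨k - 1, by omega⟩, ?_, ?_⟩
      · rw [mem_iv]; simp only; omega
      · rw [ap_adj, Ne, Fin.ext_iff]
        exact ⟨by simp only [Fin.val_last]; omega, Or.inr (Or.inr ⟨rfl, rfl⟩)⟩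
    · rintro ⟨i, j⟩ hx ⟨i', j'⟩ hx' h
      simp only [coe_product, Set.mem_prod, mem_coe, mem_range, mem_Ico] at hx hx'
      obtain ⟨rfl, rfl⟩ := insert_iv_inj (by omega) (by omega) (by omega) (by omega) h
      rfl
    · intro x hx h
      have hx := mem_product.1 hx
      rw [mem_range, mem_Ico] at hx
      have : (⟨k - 1, by omega⟩ : Fin (m + 1)) ∈ ({Fin.last m} : Finset (Fin (m + 1))) := by
        rw [← h, mem_insert, mem_iv]; right; simp only; omega
      rw [mem_singleton, Fin.ext_iff, Fin.val_last] at this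
      simp only at this
      omega

end Models2
end CSA


namespace CSA

section Models3

set_option maxHeartbeats 1000000 in
theorem SD_pathTriangle {m k : ℕ} (hk1 : 1 ≤ k) (hkm : k < m) : SD (pathTriangle m k) := by
  obtain ⟨b, rfl⟩ := Nat.exists_eq_add_of_le hkm.le
  set m := k + b with hm
  set t := tt m 0 with htdef
  have ht : t ≠ 0 := by
    have := ne_zero_tt0 (m := m) (le_refl 0) (Nat.zero_le m)
    rwa [add_sub_cancel_right] at this
  have hpath : ∀ x y : Fin (m + 1), x.val + 1 = y.val → y.val < m → (pathTriangle m k).Adj x y := by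
    intro x y h1 h2
    rw [pt_adj, Ne, Fin.ext_iff]; omega
  have hcI : ∀ i j, i < j → j ≤ m → ConnSet (pathTriangle m k) (iv m i j) :=
    fun i j hij hj => conn_iv m (by omega) hpath hij hj
  refine core (pathTriangle m k) 0 ht (fun i j => i ≤ k ∧ k ≤ j) ?_ (ι := Fin b ⊕ Fin k) ?_
    (Sum.elim (fun s => lp m (range (k + 1)) 0 * Polynomial.X ^ s.val)
      (fun s => lp m (Ico k (m + 1)) t * Polynomial.X ^ s.val))
    (Sum.elim (fun s => (k + 1) + s.val) (fun s => (b + 1) + s.val)) ?_ ?_ ?_ ?_ ?_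
  · intro I hI
    have hcut := (connSet_iff.1 hI).2
    obtain ⟨i, j, hij, hj, hJ⟩ := exists_iv (I.erase (Fin.last m)) (notMem_erase _ _) (by
      intro a b' c hab hbc ha hc
      rw [mem_erase] at ha hc ⊢
      have hcm : c.val < m := by
        have := c.2
        have h2 := hc.1
        rw [Ne, Fin.ext_iff, Fin.val_last] at h2
        omega
      have hbm : b' ≠ Fin.last m := by
        rw [Ne, Fin.ext_iff, Fin.val_last]
        have : b'.val < c.val := hbc
        omega
      refine ⟨hbm, ?_⟩
      by_contra hb
      rw [Fin.lt_def] at hab hbc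
      obtain ⟨x, hx, y, hy, hPx, hPy, hadj⟩ := hcut
        (fun x => (x.val < m ∧ x.val < b'.val) ∨ (x.val = m ∧ k - 1 < b'.val))
        ⟨a, ha.2, by left; omega⟩ ⟨c, hc.2, by omega⟩
      rw [pt_adj, Ne, Fin.ext_iff] at hadj
      have hyb : y.val ≠ b'.val := fun h => hb (Fin.ext h ▸ hy)
      have := x.2
      have := y.2
      omega)
    refine ⟨i, j, by omega, hj, ?_⟩
    by_cases hl : Fin.last m ∈ I
    · right
      have hI' : I = insert (Fin.last m) (iv m i j) := by rw [← hJ, insert_erase hl]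
      constructor
      · rcases Nat.eq_or_lt_of_le hij with h | h
        · right; exact h
        left
        obtain ⟨x, hx, y, hy, hPx, hPy, hadj⟩ := hcut (fun x => x = Fin.last m) ⟨_, hl, rfl⟩
          ⟨⟨i, by omega⟩, by rw [hI', mem_insert, mem_iv]; right; simpa using h, by
            rw [Fin.ext_iff, Fin.val_last]; show ¬ i = m; omega⟩
        rw [pt_adj, Ne, Fin.ext_iff, hPx, Fin.val_last] at hadj
        rw [hI', mem_insert, mem_iv] at hy
        have hy := hy.resolve_left hPy
        omega
      · intro p τ
        rw [hI', sum_vals_insert _ _ _ hij hj]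
        simp; ring
    · left
      rw [erase_eq_of_notMem hl] at hJ
      intro p τ
      rw [hJ, sum_vals_iv _ _ _ hij hj]
  · simp [hm]; ring
  · rintro (s | s)
    · show Wt ((k + 1) + s.val) (lp m (range (k + 1)) 0 * Polynomial.X ^ s.val)
      have := (lp_wt (m := m) (range (k + 1)) (t := 0) (by simp)).mul (Wt.X_pow s.val)
      rwa [card_range] at this
    · show Wt ((b + 1) + s.val) (lp m (Ico k (m + 1)) t * Polynomial.X ^ s.val)
      have := (lp_wt (m := m) (Ico k (m + 1)) (t := t) (deg_tt _)).mul (Wt.X_pow s.val)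
      rwa [Nat.card_Ico, show m + 1 - k = b + 1 by omega] at this
  · rintro (s | s)
    · show k + 1 + s.val ≤ m
      omega
    · show b + 1 + s.val ≤ m
      omega
  · rintro (s | s) i j hi hj ⟨hik, hkj⟩
    · show _ ∣ Polynomial.eval _ (lp m (range (k + 1)) 0 * Polynomial.X ^ s.val)
      rw [Polynomial.eval_mul, lp_eval_zero _ (mem_range.2 (Nat.lt_succ_of_le hik)), zero_mul]
      exact dvd_zero _
    · show _ ∣ Polynomial.eval _ (lp m (Ico k (m + 1)) t * Polynomial.X ^ s.val)
      rw [Polynomial.eval_mul, lp_eval]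
      refine Dvd.dvd.mul_right ?_ _
      exact dvd_prod_of_mem (fun j => t + yy m i - yy m j) (mem_Ico.2 ⟨hkj, by omega⟩)
  · intro c c' h
    have hcomp : (PiP m).comp (Polynomial.X + Polynomial.C t) = lp m (range k) t * lp m (Ico k (m + 1)) t := by
      rw [PiP_eq (m := m) (S := range k) (S' := Ico k (m + 1)) (by
        rw [disjoint_left]; intro x; simp only [mem_range, mem_Ico]; omega) (by
        ext x; simp only [mem_union, mem_range, mem_Ico]; omega),
        Polynomial.mul_comp, lp_comp, lp_comp]
    rw [← htdef, hcomp, PiP_eq (m := m) (S := range (k + 1)) (S' := Ico (k + 1) (m + 1)) (by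
        rw [disjoint_left]; intro x; simp only [mem_range, mem_Ico]; omega) (by
        ext x; simp only [mem_union, mem_range, mem_Ico]; omega)] at h
    set l0 := lp m (range (k + 1)) 0
    set l1 := lp m (range k) t
    set r0 := lp m (Ico (k + 1) (m + 1)) 0
    set r1 := lp m (Ico k (m + 1)) t
    set P := pw fun s => c (Sum.inl s) with hP
    set Q := pw fun s => c (Sum.inr s) with hQ
    have hsum := sum_elim_pw c l0 r1
    rw [hsum] at h
    have hd : l0 * (Polynomial.C t * P + Polynomial.C c' * r0) =
        r1 * (Polynomial.C c' * l1 - Polynomial.C t * Q) := by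
      linear_combination h
    have e2 : l1.coeff k = 1 := by
      have := (lp_monic (m := m) (range k) t)
      rw [Polynomial.Monic, Polynomial.leadingCoeff, lp_natDegree, card_range] at this
      exact this
    have hK := eq_zero_of_lp (S := range (k + 1)) (fun i hi => by have := mem_range.1 hi; omega) hd (by
      intro i hi
      rw [lp_eval]
      refine prod_ne_zero_iff.2 fun j hj => ?_
      have := mem_range.1 hi
      have := mem_Ico.1 hj
      exact ne_zero_tt0 (by omega) (by omega)) (by
      rw [Polynomial.degree_lt_iff_coeff_zero]
      intro s hs
      rw [card_range] at hs
      simp only [Polynomial.coeff_sub, Polynomial.coeff_C_mul]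
      rw [hQ, pw_coeff_ge _ (by omega)]
      rw [Polynomial.coeff_eq_zero_of_natDegree_lt (p := l1) (by rw [lp_natDegree, card_range]; omega)]
      ring)
    rw [hK, mul_zero] at hd
    have hl0 : l0 ≠ 0 := (lp_monic _ _).ne_zero
    have hd := (mul_eq_zero.1 hd).resolve_left hl0
    have hc' : c' = 0 := by
      have h1 := congrArg (fun p => Polynomial.coeff p k) hK
      simp only [Polynomial.coeff_sub, Polynomial.coeff_C_mul, Polynomial.coeff_zero] at h1
      rw [hQ, pw_coeff_ge _ le_rfl, e2] at h1
      linear_combination h1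
    subst hc'
    simp only [map_zero, zero_mul, add_zero, sub_zero, zero_sub, neg_eq_zero] at hd hK
    have hCt : Polynomial.C t ≠ 0 := by simpa using ht
    have hP0 := (mul_eq_zero.1 hd).resolve_left hCt
    have hQ0 := (mul_eq_zero.1 hK).resolve_left hCt
    rintro (s | s)
    · exact pw_eq_zero hP0 s
    · exact pw_eq_zero hQ0 s
  · have h := count_lem (G := pathTriangle m k) ((range (k + 1) ×ˢ Ico k (m + 1)).erase (k, k))
      (fun x => insert (Fin.last m) (iv m x.1 x.2)) {Fin.last m} hcI ?_ ?_ (connSet_singleton _ _)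
      (mem_singleton_self _) ?_
    · refine le_trans (le_of_eq ?_) h
      rw [card_erase_of_mem (by rw [mem_product, mem_range, mem_Ico]; simp only; omega),
        card_product, card_range, Nat.card_Ico, Fintype.sum_sum_type]
      simp only [Sum.elim_inl, Sum.elim_inr]
      rw [sum_lin, sum_lin, hm, sum_split, show k + b + 1 - k = b + 1 by omega]
      rw [show (k + 1) * (b + 1) - 1 = k * b + k + b by
        rw [show (k + 1) * (b + 1) = k * b + k + b + 1 by ring]; omega]
      ring
    · rintro ⟨i, j⟩ hx
      have hx := mem_erase.1 hx
      rw [mem_product, mem_range, mem_Ico, Ne, Prod.mk.injEq] at hx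
      simp only at hx ⊢
      refine ⟨?_, mem_insert_self _ _⟩
      rw [insert_eq]
      by_cases hik : i < k
      · refine connSet_union (connSet_singleton _ _) (hcI _ _ (by omega) (by omega))
          ⟨_, mem_singleton_self _, ⟨k - 1, by omega⟩, ?_, ?_⟩
        · rw [mem_iv]; simp only; omega
        · rw [pt_adj, Ne, Fin.ext_iff]
          exact ⟨by simp only [Fin.val_last]; omega, Or.inr (Or.inr (Or.inl ⟨rfl, rfl⟩))⟩
      · refine connSet_union (connSet_singleton _ _) (hcI _ _ (by omega) (by omega))
          ⟨_, mem_singleton_self _, ⟨k, by omega⟩, ?_, ?_⟩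
        · rw [mem_iv]; simp only; omega
        · rw [pt_adj, Ne, Fin.ext_iff]
          exact ⟨by simp only [Fin.val_last]; omega, Or.inr (Or.inr (Or.inr ⟨rfl, rfl⟩))⟩
    · rintro ⟨i, j⟩ hx ⟨i', j'⟩ hx' h
      simp only [coe_erase, coe_product, Set.mem_sdiff, Set.mem_singleton_iff, Set.mem_prod, mem_coe, mem_range, mem_Ico, Prod.mk.injEq] at hx hx'
      obtain ⟨rfl, rfl⟩ := insert_iv_inj (by omega) (by omega) (by omega) (by omega) h
      rfl
    · rintro ⟨i, j⟩ hx h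
      have hx := mem_erase.1 hx
      rw [mem_product, mem_range, mem_Ico, Ne, Prod.mk.injEq] at hx
      simp only at hx h
      have : (⟨i, by omega⟩ : Fin (m + 1)) ∈ ({Fin.last m} : Finset (Fin (m + 1))) := by
        rw [← h, mem_insert, mem_iv]; right; simp only; omega
      rw [mem_singleton, Fin.ext_iff, Fin.val_last] at this
      simp only at this
      omega

end Models3
end CSA


namespace CSA

section Models4
variable {m : ℕ}

lemma cyc_adj (hm : 2 ≤ m) {x y : Fin (m + 1)} : (SimpleGraph.cycleGraph (m + 1)).Adj x y ↔
    (x.val + 1 = y.val ∨ y.val + 1 = x.val ∨ (x.val = 0 ∧ y.val = m) ∨ (x.val = m ∧ y.val = 0)) := by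
  rw [SimpleGraph.cycleGraph_adj', Fin.val_sub, Fin.val_sub]
  have hx := x.2
  have hy := y.2
  have key : ∀ a b : ℕ, a < m + 1 → b < m + 1 →
      (m + 1 - b + a) % (m + 1) = if b ≤ a then a - b else m + 1 - b + a := by
    intro a b ha hb
    split_ifs with h
    · rw [show m + 1 - b + a = (a - b) + (m + 1) by omega, Nat.add_mod_right]
      exact Nat.mod_eq_of_lt (by omega)
    · exact Nat.mod_eq_of_lt (by omega)
  rw [key _ _ hx hy, key _ _ hy hx]
  split_ifs <;> omega

/-- cycle basis -/
noncomputable def gc (m k : ℕ) (t : MvPolynomial (Fin (m + 1)) ℚ) :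
    Polynomial (MvPolynomial (Fin (m + 1)) ℚ) := lp m (Ico (k + 1) (m + 1)) 0 * lp m (range k) t

lemma gc_tel (t : MvPolynomial (Fin (m + 1)) ℚ) (k : ℕ) (hk : k ≤ m + 1) :
    Polynomial.C t * ∑ i ∈ range k, gc m i t =
      lp m (Ico k (m + 1)) 0 * lp m (range k) t - PiP m := by
  induction k with
  | zero =>
    have : PiP m = lp m (Ico 0 (m + 1)) 0 * lp m (range 0) t := by
      rw [PiP, lp, lp]; simp
    rw [this]; simp
  | succ k ih =>
    rw [sum_range_succ, mul_add, ih (by omega)]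
    have h1 : lp m (Ico k (m + 1)) 0 =
        (Polynomial.X - Polynomial.C (yy m k)) * lp m (Ico (k + 1) (m + 1)) 0 := by
      rw [lp, lp, Finset.prod_eq_prod_Ico_succ_bot (by omega)]
      simp
    have h2 : lp m (range (k + 1)) t =
        lp m (range k) t * (Polynomial.X - Polynomial.C (yy m k - t)) := by
      rw [lp, lp, prod_range_succ]
    rw [h1, h2, gc, map_sub]
    ring

lemma PiP_eq_lp : PiP m = lp m (range (m + 1)) 0 := by
  rw [PiP, lp]; simp

lemma gc_ind (d : ℕ → MvPolynomial (Fin (m + 1)) ℚ)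
    (h : ∑ i ∈ range (m + 1), Polynomial.C (d i) * gc m i (tt m 1) = 0) :
    ∀ j, j ≤ m → d (m - j) = 0 := by
  intro j
  induction j using Nat.strong_induction_on with
  | _ j ih =>
    intro hj
    have h1 := congrArg (Polynomial.eval (yy m (m - j))) h
    rw [Polynomial.eval_finsetSum, Polynomial.eval_zero, Finset.sum_eq_single (m - j)] at h1
    · rw [Polynomial.eval_mul, Polynomial.eval_C] at h1
      refine (mul_eq_zero.1 h1).resolve_right ?_
      rw [gc, Polynomial.eval_mul, lp_eval, lp_eval]
      refine mul_ne_zero (prod_ne_zero_iff.2 fun l hl => ?_) (prod_ne_zero_iff.2 fun l hl => ?_)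
      · rw [zero_add, sub_ne_zero]
        have := mem_Ico.1 hl
        exact yy_ne (by omega) (by omega)
      · have := mem_range.1 hl
        exact ne_zero_tt1 (by omega) (by omega)
    · intro i hi hne
      have hi := mem_range.1 hi
      rw [Polynomial.eval_mul, Polynomial.eval_C]
      rcases Nat.lt_or_gt_of_ne hne with hlt | hgt
      · rw [gc, Polynomial.eval_mul, lp_eval_zero _ (mem_Ico.2 (by omega))]
        ring
      · have := ih (m - i) (by omega) (by omega)
        rw [show m - (m - i) = i by omega] at this
        rw [this, zero_mul]
    · intro hn
      exact absurd (mem_range.2 (by omega)) hn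

lemma two_sum (m : ℕ) : ∑ j ∈ range (m + 1), j + ∑ j ∈ range (m + 1), j = m * (m + 1) := by
  induction m with
  | zero => simp
  | succ m ih => rw [sum_range_succ]; linarith

theorem SD_cycle (hm : 2 ≤ m) : SD (SimpleGraph.cycleGraph (m + 1)) := by
  set t := tt m 1 with htdef
  have ht : t ≠ 0 := by
    have := ne_zero_tt1 (m := m) (le_refl 0) (Nat.zero_le m)
    rwa [add_sub_cancel_right] at this
  have hpath : ∀ x y : Fin (m + 1), x.val + 1 = y.val → y.val < m + 1 →
      (SimpleGraph.cycleGraph (m + 1)).Adj x y := by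
    intro x y h1 h2
    rw [cyc_adj hm]; omega
  have hcI : ∀ i j, i < j → j ≤ m + 1 → ConnSet (SimpleGraph.cycleGraph (m + 1)) (iv m i j) :=
    fun i j hij hj => conn_iv (m + 1) le_rfl hpath hij hj
  refine core _ 1 ht (fun i j => j < i) ?_ (ι := Fin m) (by simp)
    (fun k => gc m k.val t) (fun _ => m) ?_ (fun _ => le_rfl) ?_ ?_ ?_
  · intro I hI
    have hcut := (connSet_iff.1 hI).2
    by_cases hl : Fin.last m ∈ I
    · obtain ⟨i, j, hij, hj, hJ⟩ := exists_iv Iᶜ (by simpa using hl) (by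
        intro a b' c hab hbc ha hc
        rw [mem_compl] at ha hc ⊢
        intro hb
        rw [Fin.lt_def] at hab hbc
        obtain ⟨x, hx, y, hy, hPx, hPy, hadj⟩ := hcut
          (fun x => a.val < x.val ∧ x.val < c.val)
          ⟨b', hb, by omega⟩ ⟨_, hl, by have := c.2; simp only [Fin.val_last]; omega⟩
        rw [cyc_adj hm] at hadj
        have hya : y.val ≠ a.val := fun h => ha (Fin.ext h ▸ hy)
        have hyc : y.val ≠ c.val := fun h => hc (Fin.ext h ▸ hy)
        have := c.2
        have := y.2
        omega)
      have hI' : I = (iv m i j)ᶜ := by rw [← hJ, compl_compl]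
      refine ⟨j, i, hj, by omega, Or.inr ⟨by omega, fun p τ => ?_⟩⟩
      rw [hI', sum_vals_compl _ _ hij hj]
    · obtain ⟨i, j, hij, hj, hJ⟩ := exists_iv I hl (by
        intro a b' c hab hbc ha hc
        by_contra hb
        rw [Fin.lt_def] at hab hbc
        obtain ⟨x, hx, y, hy, hPx, hPy, hadj⟩ := hcut
          (fun x => x.val < b'.val) ⟨a, ha, hab⟩ ⟨c, hc, by omega⟩
        rw [cyc_adj hm] at hadj
        have hyb : y.val ≠ b'.val := fun h => hb (Fin.ext h ▸ hy)
        have hym : y.val ≠ m := fun h => hl ((Fin.ext h : y = Fin.last m) ▸ hy)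
        have := c.2
        have := y.2
        omega)
      refine ⟨i, j, by omega, hj, Or.inl fun p τ => ?_⟩
      rw [hJ, sum_vals_iv _ _ _ hij hj]
  · intro k
    have := (lp_wt (m := m) (Ico (k.val + 1) (m + 1)) (t := 0) (by simp)).mul
      (lp_wt (m := m) (range k.val) (t := t) (deg_tt _))
    rw [Nat.card_Ico, card_range] at this
    exact this.mono (by omega)
  · intro k i j hi hj hji
    show _ ∣ Polynomial.eval _ (gc m k.val t)
    rw [gc, Polynomial.eval_mul]
    by_cases hk : k.val < i
    · rw [lp_eval_zero _ (mem_Ico.2 (by omega)), zero_mul]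
      exact dvd_zero _
    · refine Dvd.dvd.mul_left ?_ _
      rw [lp_eval]
      exact dvd_prod_of_mem (fun j => t + yy m i - yy m j) (mem_range.2 (by omega))
  · intro c c' h
    set d : ℕ → MvPolynomial (Fin (m + 1)) ℚ := fun i => (if h : i < m then c ⟨i, h⟩ else 0) - c' with hd
    have hCt : Polynomial.C t ≠ 0 := by simpa using ht
    have hz : ∑ i ∈ range (m + 1), Polynomial.C (d i) * gc m i t = 0 := by
      have htel := gc_tel t (m + 1) le_rfl
      have h1 : lp m (Ico (m + 1) (m + 1)) 0 = 1 := by rw [lp]; simp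
      have h2 : (PiP m).comp (Polynomial.X + Polynomial.C t) = lp m (range (m + 1)) t := by
        rw [PiP_eq_lp, lp_comp]
      rw [h1, one_mul] at htel
      rw [← htdef, h2, ← htel] at h
      have h3 : ∑ k : Fin m, Polynomial.C (c k) * gc m k.val t =
          ∑ i ∈ range (m + 1), Polynomial.C (if h : i < m then c ⟨i, h⟩ else 0) * gc m i t := by
        rw [sum_range_succ, dif_neg (by omega), map_zero, zero_mul, add_zero,
          ← Fin.sum_univ_eq_sum_range (fun i => Polynomial.C (if h : i < m then c ⟨i, h⟩ else 0) * gc m i t)]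
        refine sum_congr rfl fun k _ => ?_
        rw [dif_pos k.2]
      apply (mul_eq_zero.1 (?_ : Polynomial.C t * _ = 0)).resolve_left hCt
      have h4 : ∑ i ∈ range (m + 1), Polynomial.C (d i) * gc m i t =
          ∑ k : Fin m, Polynomial.C (c k) * gc m k.val t - Polynomial.C c' * ∑ i ∈ range (m + 1), gc m i t := by
        rw [h3, mul_sum, ← sum_sub_distrib]
        refine sum_congr rfl fun i _ => ?_
        rw [hd, map_sub, sub_mul]
      rw [h4]
      linear_combination h
    have hall := gc_ind d hz
    have hc' : c' = 0 := by
      have := hall 0 (by omega)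
      simpa [hd] using this
    intro k
    have := hall (m - k.val) (by omega)
    rw [show m - (m - k.val) = k.val by omega] at this
    simpa [hd, hc'] using this
  · have h := count_lem (G := SimpleGraph.cycleGraph (m + 1)) ((range (m + 1)).sigma fun j => range j)
      (fun x => (iv m x.2 x.1)ᶜ) univ (fun i j h1 h2 => hcI i j h1 (by omega)) ?_ ?_ ?_
      (mem_univ _) ?_
    · refine le_trans (le_of_eq ?_) h
      have := two_sum m
      simp only [card_sigma, card_range, sum_const, card_univ, Fintype.card_fin, smul_eq_mul]
      omega
    · rintro ⟨j, i⟩ hx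
      have hx := mem_sigma.1 hx
      simp only [mem_range] at hx
      refine ⟨?_, mem_compl.2 (last_notMem_iv (by simp only; omega))⟩
      simp only
      have hlast := hcI j (m + 1) (by omega) le_rfl
      rcases Nat.eq_zero_or_pos i with rfl | hi
      · have : (iv m 0 j)ᶜ = iv m j (m + 1) := by
          ext x; have := x.2; rw [mem_compl, mem_iv, mem_iv]; omega
        rwa [this]
      · have : (iv m i j)ᶜ = iv m 0 i ∪ iv m j (m + 1) := by
          ext x; have := x.2; rw [mem_compl, mem_union, mem_iv, mem_iv, mem_iv]; omega
        rw [this]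
        refine connSet_union (hcI 0 i hi (by omega)) hlast
          ⟨⟨0, by omega⟩, mem_iv.2 ⟨le_rfl, hi⟩, Fin.last m, ?_, ?_⟩
        · rw [mem_iv, Fin.val_last]; omega
        · rw [cyc_adj hm, Fin.val_last]; simp
    · rintro ⟨j, i⟩ hx ⟨j', i'⟩ hx' h
      simp only [coe_sigma, Set.mem_sigma_iff, mem_coe, mem_range] at hx hx'
      have h : iv m i j = iv m i' j' := compl_injective h
      obtain ⟨rfl, rfl⟩ := iv_inj (by omega) (by omega) (by omega) (by omega) h
      rfl
    · have : (univ : Finset (Fin (m + 1))) = iv m 0 (m + 1) := by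
        ext x; have := x.2; simp only [mem_univ, mem_iv, true_iff]; omega
      rw [this]
      exact hcI 0 (m + 1) (by omega) le_rfl
    · rintro ⟨j, i⟩ hx h
      have hx := mem_sigma.1 hx
      simp only [mem_range] at hx
      have : (⟨i, by omega⟩ : Fin (m + 1)) ∈ (iv m i j)ᶜ := by
        simp only at h; rw [h]; exact mem_univ _
      rw [mem_compl, mem_iv] at this
      simp only at this
      omega

end Models4
end CSA


namespace CSA

section Graph
variable {n : ℕ} {G : SimpleGraph (Fin n)}

lemma isoOf {n' : ℕ} {G' : SimpleGraph (Fin n')} (f : Fin n' → Fin n) (hf : Function.Bijective f)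
    (h : ∀ x y, G.Adj (f x) (f y) ↔ G'.Adj x y) : Nonempty (G ≃g G') :=
  ⟨(⟨Equiv.ofBijective f hf, fun {a b} => h a b⟩ : G' ≃g G).symm⟩

lemma SD_path1 : SD (SimpleGraph.pathGraph 1) := by
  refine ⟨Matrix.of fun _ l => MvPolynomial.X l, fun I _ _ => dvd_rfl, ?_, ?_⟩
  · rw [Matrix.det_fin_one]; simp
  · rw [Matrix.det_fin_one, Matrix.of_apply, MvPolynomial.totalDegree_X]
    exact card_pos.2 ⟨{0}, mem_conns.2 (connSet_singleton _ _)⟩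

lemma SD_path (m : ℕ) : SD (SimpleGraph.pathGraph (m + 1)) := by
  rcases Nat.eq_zero_or_pos m with rfl | hm
  · exact SD_path1
  have : Nonempty (SimpleGraph.pathGraph (m + 1) ≃g almostPath m 1) := by
    refine isoOf (fun x => ⟨if x.val < m then x.val + 1 else 0, by split_ifs <;> omega⟩) ?_ ?_
    · rw [Fintype.bijective_iff_injective_and_card]
      refine ⟨?_, rfl⟩
      intro x y hxy
      have := x.2
      have := y.2
      ext
      simp only [Fin.mk.injEq] at hxy
      split_ifs at hxy <;> omega
    · intro x y
      have := x.2
      have := y.2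
      rw [SimpleGraph.pathGraph_adj, ap_adj, Ne, Fin.ext_iff]
      dsimp only
      split_ifs <;> (try simp only [false_or, or_false, false_iff]) <;> omega
  exact this.some |> fun e => SD.of_iso e (SD_almostPath le_rfl hm)

lemma cross (hG : G.Connected) (P : Fin n → Prop) {x y : Fin n} (hx : P x) (hy : ¬ P y) :
    ∃ a b, P a ∧ ¬ P b ∧ G.Adj a b := by
  by_contra hcon
  push Not at hcon
  have : ∀ a b, G.Reachable a b → P a → P b := by
    rintro a b ⟨w⟩
    induction w with
    | nil => exact id
    | cons h _ ih =>
      intro ha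
      refine ih ?_
      by_contra hb
      exact hcon _ _ ha hb h
  exact hy (this x y (hG.preconnected x y) hx)

/-- image of an index interval -/
def seg (v : ℕ → Fin n) (i j : ℕ) : Finset (Fin n) := (Ico i j).image v

lemma seg_conn (v : ℕ → Fin n) {i j : ℕ} (hij : i < j)
    (h : ∀ a, i ≤ a → a + 1 < j → G.Adj (v a) (v (a + 1))) : ConnSet G (seg v i j) := by
  induction j with
  | zero => omega
  | succ j ih =>
    rcases Nat.eq_or_lt_of_le (Nat.le_of_lt_succ hij) with rfl | hij'
    · have : seg v i (i + 1) = {v i} := by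
        rw [seg, Nat.Ico_succ_singleton, image_singleton]
      rw [this]; exact connSet_singleton G _
    · have hs : seg v i (j + 1) = seg v i j ∪ {v j} := by
        rw [seg, seg, ← Finset.insert_Ico_right_eq_Ico_add_one hij'.le, image_insert, insert_eq, union_comm]
      rw [hs]
      refine connSet_union (ih hij' fun a ha hb => h a ha (by omega)) (connSet_singleton G _)
        ⟨v (j - 1), mem_image_of_mem _ (mem_Ico.2 (by omega)), _, mem_singleton_self _, ?_⟩
      have := h (j - 1) (by omega) (by omega)
      rwa [show j - 1 + 1 = j by omega] at this

lemma mdl {r : ℕ} (v : ℕ → Fin n) (M : ℕ) (hinj : ∀ a b, a < M → b < M → v a = v b → a = b)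
    (lo hi : Fin r → ℕ) (E : List (Fin r × Fin r)) (h1 : ∀ j, lo j < hi j ∧ hi j ≤ M)
    (h2 : ∀ j a, lo j ≤ a → a + 1 < hi j → G.Adj (v a) (v (a + 1)))
    (h3 : ∀ i j, i < j → hi i ≤ lo j ∨ hi j ≤ lo i)
    (h4 : ∀ e ∈ E, ∃ a b, (lo e.1 ≤ a ∧ a < hi e.1) ∧ (lo e.2 ≤ b ∧ b < hi e.2) ∧ G.Adj (v a) (v b)) :
    MdlW G (fun j => seg v (lo j) (hi j)) E := by
  refine ⟨?_, fun j => seg_conn v (h1 j).1 (h2 j), ?_⟩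
  · intro i j hij
    rw [disjoint_left]
    intro x hx hy
    obtain ⟨a, ha, rfl⟩ := mem_image.1 hx
    obtain ⟨b, hb, e⟩ := mem_image.1 hy
    have ha := mem_Ico.1 ha
    have hb := mem_Ico.1 hb
    have a1 := h1 i
    have a2 := h1 j
    have := hinj b a (by omega) (by omega) e
    have := h3 i j hij
    omega
  · intro e he
    obtain ⟨a, b, ha, hb, hab⟩ := h4 e he
    exact ⟨v a, mem_image_of_mem _ (mem_Ico.2 ha), v b, mem_image_of_mem _ (mem_Ico.2 hb), hab⟩

/-- star with an interval as centre -/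
lemma star4 (hF : ¬ NF G) (v : ℕ → Fin n) (M : ℕ) (hinj : ∀ a b, a < M → b < M → v a = v b → a = b)
    (l h x1 x2 x3 x4 p1 p2 p3 p4 : ℕ) (hlh : l < h) (hM : h ≤ M)
    (hx : x1 < M ∧ x2 < M ∧ x3 < M ∧ x4 < M)
    (ho : (x1 < l ∨ h ≤ x1) ∧ (x2 < l ∨ h ≤ x2) ∧ (x3 < l ∨ h ≤ x3) ∧ (x4 < l ∨ h ≤ x4))
    (hd : x1 ≠ x2 ∧ x1 ≠ x3 ∧ x1 ≠ x4 ∧ x2 ≠ x3 ∧ x2 ≠ x4 ∧ x3 ≠ x4)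
    (hadj : ∀ a, l ≤ a → a + 1 < h → G.Adj (v a) (v (a + 1)))
    (hp : (l ≤ p1 ∧ p1 < h) ∧ (l ≤ p2 ∧ p2 < h) ∧ (l ≤ p3 ∧ p3 < h) ∧ (l ≤ p4 ∧ p4 < h))
    (a1 : G.Adj (v p1) (v x1)) (a2 : G.Adj (v p2) (v x2)) (a3 : G.Adj (v p3) (v x3))
    (a4 : G.Adj (v p4) (v x4)) : False := by
  apply hF
  refine NF_K14 (mdl v M hinj ![l, x1, x2, x3, x4] ![h, x1 + 1, x2 + 1, x3 + 1, x4 + 1] _ ?_ ?_ ?_ ?_)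
  · intro j; fin_cases j <;> simp <;> omega
  · intro j; fin_cases j
    · simpa using hadj
    all_goals { intro a ha hb; simp at ha hb; omega }
  · intro i j hij
    fin_cases i <;> fin_cases j <;> simp at hij ⊢ <;> omega
  · intro e he
    fin_cases he
    · exact ⟨p1, x1, by simpa using hp.1, by simp, a1⟩
    · exact ⟨p2, x2, by simpa using hp.2.1, by simp, a2⟩
    · exact ⟨p3, x3, by simpa using hp.2.2.1, by simp, a3⟩
    · exact ⟨p4, x4, by simpa using hp.2.2.2, by simp, a4⟩

/-- models by single vertices -/
lemma mdl_pts {r : ℕ} (p : Fin r → Fin n) (hp : ∀ i j, i < j → p i ≠ p j) (E : List (Fin r × Fin r))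
    (h : ∀ e ∈ E, G.Adj (p e.1) (p e.2)) : MdlW G (fun j => {p j}) E := by
  refine ⟨fun i j hij => ?_, fun j => connSet_singleton _ _, fun e he => ?_⟩
  · rw [disjoint_singleton]; exact hp i j hij
  · exact ⟨_, mem_singleton_self _, _, mem_singleton_self _, h e he⟩

/-- a path given by a vertex sequence -/
def Pth (G : SimpleGraph (Fin n)) (v : ℕ → Fin n) (L : ℕ) : Prop :=
  (∀ a b, a < L → b < L → v a = v b → a = b) ∧ ∀ a, a + 1 < L → G.Adj (v a) (v (a + 1))

/-- a cycle given by a vertex sequence -/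
def Cyc (G : SimpleGraph (Fin n)) (v : ℕ → Fin n) (q : ℕ) : Prop :=
  Pth G v q ∧ G.Adj (v (q - 1)) (v 0)

lemma Cyc.rot {v : ℕ → Fin n} {q : ℕ} (h : Cyc G v q) (hq : 3 ≤ q) (a : ℕ) :
    Cyc G (fun i => v ((i + a) % q)) q := by
  have hs : ∀ x, G.Adj (v (x % q)) (v ((x + 1) % q)) := by
    intro x
    have hx := Nat.mod_lt x (show 0 < q by omega)
    rw [Nat.add_mod, Nat.mod_eq_of_lt (show 1 < q by omega)]
    rcases Nat.lt_or_ge (x % q + 1) q with h1 | h1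
    · rw [Nat.mod_eq_of_lt h1]; exact h.1.2 _ h1
    · have h2 : x % q = q - 1 := by omega
      rw [h2, show q - 1 + 1 = q by omega, Nat.mod_self]
      exact h.2
  refine ⟨⟨?_, ?_⟩, ?_⟩
  · intro x y hx hy hxy
    have h1 := h.1.1 _ _ (Nat.mod_lt _ (by omega)) (Nat.mod_lt _ (by omega)) hxy
    have h2 : x ≡ y [MOD q] := Nat.ModEq.add_right_cancel' a h1
    rwa [Nat.ModEq, Nat.mod_eq_of_lt hx, Nat.mod_eq_of_lt hy] at h2
  · intro x _
    have := hs (x + a)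
    rwa [show x + a + 1 = x + 1 + a by ring] at this
  · have := hs (q - 1 + a)
    rw [show q - 1 + a + 1 = 0 + a + q by omega, Nat.add_mod_right] at this
    exact this

/-- in a free graph every long cycle spans -/
lemma cyc_no_off (hF : ¬ NF G) {v : ℕ → Fin n} {q : ℕ} (hq : 4 ≤ q) (h : Cyc G v q) {x : Fin n}
    (hx : ∀ i < q, v i ≠ x) {a : ℕ} (ha : a < q) (hax : G.Adj (v a) x) : False := by
  have hr := h.rot (by omega) a
  set c : ℕ → Fin n := fun i => v ((i + a) % q) with hc
  have hc0 : c 0 = v a := by simp [hc, Nat.mod_eq_of_lt ha]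
  set c' : ℕ → Fin n := fun i => if i < q then c i else x with hc'
  have hcc : ∀ i, i < q → c' i = c i := fun i hi => by simp [hc', hi]
  have hcq : c' q = x := by simp [hc']
  apply hF
  refine NF_C4p (mdl c' (q + 1) ?_ ![0, 1, 2, 3, q] ![1, 2, 3, q, q + 1] _ ?_ ?_ ?_ ?_)
  · intro i j hi hj hij
    by_cases h1 : i < q <;> by_cases h2 : j < q
    · rw [hcc i h1, hcc j h2] at hij
      exact hr.1.1 _ _ h1 h2 hij
    · rw [hcc i h1, show j = q by omega, hcq] at hij
      exact absurd hij (hx _ (Nat.mod_lt _ (by omega)))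
    · rw [hcc j h2, show i = q by omega, hcq] at hij
      exact absurd hij.symm (hx _ (Nat.mod_lt _ (by omega)))
    · omega
  · intro j; fin_cases j <;> simp <;> omega
  · intro j; fin_cases j
    all_goals
      intro i hi hj
      simp at hi hj
      try omega
    rw [hcc i (by omega), hcc (i + 1) (by omega)]
    exact hr.1.2 i (by omega)
  · intro i j hij
    fin_cases i <;> fin_cases j <;> simp at hij ⊢ <;> omega
  · intro e he
    fin_cases he
    · refine ⟨0, 1, by simp, by simp, ?_⟩
      rw [hcc _ (by omega), hcc _ (by omega)]; exact hr.1.2 0 (by omega)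
    · refine ⟨1, 2, by simp, by simp, ?_⟩
      rw [hcc _ (by omega), hcc _ (by omega)]; exact hr.1.2 1 (by omega)
    · refine ⟨2, 3, by simp, by simp; omega, ?_⟩
      rw [hcc _ (by omega), hcc _ (by omega)]; exact hr.1.2 2 (by omega)
    · refine ⟨0, q - 1, by simp, by simp; omega, ?_⟩
      rw [hcc _ (by omega), hcc _ (by omega)]; exact hr.2.symm
    · refine ⟨0, q, by simp, by simp, ?_⟩
      rw [hcc _ (by omega), hcq, hc0]; exact hax

lemma cyc_no_chord (hF : ¬ NF G) {v : ℕ → Fin n} {q : ℕ} (h : Cyc G v q) {i j : ℕ}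
    (hij : i + 2 ≤ j) (hj : j < q) (hne : ¬ (i = 0 ∧ j = q - 1)) (hadj : G.Adj (v i) (v j)) : False := by
  have hr := h.rot (by omega) i
  set c : ℕ → Fin n := fun x => v ((x + i) % q) with hc
  have hc0 : c 0 = v i := by simp [hc, Nat.mod_eq_of_lt (show i < q by omega)]
  have hcj : c (j - i) = v j := by
    simp only [hc]
    rw [show j - i + i = j by omega, Nat.mod_eq_of_lt hj]
  rw [← hc0, ← hcj] at hadj
  obtain ⟨d, hd⟩ : ∃ d, d = j - i := ⟨_, rfl⟩
  rw [← hd] at hadj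
  have hd2 : 2 ≤ d := by omega
  have hdq : d + 2 ≤ q := by omega
  apply hF
  refine NF_D (mdl c q hr.1.1 ![0, d, 1, d + 1] ![1, d + 1, d, q] _ ?_ ?_ ?_ ?_)
  · intro j; fin_cases j <;> simp <;> omega
  · intro j; fin_cases j
    all_goals
      intro i hi hj
      simp at hi hj
      try omega
    all_goals exact hr.1.2 i (by omega)
  · intro i j hij
    fin_cases i <;> fin_cases j <;> simp at hij ⊢ <;> omega
  · intro e he
    fin_cases he
    · exact ⟨0, d, by simp, by simp, hadj⟩
    · exact ⟨0, 1, by simp, by simp; omega, hr.1.2 0 (by omega)⟩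
    · exact ⟨0, q - 1, by simp, by simp; omega, hr.2.symm⟩
    · refine ⟨d, d - 1, by simp, by simp; omega, ?_⟩
      have := hr.1.2 (d - 1) (by omega)
      rw [show d - 1 + 1 = d by omega] at this
      exact this.symm
    · exact ⟨d, d + 1, by simp, by simp; omega, hr.1.2 d (by omega)⟩

theorem cyc_case (hG : G.Connected) (hF : ¬ NF G) {v : ℕ → Fin n} {q : ℕ} (hq : 4 ≤ q)
    (h : Cyc G v q) : Nonempty (G ≃g SimpleGraph.cycleGraph q) := by
  have hsurj : ∀ x, ∃ i < q, v i = x := by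
    by_contra hcon
    push Not at hcon
    obtain ⟨x, hx⟩ := hcon
    obtain ⟨a, b, ⟨i, hi, rfl⟩, hb, hab⟩ := cross hG (fun y => ∃ i < q, v i = y) (x := v 0) (y := x)
      ⟨0, by omega, rfl⟩ (by push Not; exact hx)
    push Not at hb
    exact cyc_no_off hF hq h hb hi hab
  obtain ⟨m, rfl⟩ : ∃ m, q = m + 1 := ⟨q - 1, by omega⟩
  have hchord : ∀ i j, i < j → j < m + 1 → G.Adj (v i) (v j) → i + 1 = j ∨ (i = 0 ∧ j = m) := by
    intro i j hij hj hadj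
    by_contra hcon
    exact cyc_no_chord hF h (by omega) hj (by omega) hadj
  have hback : ∀ i j, i < j → j < m + 1 → (i + 1 = j ∨ (i = 0 ∧ j = m)) → G.Adj (v i) (v j) := by
    rintro i j hij hj (rfl | ⟨rfl, rfl⟩)
    · exact h.1.2 i hj
    · exact h.2.symm
  refine isoOf (fun x => v x.val) ⟨?_, ?_⟩ ?_
  · intro x y hxy
    exact Fin.ext (h.1.1 _ _ x.2 y.2 hxy)
  · intro x
    obtain ⟨i, hi, rfl⟩ := hsurj x
    exact ⟨⟨i, hi⟩, rfl⟩
  · intro x y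
    rw [cyc_adj (by omega)]
    have hx := x.2
    have hy := y.2
    rcases lt_trichotomy x.val y.val with hlt | heq | hgt
    · constructor
      · intro hadj
        have := hchord _ _ hlt hy hadj
        omega
      · intro hh
        exact hback _ _ hlt hy (by omega)
    · rw [heq]
      constructor
      · intro hadj; exact absurd rfl hadj.ne
      · omega
    · constructor
      · intro hadj
        have := hchord _ _ hgt hx hadj.symm
        omega
      · intro hh
        exact (hback _ _ hgt hx (by omega)).symm

end Graph
end CSA


namespace CSA

section Graph
variable {n : ℕ} {G : SimpleGraph (Fin n)}

lemma reidx {v : ℕ → Fin n} {M : ℕ} (hinj : ∀ a b, a < M → b < M → v a = v b → a = b) (K : ℕ)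
    (s : ℕ → ℕ) (h1 : ∀ a, a < K → s a < M) (h2 : ∀ a b, a < K → b < K → s a = s b → a = b)
    (h3 : ∀ a, a + 1 < K → G.Adj (v (s a)) (v (s (a + 1)))) : Pth G (fun a => v (s a)) K :=
  ⟨fun a b ha hb h => h2 a b ha hb (hinj _ _ (h1 a ha) (h1 b hb) h), h3⟩

lemma extend {v : ℕ → Fin n} {M : ℕ} (hinj : ∀ a b, a < M → b < M → v a = v b → a = b) {w : Fin n}
    (hw : ∀ a, a < M → v a ≠ w) : ∃ v' : ℕ → Fin n, (∀ a, a < M → v' a = v a) ∧ v' M = w ∧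
      ∀ a b, a < M + 1 → b < M + 1 → v' a = v' b → a = b := by
  have e : ∀ a, a < M → (fun a => if a < M then v a else w) a = v a := fun a ha => if_pos ha
  have e' : (fun a => if a < M then v a else w) M = w := if_neg (lt_irrefl _)
  refine ⟨fun a => if a < M then v a else w, e, e', ?_⟩
  intro a b ha hb h
  rcases Nat.lt_succ_iff_lt_or_eq.1 ha with ha | rfl <;> rcases Nat.lt_succ_iff_lt_or_eq.1 hb with hb | rfl
  · rw [e a ha, e b hb] at h; exact hinj a b ha hb h
  · rw [e a ha, e'] at h; exact absurd h (hw a ha)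
  · rw [e b hb, e'] at h; exact absurd h.symm (hw b hb)
  · rfl

lemma no_long_chord (hC : ∀ v q, 4 ≤ q → ¬ Cyc G v q) {v : ℕ → Fin n} {L : ℕ} (hP : Pth G v L)
    {i j : ℕ} (hj : j < L) (hij : i + 3 ≤ j) : ¬ G.Adj (v i) (v j) := by
  intro h
  refine hC (fun a => v (i + a)) (j - i + 1) (by omega) ⟨reidx hP.1 _ (fun a => i + a) ?_ ?_ ?_, ?_⟩
  · intro a ha; omega
  · intro a b _ _ h; omega
  · intro a ha; exact hP.2 (i + a) (by omega)
  · have e : i + (j - i + 1 - 1) = j := by omega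
    simp only [e]
    exact h.symm

lemma one_chord (hF : ¬ NF G) (hC : ∀ v q, 4 ≤ q → ¬ Cyc G v q) {v : ℕ → Fin n} {L : ℕ}
    (hP : Pth G v L) {i j : ℕ} (hij : i < j) (hj : j + 2 < L)
    (hi : G.Adj (v i) (v (i + 2))) (h : G.Adj (v j) (v (j + 2))) : False := by
  rcases Nat.lt_or_ge (i + 1) j with h1 | h1
  · have e := hP.2 (i + 1) (by omega)
    have e2 := hP.2 j (by omega)
    exact star4 hF v L hP.1 (i + 2) (j + 1) i (i + 1) (j + 1) (j + 2) (i + 2) (i + 2) j j (by omega) (by omega)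
      (by omega) (by omega) (by omega) (fun a _ _ => hP.2 a (by omega)) (by omega) hi.symm e.symm e2 h
  · obtain rfl : j = i + 1 := by omega
    have E : ∀ a b, ((a = i ∧ b = i + 1) ∨ (a = i + 1 ∧ b = i + 3) ∨ (a = i + 3 ∧ b = i + 2) ∨
        (a = i + 2 ∧ b = i)) → G.Adj (v a) (v b) := by
      rintro a b (⟨rfl, rfl⟩ | ⟨rfl, rfl⟩ | ⟨rfl, rfl⟩ | ⟨rfl, rfl⟩)
      · exact hP.2 _ (by omega)
      · exact h
      · exact (hP.2 _ (by omega)).symm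
      · exact hi.symm
    refine hC (fun a => v (if a < 2 then i + a else if a = 2 then i + 3 else i + 2)) 4 le_rfl
      ⟨reidx hP.1 _ (fun a => if a < 2 then i + a else if a = 2 then i + 3 else i + 2) ?_ ?_ ?_, ?_⟩
    · intro a ha; split_ifs <;> omega
    · intro a b ha hb h; split_ifs at h <;> omega
    · intro a ha; apply E; split_ifs <;> omega
    · apply E; simp

theorem case_span (hF : ¬ NF G) (hC : ∀ v q, 4 ≤ q → ¬ Cyc G v q) {v : ℕ → Fin n} {L : ℕ}
    (hP : Pth G v L) (hs : ∀ x, ∃ i < L, v i = x) (hL : 1 ≤ L) :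
    (∃ m : ℕ, Nonempty (G ≃g SimpleGraph.pathGraph m)) ∨
      (∃ m k : ℕ, 1 ≤ k ∧ k < m ∧ Nonempty (G ≃g pathTriangle m k)) := by
  by_cases hch : ∃ i, i + 2 < L ∧ G.Adj (v i) (v (i + 2))
  · right
    obtain ⟨i, hi, hadj⟩ := hch
    have key : ∀ a b, a < b → b < L → (G.Adj (v a) (v b) ↔ (a + 1 = b ∨ (a = i ∧ b = i + 2))) := by
      intro a b hab hb
      constructor
      · intro h
        by_contra hcon
        rcases Nat.lt_or_ge b (a + 3) with h3 | h3
        · obtain rfl : b = a + 2 := by omega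
          rcases lt_trichotomy a i with h4 | h4 | h4
          · exact one_chord hF hC hP h4 hi h hadj
          · omega
          · exact one_chord hF hC hP h4 hb hadj h
        · exact no_long_chord hC hP hb h3 h
      · rintro (rfl | ⟨rfl, rfl⟩)
        · exact hP.2 _ hb
        · exact hadj
    obtain ⟨m, rfl⟩ : ∃ m, L = m + 1 := ⟨L - 1, by omega⟩
    refine ⟨m, i + 1, by omega, by omega, isoOf (fun x => v (if x.val = m then i + 1 else
      if x.val ≤ i then x.val else x.val + 1)) ⟨?_, ?_⟩ ?_⟩
    · intro x y hxy
      have := x.2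
      have := y.2
      have := hP.1 _ _ (by split_ifs <;> omega) (by split_ifs <;> omega) hxy
      ext
      split_ifs at this <;> omega
    · intro x
      obtain ⟨a, ha, rfl⟩ := hs x
      refine ⟨⟨if a = i + 1 then m else if a ≤ i then a else a - 1, by split_ifs <;> omega⟩, ?_⟩
      dsimp only
      congr 1
      split_ifs <;> omega
    · intro x y
      have hx := x.2
      have hy := y.2
      have hx' : (if x.val = m then i + 1 else if x.val ≤ i then x.val else x.val + 1) < m + 1 := by
        split_ifs <;> omega
      have hy' : (if y.val = m then i + 1 else if y.val ≤ i then y.val else y.val + 1) < m + 1 := by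
        split_ifs <;> omega
      rw [pt_adj, Ne, Fin.ext_iff]
      rcases lt_trichotomy (if x.val = m then i + 1 else if x.val ≤ i then x.val else x.val + 1)
        (if y.val = m then i + 1 else if y.val ≤ i then y.val else y.val + 1) with h | h | h
      · rw [key _ _ h hy']; split_ifs at h ⊢ <;> omega
      · rw [h]
        constructor
        · intro hh; exact absurd rfl hh.ne
        · intro hh; exfalso; split_ifs at h <;> omega
      · rw [SimpleGraph.adj_comm, key _ _ h hx']; split_ifs at h ⊢ <;> omega
  · left
    push Not at hch
    have key : ∀ a b, a < b → b < L → (G.Adj (v a) (v b) ↔ a + 1 = b) := by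
      intro a b hab hb
      constructor
      · intro h
        by_contra hcon
        rcases Nat.lt_or_ge b (a + 3) with h3 | h3
        · obtain rfl : b = a + 2 := by omega
          exact hch a hb h
        · exact no_long_chord hC hP hb h3 h
      · rintro rfl
        exact hP.2 _ hb
    refine ⟨L, isoOf (fun x => v x.val) ⟨?_, ?_⟩ ?_⟩
    · intro x y hxy
      exact Fin.ext (hP.1 _ _ x.2 y.2 hxy)
    · intro x
      obtain ⟨a, ha, rfl⟩ := hs x
      exact ⟨⟨a, ha⟩, rfl⟩
    · intro x y
      have hx := x.2
      have hy := y.2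
      rw [SimpleGraph.pathGraph_adj]
      rcases lt_trichotomy x.val y.val with h | h | h
      · rw [key _ _ h hy]; omega
      · rw [h]
        constructor
        · intro hh; exact absurd rfl hh.ne
        · omega
      · rw [SimpleGraph.adj_comm, key _ _ h hx]; omega

end Graph
end CSA


namespace CSA

section Graph
variable {n : ℕ} {G : SimpleGraph (Fin n)}

/-- longest path `v 0, …, v (L-1)` with an extra vertex `v L` attached at `v i` -/
structure Off (G : SimpleGraph (Fin n)) (v : ℕ → Fin n) (L i : ℕ) : Prop where
  pth : Pth G v L
  max : ∀ v', ¬ Pth G v' (L + 1)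
  inj : ∀ a b, a < L + 1 → b < L + 1 → v a = v b → a = b
  lt : i < L
  adj : G.Adj (v i) (v L)

lemma Off.E {v : ℕ → Fin n} {L i : ℕ} (h : Off G v L i) {a b : ℕ}
    (hab : (a + 1 = b ∧ b < L) ∨ (b + 1 = a ∧ a < L) ∨ (a = i ∧ b = L) ∨ (a = L ∧ b = i)) :
    G.Adj (v a) (v b) := by
  rcases hab with ⟨rfl, h1⟩ | ⟨rfl, h1⟩ | ⟨rfl, rfl⟩ | ⟨rfl, rfl⟩
  · exact h.pth.2 _ h1
  · exact (h.pth.2 _ h1).symm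
  · exact h.adj
  · exact h.adj.symm

lemma Off.pos {v : ℕ → Fin n} {L i : ℕ} (h : Off G v L i) : 0 < i := by
  by_contra hi
  refine h.max _ (reidx h.inj _ (fun a => if a = 0 then L else a - 1) ?_ ?_ ?_)
  · intro a ha; split_ifs <;> omega
  · intro a b ha hb h; split_ifs at h <;> omega
  · intro a ha; apply h.E; have := h.lt; split_ifs <;> (first | contradiction | omega)

lemma Off.lt' {v : ℕ → Fin n} {L i : ℕ} (h : Off G v L i) : i + 1 < L := by
  by_contra hi
  refine h.max _ (reidx h.inj _ (fun a => a) ?_ ?_ ?_)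
  · intro a ha; omega
  · intro a b ha hb h; omega
  · intro a ha; apply h.E; have := h.lt; omega

lemma Off.uniq_aux (hC : ∀ v q, 4 ≤ q → ¬ Cyc G v q) {v : ℕ → Fin n} {L i j : ℕ} (h : Off G v L i)
    (hij : i < j) (hj : j < L) : ¬ G.Adj (v j) (v L) := by
  intro hadj
  have E : ∀ a b, ((a + 1 = b ∧ b < L) ∨ (a = i ∧ b = L) ∨ (a = L ∧ b = i) ∨ (a = j ∧ b = L) ∨
      (a = L ∧ b = j)) → G.Adj (v a) (v b) := by
    rintro a b (h1 | h1 | h1 | ⟨rfl, rfl⟩ | ⟨rfl, rfl⟩)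
    · exact h.E (by omega)
    · exact h.E (by omega)
    · exact h.E (by omega)
    · exact hadj
    · exact hadj.symm
  rcases Nat.lt_or_ge (i + 1) j with h1 | h1
  · refine hC (fun a => v (if a < j - i + 1 then i + a else L)) (j - i + 2) (by omega)
      ⟨reidx h.inj _ (fun a => if a < j - i + 1 then i + a else L) ?_ ?_ ?_, ?_⟩
    · intro a ha; split_ifs <;> omega
    · intro a b ha hb h; split_ifs at h <;> omega
    · intro a ha; apply E; split_ifs <;> omega
    · apply E; split_ifs <;> omega
  · refine h.max _ (reidx h.inj _ (fun a => if a ≤ i then a else if a = i + 1 then L else a - 1) ?_ ?_ ?_)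
    · intro a ha; split_ifs <;> omega
    · intro a b ha hb h; split_ifs at h <;> omega
    · intro a ha; apply E; split_ifs <;> omega

lemma Off.uniq (hC : ∀ v q, 4 ≤ q → ¬ Cyc G v q) {v : ℕ → Fin n} {L i j : ℕ} (h : Off G v L i)
    (hj : j < L) (hadj : G.Adj (v j) (v L)) : j = i := by
  rcases lt_trichotomy i j with h1 | h1 | h1
  · exact absurd hadj (h.uniq_aux hC h1 hj)
  · exact h1.symm
  · exact absurd h.adj (Off.uniq_aux hC ⟨h.pth, h.max, h.inj, hj, hadj⟩ h1 h.lt)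

lemma Off.no_chord (hF : ¬ NF G) {v : ℕ → Fin n} {L i j : ℕ} (h : Off G v L i)
    (hj : j + 2 < L) : ¬ G.Adj (v j) (v (j + 2)) := by
  intro hadj
  have h0 := h.pos
  have h1 := h.lt'
  have E : ∀ a b, ((a + 1 = b ∧ b < L) ∨ (b + 1 = a ∧ a < L) ∨ (a = i ∧ b = L) ∨ (a = L ∧ b = i) ∨
      (a = j ∧ b = j + 2) ∨ (a = j + 2 ∧ b = j)) → G.Adj (v a) (v b) := by
    rintro a b (h1 | h1 | h1 | h1 | ⟨rfl, rfl⟩ | ⟨rfl, rfl⟩)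
    · exact h.E (by omega)
    · exact h.E (by omega)
    · exact h.E (by omega)
    · exact h.E (by omega)
    · exact hadj
    · exact hadj.symm
  rcases lt_trichotomy (j + 1) i with h2 | h2 | h2
  · exact star4 hF v (L + 1) h.inj (j + 2) (i + 1) j (j + 1) (i + 1) L (j + 2) (j + 2) i i (by omega)
      (by omega) (by omega) (by omega) (by omega) (fun a _ _ => E _ _ (by omega)) (by omega)
      (E _ _ (by omega)) (E _ _ (by omega)) (E _ _ (by omega)) (E _ _ (by omega))
  · subst h2
    rcases Nat.eq_zero_or_pos j with rfl | hj0
    · refine h.max _ (reidx h.inj _ (fun a => if a = 0 then L else if a = 1 then 1 else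
        if a = 2 then 0 else a - 1) ?_ ?_ ?_)
      · intro a ha; split_ifs <;> omega
      · intro a b ha hb h; split_ifs at h <;> omega
      · intro a ha; apply E; split_ifs <;> (first | contradiction | omega)
    rcases Nat.lt_or_ge (j + 3) L with h3 | h3
    · refine hF (NF_net (mdl_pts (fun k => v (![j + 1, j, j + 2, L, j - 1, j + 3] k)) ?_ _ ?_))
      · intro a b hab hh
        have := h.inj _ _ (by fin_cases a <;> simp <;> omega) (by fin_cases b <;> simp <;> omega) hh
        fin_cases a <;> fin_cases b <;> simp at hab this <;> omega
      · intro e he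
        apply E
        fin_cases he <;> simp <;> omega
    · refine h.max _ (reidx h.inj _ (fun a => if a = j + 1 then j + 2 else if a = j + 2 then j + 1
        else a) ?_ ?_ ?_)
      · intro a ha; split_ifs <;> omega
      · intro a b ha hb h; split_ifs at h <;> omega
      · intro a ha; apply E; split_ifs <;> omega
  · exact star4 hF v (L + 1) h.inj i (j + 1) L (i - 1) (j + 1) (j + 2) i i j j (by omega)
      (by omega) (by omega) (by omega) (by omega) (fun a _ _ => E _ _ (by omega)) (by omega)
      (E _ _ (by omega)) (E _ _ (by omega)) (E _ _ (by omega)) (E _ _ (by omega))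

lemma Off.two_aux (hF : ¬ NF G) {v : ℕ → Fin n} {L i j : ℕ} (h : Off G v L i)
    (hinj : ∀ a b, a < L + 2 → b < L + 2 → v a = v b → a = b) (h1 : j + 1 < L) (hj : 0 < j)
    (hadj : G.Adj (v j) (v (L + 1))) : False := by
  have h0 := h.pos
  have h2 := h.lt'
  have E : ∀ a b, ((a + 1 = b ∧ b < L) ∨ (b + 1 = a ∧ a < L) ∨ (a = i ∧ b = L) ∨
      (a = j ∧ b = L + 1)) → G.Adj (v a) (v b) := by
    rintro a b (h1 | h1 | h1 | ⟨rfl, rfl⟩)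
    · exact h.E (by omega)
    · exact h.E (by omega)
    · exact h.E (by omega)
    · exact hadj
  rcases Nat.le_total i j with h3 | h3
  · exact star4 hF v (L + 2) hinj i (j + 1) (i - 1) (j + 1) L (L + 1) i j i j (by omega)
      (by omega) (by omega) (by omega) (by omega) (fun a _ _ => E _ _ (by omega)) (by omega)
      (E _ _ (by omega)) (E _ _ (by omega)) (E _ _ (by omega)) (E _ _ (by omega))
  · exact star4 hF v (L + 2) hinj j (i + 1) (j - 1) (i + 1) L (L + 1) j i i j (by omega)
      (by omega) (by omega) (by omega) (by omega) (fun a _ _ => E _ _ (by omega)) (by omega)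
      (E _ _ (by omega)) (E _ _ (by omega)) (E _ _ (by omega)) (E _ _ (by omega))

lemma Off.two_aux' (hF : ¬ NF G) {v : ℕ → Fin n} {L i : ℕ} (h : Off G v L i)
    (hinj : ∀ a b, a < L + 2 → b < L + 2 → v a = v b → a = b)
    (hadj : G.Adj (v L) (v (L + 1))) : False := by
  have h0 := h.pos
  have h2 := h.lt'
  have E : ∀ a b, ((a + 1 = b ∧ b < L) ∨ (b + 1 = a ∧ a < L) ∨ (a = i ∧ b = L) ∨ (a = L ∧ b = i) ∨
      (a = L ∧ b = L + 1) ∨ (a = L + 1 ∧ b = L)) → G.Adj (v a) (v b) := by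
    rintro a b (h1 | h1 | h1 | h1 | ⟨rfl, rfl⟩ | ⟨rfl, rfl⟩)
    · exact h.E (by omega)
    · exact h.E (by omega)
    · exact h.E (by omega)
    · exact h.E (by omega)
    · exact hadj
    · exact hadj.symm
  rcases Nat.eq_or_lt_of_le (Nat.succ_le_of_lt h0) with hi1 | hi1
  · refine h.max _ (reidx hinj _ (fun a => if a = 0 then L + 1 else if a = 1 then L else a - 1) ?_ ?_ ?_)
    · intro a ha; split_ifs <;> omega
    · intro a b ha hb h; split_ifs at h <;> omega
    · intro a ha; apply E; split_ifs <;> (first | contradiction | omega)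
  rcases Nat.lt_or_ge (i + 2) L with h3 | h3
  · refine hF (NF_S222 (mdl_pts (fun k => v (![i, L, L + 1, i - 1, i - 2, i + 1, i + 2] k)) ?_ _ ?_))
    · intro a b hab hh
      have := hinj _ _ (by fin_cases a <;> simp <;> omega) (by fin_cases b <;> simp <;> omega) hh
      fin_cases a <;> fin_cases b <;> simp at hab this <;> omega
    · intro e he
      apply E
      fin_cases he <;> simp <;> omega
  · refine h.max _ (reidx hinj _ (fun a => if a ≤ i then a else a + 1) ?_ ?_ ?_)
    · intro a ha; split_ifs <;> omega
    · intro a b ha hb h; split_ifs at h <;> omega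
    · intro a ha; apply E; split_ifs <;> omega

end Graph
end CSA


namespace CSA

section Graph
variable {n : ℕ} {G : SimpleGraph (Fin n)}

lemma Off.span (hG : G.Connected) (hF : ¬ NF G) {v : ℕ → Fin n} {L i : ℕ}
    (h : Off G v L i) : ∀ x, ∃ a < L + 1, v a = x := by
  by_contra hcon
  push Not at hcon
  obtain ⟨x, hx⟩ := hcon
  obtain ⟨_, u, ⟨a, ha, rfl⟩, hu, hadj⟩ := cross hG (fun y => ∃ a < L + 1, v a = y) (x := v 0) (y := x)
    ⟨0, by omega, rfl⟩ (by push Not; exact hx)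
  push Not at hu
  obtain ⟨v', h1, h2, h3⟩ := extend h.inj hu
  have hlt := h.lt
  have hP : Pth G v' L := by
    refine ⟨fun a b ha hb => h3 a b (by omega) (by omega), fun a ha => ?_⟩
    rw [h1 a (by omega), h1 (a + 1) (by omega)]
    exact h.pth.2 a ha
  have hO : Off G v' L i := by
    refine ⟨hP, h.max, fun a b ha hb => h3 a b (by omega) (by omega), h.lt, ?_⟩
    rw [h1 i (by omega), h1 L (by omega)]
    exact h.adj
  rw [← h1 a ha, ← h2] at hadj
  rcases Nat.lt_succ_iff_lt_or_eq.1 ha with haL | rfl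
  · obtain ⟨v2, g1, g2, g3⟩ := extend (w := u) h.pth.1 (fun a ha => hu a (by omega))
    have hO2 : Off G v2 L a := by
      refine ⟨⟨fun a b ha hb => g3 a b (by omega) (by omega), fun a ha => ?_⟩, h.max, g3, haL, ?_⟩
      · rw [g1 a (by omega), g1 (a + 1) (by omega)]
        exact h.pth.2 a ha
      · rw [g1 a haL, g2]
        rwa [h1 a ha, h2] at hadj
    exact hO.two_aux hF h3 hO2.lt' hO2.pos hadj
  · exact hO.two_aux' hF h3 hadj

theorem Off.iso (hG : G.Connected) (hF : ¬ NF G) (hC : ∀ v q, 4 ≤ q → ¬ Cyc G v q) {v : ℕ → Fin n}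
    {L i : ℕ} (h : Off G v L i) : Nonempty (G ≃g almostPath L (i + 1)) := by
  have key : ∀ a b, a < b → b < L + 1 → (G.Adj (v a) (v b) ↔ ((a + 1 = b ∧ b < L) ∨ (a = i ∧ b = L))) := by
    intro a b hab hb
    constructor
    · intro hadj
      rcases Nat.lt_succ_iff_lt_or_eq.1 hb with hb | rfl
      · by_contra hcon
        rcases Nat.lt_or_ge b (a + 3) with h3 | h3
        · obtain rfl : b = a + 2 := by omega
          exact h.no_chord hF hb hadj
        · exact no_long_chord hC h.pth hb h3 hadj
      · exact Or.inr ⟨h.uniq hC hab hadj, rfl⟩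
    · intro hh; exact h.E (by omega)
  refine isoOf (fun x => v x.val) ⟨?_, ?_⟩ ?_
  · intro x y hxy
    exact Fin.ext (h.inj _ _ x.2 y.2 hxy)
  · intro x
    obtain ⟨a, ha, rfl⟩ := h.span hG hF x
    exact ⟨⟨a, ha⟩, rfl⟩
  · intro x y
    have hx := x.2
    have hy := y.2
    have hi := h.lt
    rw [ap_adj, Ne, Fin.ext_iff]
    rcases lt_trichotomy x.val y.val with h | h | h
    · rw [key _ _ h hy]; omega
    · rw [h]
      constructor
      · intro hh; exact absurd rfl hh.ne
      · omega
    · rw [SimpleGraph.adj_comm, key _ _ h hx]; omega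

theorem classify (hG : G.Connected) (hF : ¬ NF G) :
    ((∃ m : ℕ, Nonempty (G ≃g SimpleGraph.pathGraph m)) ∨
       (∃ m : ℕ, 3 ≤ m ∧ Nonempty (G ≃g SimpleGraph.cycleGraph m)) ∨
       (∃ m k : ℕ, 1 < k ∧ k < m ∧ Nonempty (G ≃g almostPath m k)) ∨
       (∃ m k : ℕ, 1 ≤ k ∧ k < m ∧ Nonempty (G ≃g pathTriangle m k))) := by
  classical
  by_cases hC : ∃ v q, 4 ≤ q ∧ Cyc G v q
  · obtain ⟨v, q, hq, h⟩ := hC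
    exact Or.inr (Or.inl ⟨q, by omega, cyc_case hG hF hq h⟩)
  push Not at hC
  have hbd : ∀ L, (∃ v, Pth G v L) → L ≤ n := by
    rintro L ⟨v, h⟩
    have : Function.Injective (fun x : Fin L => v x.val) := fun x y hxy =>
      Fin.ext (h.1 _ _ x.2 y.2 hxy)
    simpa using Fintype.card_le_of_injective _ this
  obtain ⟨x0⟩ := hG.nonempty
  have h1 : ∃ v, Pth G v 1 := ⟨fun _ => x0, fun a b ha hb _ => by omega, fun a ha => by omega⟩
  have hn := hbd 1 h1
  obtain ⟨L, hL⟩ : ∃ L, L = Nat.findGreatest (fun L => ∃ v, Pth G v L) n := ⟨_, rfl⟩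
  have hspec : ∃ v, Pth G v L := by
    rw [hL]; exact Nat.findGreatest_spec (P := fun L => ∃ v, Pth G v L) hn h1
  have hL1 : 1 ≤ L := by
    rw [hL]; exact Nat.le_findGreatest (P := fun L => ∃ v, Pth G v L) hn h1
  have hmax : ∀ v', ¬ Pth G v' (L + 1) := by
    intro v' hv'
    have := Nat.le_findGreatest (P := fun L => ∃ v, Pth G v L) (hbd _ ⟨v', hv'⟩) ⟨v', hv'⟩
    omega
  obtain ⟨v, hv⟩ := hspec
  by_cases hs : ∀ x, ∃ i < L, v i = x
  · rcases case_span hF hC hv hs hL1 with h | h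
    · exact Or.inl h
    · exact Or.inr (Or.inr (Or.inr h))
  · push Not at hs
    obtain ⟨x, hx⟩ := hs
    obtain ⟨_, w, ⟨i, hi, rfl⟩, hw, hadj⟩ := cross hG (fun y => ∃ a < L, v a = y) (x := v 0) (y := x)
      ⟨0, by omega, rfl⟩ (by push Not; exact hx)
    push Not at hw
    obtain ⟨v', g1, g2, g3⟩ := extend hv.1 hw
    have hO : Off G v' L i := by
      refine ⟨⟨fun a b ha hb => g3 a b (by omega) (by omega), fun a ha => ?_⟩, hmax, g3, hi, ?_⟩
      · rw [g1 a (by omega), g1 (a + 1) (by omega)]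
        exact hv.2 a ha
      · rw [g1 i hi, g2]
        exact hadj
    have := hO.pos
    exact Or.inr (Or.inr (Or.inl ⟨L, i + 1, by omega, hO.lt', hO.iso hG hF hC⟩))

theorem main (hG : G.Connected) :
    Module.Free (MvPolynomial (Fin n) ℚ) (derModule G) ↔
      ((∃ m : ℕ, Nonempty (G ≃g SimpleGraph.pathGraph m)) ∨
       (∃ m : ℕ, 3 ≤ m ∧ Nonempty (G ≃g SimpleGraph.cycleGraph m)) ∨
       (∃ m k : ℕ, 1 < k ∧ k < m ∧ Nonempty (G ≃g almostPath m k)) ∨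
       (∃ m k : ℕ, 1 ≤ k ∧ k < m ∧ Nonempty (G ≃g pathTriangle m k))) := by
  constructor
  · intro h
    exact classify hG (fun hN => hN h)
  · rintro (⟨m, ⟨e⟩⟩ | ⟨m, hm, ⟨e⟩⟩ | ⟨m, k, h1, h2, ⟨e⟩⟩ | ⟨m, k, h1, h2, ⟨e⟩⟩)
    · obtain ⟨x0⟩ := hG.nonempty
      obtain ⟨m, rfl⟩ : ∃ m', m = m' + 1 := ⟨m - 1, by have := (e x0).2; omega⟩
      exact (SD.of_iso e (SD_path m)).free
    · obtain ⟨m, rfl⟩ : ∃ m', m = m' + 1 := ⟨m - 1, by omega⟩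
      exact (SD.of_iso e (SD_cycle (by omega))).free
    · exact (SD.of_iso e (SD_almostPath (by omega) (by omega))).free
    · exact (SD.of_iso e (SD_pathTriangle h1 h2)).free

end Graph
end CSA

/-- For a finite connected simple graph `G`, the connected subgraph
arrangement `𝒜_G` over `ℚ` is free (its module of `𝒜_G`-derivations is a free module
over `ℚ[x_1,…,x_n]`) if and only if `G` is a path graph, a cycle graph `C_m` with
`m ≥ 3`, an almost path graph `A_{m,k}` with `1 < k < m`, or a path-with-triangle
graph `Δ_{m,k}` with `1 ≤ k < m`. -/
theorem csa_free_iff {n : ℕ} (G : SimpleGraph (Fin n)) (hG : G.Connected) :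
    Module.Free (MvPolynomial (Fin n) ℚ) (derModule G) ↔
      ((∃ m : ℕ, Nonempty (G ≃g SimpleGraph.pathGraph m)) ∨
       (∃ m : ℕ, 3 ≤ m ∧ Nonempty (G ≃g SimpleGraph.cycleGraph m)) ∨
       (∃ m k : ℕ, 1 < k ∧ k < m ∧ Nonempty (G ≃g almostPath m k)) ∨
       (∃ m k : ℕ, 1 ≤ k ∧ k < m ∧ Nonempty (G ≃g pathTriangle m k))) := by
  exact CSA.main hG
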